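/- arXiv:1307.3582 — 3 statements merged into one kernel-verified Lean document; each statement's English description precedes it below -/
import Mathlib

section
/- Let 0 < c ≤ 1 and let 𝓔 ⊆ T_n(2) be a family of 2-simplices of T_n with |𝓔| ≥ c·n³. Then there exists n_0(c) such that for all n ≥ n_0(c), a uniformly random Latin square L of order n satisfies P[ f_𝓔(L) < 10^{-3}·c²·n² ] < e^{−10^{-3}·c²·n²}. -/
open Finset
open scoped Classical

noncomputable section

/-- A Latin square of order `n`: an `n`-tuple `(π_1,…,π_n)` of permutations of `[n]`
such that `π_i ∘ π_j⁻¹` is fixed-point-free for all `i ≠ j`. -/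
def IsLatinSquare {n : ℕ} (L : Fin n → Equiv.Perm (Fin n)) : Prop :=
  ∀ i j : Fin n, i ≠ j → ∀ x : Fin n, L i x ≠ L j x

/-- The (finite) space of Latin squares of order `n`. -/
abbrev LatinSquare (n : ℕ) := {L : Fin n → Equiv.Perm (Fin n) // IsLatinSquare L}

/-- For a family `𝓔` of `2`-simplices of `T_n` (encoded as triples of indices
`(i,j,k)` standing for `[a_i, b_j, c_k]`), `f_𝓔(L) = |Y(L)(2) ∩ 𝓔|` is the number of
`2`-simplices `[a_i, b_j, c_{π_i(j)}]` of `Y(L)` lying in `𝓔`. -/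
def fE {n : ℕ} (E : Finset (Fin n × Fin n × Fin n)) (L : LatinSquare n) : ℕ :=
  (univ.filter fun p : Fin n × Fin n => (p.1, p.2, (L.1 p.1) p.2) ∈ E).card

structure LSGood {n : ℕ} (p : MvPolynomial (Fin n) ℝ) (d : ℕ) : Prop where
  hom : p.IsHomogeneous d
  pos : ∀ m : Fin n →₀ ℕ, m.degree = d → 0 < p.coeff m
  stab : ∀ z : Fin n → ℂ, (∀ i, 0 < (z i).re) → MvPolynomial.aeval z p ≠ 0

lemma LSGood.nonneg {n : ℕ} {p : MvPolynomial (Fin n) ℝ} {d : ℕ} (h : LSGood p d)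
    (m : Fin n →₀ ℕ) : 0 ≤ p.coeff m := by
  by_cases hm : m.degree = d
  · exact (h.pos m hm).le
  · rw [h.hom.coeff_eq_zero hm]

lemma LSGood.eval_ge {n : ℕ} {p : MvPolynomial (Fin n) ℝ} {d : ℕ} (h : LSGood p d)
    (x : Fin n → ℝ) (hx : ∀ i, 0 ≤ x i) (m : Fin n →₀ ℕ) :
    p.coeff m * ∏ i, x i ^ m i ≤ MvPolynomial.eval x p := by
  rw [MvPolynomial.eval_eq']
  have hn : ∀ m' : Fin n →₀ ℕ, 0 ≤ p.coeff m' * ∏ i, x i ^ m' i := fun m' =>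
    mul_nonneg (h.nonneg m') (Finset.prod_nonneg fun i _ => pow_nonneg (hx i) _)
  by_cases hm : m ∈ p.support
  · exact Finset.single_le_sum (f := fun m' => p.coeff m' * ∏ i, x i ^ m' i)
      (fun i _ => hn i) hm
  · rw [MvPolynomial.notMem_support_iff.mp hm, zero_mul]
    exact Finset.sum_nonneg fun i _ => hn i

lemma aeval_ofReal {n : ℕ} (p : MvPolynomial (Fin n) ℝ) (x : Fin n → ℝ) :
    MvPolynomial.aeval (fun i => (x i : ℂ)) p = ((MvPolynomial.eval x p : ℝ) : ℂ) := by
  have := MvPolynomial.aeval_algebraMap_apply (A := ℝ) ℂ x p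
  simpa [Function.comp_def] using this

lemma aeval_smul_hom {n : ℕ} {p : MvPolynomial (Fin n) ℝ} {d : ℕ} (h : p.IsHomogeneous d)
    (s : ℂ) (z : Fin n → ℂ) :
    MvPolynomial.aeval (fun i => s * z i) p = s ^ d * MvPolynomial.aeval z p := by
  rw [MvPolynomial.aeval_def, MvPolynomial.aeval_def, MvPolynomial.eval₂_eq',
    MvPolynomial.eval₂_eq', Finset.mul_sum]
  refine Finset.sum_congr rfl fun m hm => ?_
  have hd : m.degree = d := by
    by_contra hne
    exact MvPolynomial.mem_support_iff.mp hm (h.coeff_eq_zero hne)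
  simp only [mul_pow, Finset.prod_mul_distrib]
  rw [Finset.prod_pow_eq_pow_sum, ← hd, Finsupp.degree_eq_sum]
  ring

/-- restriction of a polynomial to a line -/
def lineP {n : ℕ} (p : MvPolynomial (Fin n) ℝ) (w v : Fin n → ℂ) : Polynomial ℂ :=
  MvPolynomial.aeval (fun i => Polynomial.C (w i) + Polynomial.C (v i) * Polynomial.X) p

lemma eval_lineP {n : ℕ} (p : MvPolynomial (Fin n) ℝ) (w v : Fin n → ℂ) (t : ℂ) :
    (lineP p w v).eval t = MvPolynomial.aeval (fun i => w i + t * v i) p := by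
  unfold lineP
  induction p using MvPolynomial.induction_on with
  | C a =>
    simp [Polynomial.algebraMap_apply]
  | add p q hp hq => simp [hp, hq]
  | mul_X p i hp => simp [hp, mul_comm t]

lemma derivative_lineP {n : ℕ} (p : MvPolynomial (Fin n) ℝ) (w : Fin n → ℂ) (j : Fin n) :
    (lineP p w (Pi.single j 1)).derivative = lineP (MvPolynomial.pderiv j p) w (Pi.single j 1) := by
  unfold lineP
  induction p using MvPolynomial.induction_on with
  | C a => simp [Polynomial.algebraMap_apply]
  | add p q hp hq => simp [hp, hq]
  | mul_X p i hp =>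
    simp only [map_mul, Polynomial.derivative_mul, hp, MvPolynomial.pderiv_mul, map_add,
      MvPolynomial.aeval_X, MvPolynomial.pderiv_X]
    by_cases hij : i = j
    · subst hij; simp
    · simp [Pi.single_apply, hij]

lemma lineP_nonconst {n : ℕ} {p : MvPolynomial (Fin n) ℝ} {d : ℕ} (h : LSGood p (d + 1))
    (z : Fin n → ℂ) (j : Fin n) (c : ℂ) : lineP p z (Pi.single j 1) ≠ Polynomial.C c := by
  intro hc
  have hev : ∀ t : ℂ, MvPolynomial.aeval (fun i => z i + t * (Pi.single j 1 : Fin n → ℂ) i) p = c := by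
    intro t; rw [← eval_lineP, hc]; simp
  have h2 : lineP p (Pi.single j 1) z = Polynomial.C c * Polynomial.X ^ (d + 1) := by
    apply Polynomial.eq_of_infinite_eval_eq
    apply Set.Infinite.mono (s := {s : ℂ | s ≠ 0})
    · intro s hs
      have hs : s ≠ 0 := hs
      simp only [Set.mem_ofPred_eq, eval_lineP]
      have := aeval_smul_hom h.hom s (fun i => z i + s⁻¹ * (Pi.single j 1 : Fin n → ℂ) i)
      rw [hev] at this
      have e : (fun i => (Pi.single j 1 : Fin n → ℂ) i + s * z i) =
          fun i => s * (z i + s⁻¹ * (Pi.single j 1 : Fin n → ℂ) i) := by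
        funext i; field_simp; ring
      rw [e, this]; simp [mul_comm c]
    · exact (Set.finite_singleton (0 : ℂ)).infinite_compl
  have h3 := congrArg (Polynomial.eval 0) h2
  rw [eval_lineP] at h3
  have e : (fun i => (Pi.single j 1 : Fin n → ℂ) i + 0 * z i) =
      fun i => (((Pi.single j 1 : Fin n → ℝ) i : ℝ) : ℂ) := by
    funext i; by_cases hij : i = j
    · subst hij; simp
    · simp [hij]
  rw [e, aeval_ofReal] at h3
  have h4 := h.eval_ge (Pi.single j 1) (fun i => by
    by_cases hij : i = j
    · subst hij; simp
    · simp [hij]) (Finsupp.single j (d + 1))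
  have h5 := h.pos (Finsupp.single j (d + 1)) (by simp)
  have h6 : (∏ i, (Pi.single j 1 : Fin n → ℝ) i ^ (Finsupp.single j (d + 1)) i) = 1 := by
    apply Finset.prod_eq_one
    intro i _
    by_cases hij : i = j
    · subst hij; simp
    · simp [hij]
  rw [h6] at h4
  simp at h3
  linarith

lemma lineP_roots_re {n : ℕ} {p : MvPolynomial (Fin n) ℝ} {d : ℕ} (h : LSGood p d)
    (z : Fin n → ℂ) (hz : ∀ i, 0 < (z i).re) (j : Fin n) (t : ℂ)
    (ht : (lineP p z (Pi.single j 1)).eval t = 0) : t.re < 0 := by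
  by_contra hcon
  push Not at hcon
  rw [eval_lineP] at ht
  refine h.stab _ (fun i => ?_) ht
  by_cases hij : i = j
  · subst hij; simp; linarith [hz i]
  · simp [hij, hz i]

lemma LSGood.pderiv {n : ℕ} {p : MvPolynomial (Fin n) ℝ} {d : ℕ} (h : LSGood p (d + 1))
    (j : Fin n) : LSGood (MvPolynomial.pderiv j p) d where
  hom := by
    intro m hm
    rw [MvPolynomial.coeff_pderiv] at hm
    have h1 := left_ne_zero_of_mul hm
    change Finsupp.weight (fun _ => 1) m = d
    rw [← Finsupp.degree_eq_weight_one]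
    by_contra hne
    exact h1 (h.hom.coeff_eq_zero (by simpa using hne))
  pos := by
    intro m hm
    rw [MvPolynomial.coeff_pderiv]
    have := h.pos (m + Finsupp.single j 1) (by simp [hm])
    positivity
  stab := by
    intro z hz h0
    set g := lineP p z (Pi.single j 1) with hg
    have h1 : g.derivative.eval 0 = 0 := by
      rw [hg, derivative_lineP, eval_lineP]
      simpa using h0
    have hdeg : 0 < g.degree := by
      by_contra hcon
      push Not at hcon
      exact lineP_nonconst h z j _ (Polynomial.eq_C_of_degree_le_zero hcon)
    have h2 := Polynomial.rootSet_derivative_subset_convexHull_rootSet hdeg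
    have h3 : (0 : ℂ) ∈ g.derivative.rootSet ℂ := by
      rw [Polynomial.mem_rootSet]
      refine ⟨fun hd => ?_, by simpa [Polynomial.coe_aeval_eq_eval] using h1⟩
      have := Polynomial.derivative_eq_zero.mp hd
      rw [Polynomial.natDegree_eq_zero_iff_degree_le_zero] at this
      exact absurd hdeg (not_lt.mpr this)
    have h4 : convexHull ℝ (g.rootSet ℂ) ⊆ {w : ℂ | w.re < 0} := by
      apply convexHull_min
      · intro w hw
        rw [Polynomial.mem_rootSet, Polynomial.coe_aeval_eq_eval] at hw
        exact lineP_roots_re h z hz j w hw.2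
      · exact convex_halfSpace_re_lt 0
    have := h4 (h2 h3)
    simp at this

lemma multiset_bound (t : ℝ) (ht : 0 ≤ t) (S : Multiset ℂ)
    (hS : ∀ r ∈ S, r.im = 0 ∧ r.re < 0) :
    ‖(S.map (fun r => (t : ℂ) - r)).prod‖ ≤ ‖(S.map (fun r => (0 : ℂ) - r)).prod‖ *
      Real.exp (t * ((S.map (fun r => 1 / ((0 : ℂ) - r))).sum).re) := by
  induction S using Multiset.induction with
  | empty => simp
  | cons r S ih =>
    have ih := ih (fun r hr => hS r (Multiset.mem_cons_of_mem hr))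
    obtain ⟨him, hre⟩ := hS r (Multiset.mem_cons_self r S)
    obtain ⟨ρ, hρ, rfl⟩ : ∃ ρ : ℝ, 0 < ρ ∧ r = ((-ρ : ℝ) : ℂ) :=
      ⟨-r.re, by linarith, Complex.ext (by simp) (by simp [him])⟩
    simp only [Multiset.map_cons, Multiset.prod_cons, Multiset.sum_cons, norm_mul, Complex.add_re,
      mul_add, Real.exp_add]
    have h1 : ‖(t : ℂ) - ((-ρ : ℝ) : ℂ)‖ = t + ρ := by
      rw [← Complex.ofReal_sub, Complex.norm_real, Real.norm_eq_abs, abs_of_nonneg] <;> linarith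
    have h2 : ‖(0 : ℂ) - ((-ρ : ℝ) : ℂ)‖ = ρ := by
      rw [← Complex.ofReal_zero, ← Complex.ofReal_sub, Complex.norm_real, Real.norm_eq_abs,
        abs_of_nonneg] <;> linarith
    have h3 : (1 / ((0 : ℂ) - ((-ρ : ℝ) : ℂ))).re = 1 / ρ := by
      rw [← Complex.ofReal_zero, ← Complex.ofReal_sub, ← Complex.ofReal_one, ← Complex.ofReal_div,
        Complex.ofReal_re]
      simp
    rw [h1, h2, h3]
    have h4 : t + ρ ≤ ρ * Real.exp (t * (1 / ρ)) := by
      have := Real.add_one_le_exp (t * (1 / ρ))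
      calc t + ρ = ρ * (t * (1 / ρ) + 1) := by field_simp
        _ ≤ _ := by gcongr
    calc _ ≤ (ρ * Real.exp (t * (1 / ρ))) * _ := mul_le_mul h4 ih (norm_nonneg _) (by positivity)
      _ = _ := by ring

lemma LSGood.exp_bound {n : ℕ} {p : MvPolynomial (Fin n) ℝ} {d : ℕ} (h : LSGood p d)
    (j : Fin n) (x : Fin n → ℝ) (hx : ∀ i, 0 < x i) (hp : 0 < MvPolynomial.eval x p)
    (t : ℝ) (ht : 0 ≤ t) :
    MvPolynomial.eval (fun i => x i + t * (Pi.single j 1 : Fin n → ℝ) i) p ≤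
      MvPolynomial.eval x p *
        Real.exp (t * (MvPolynomial.eval x (MvPolynomial.pderiv j p) / MvPolynomial.eval x p)) := by
  set g := lineP p (fun i => (x i : ℂ)) (Pi.single j 1) with hg
  have hval : ∀ t : ℝ, g.eval (t : ℂ) =
      ((MvPolynomial.eval (fun i => x i + t * (Pi.single j 1 : Fin n → ℝ) i) p : ℝ) : ℂ) := by
    intro t
    rw [hg, eval_lineP, ← aeval_ofReal]
    congr 2
    funext i
    by_cases hij : i = j
    · subst hij; simp
    · simp [hij]
  have hval0 : g.eval 0 = ((MvPolynomial.eval x p : ℝ) : ℂ) := by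
    have := hval 0
    simpa using this
  have hder : g.derivative.eval 0 = ((MvPolynomial.eval x (MvPolynomial.pderiv j p) : ℝ) : ℂ) := by
    rw [hg, derivative_lineP, eval_lineP, ← aeval_ofReal]
    simp
  have hg0 : g.eval 0 ≠ 0 := by
    rw [hval0]; exact_mod_cast hp.ne'
  have hroots : ∀ r ∈ g.roots, r.im = 0 ∧ r.re < 0 := by
    intro r hr
    have hr := (Polynomial.mem_roots'.mp hr).2
    have hr : g.eval r = 0 := hr
    refine ⟨?_, lineP_roots_re h _ (fun i => by simpa using hx i) j r hr⟩
    have hr0 : r ≠ 0 := by rintro rfl; exact hg0 hr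
    rw [hg, eval_lineP] at hr
    by_contra him
    -- multiply by `±i / r`
    have key : ∀ s : ℂ, 0 < (s).re → (s * r).re = 0 → False := by
      intro s hs hs2
      have := aeval_smul_hom h.hom s (fun i => (x i : ℂ) + r * (Pi.single j 1 : Fin n → ℂ) i)
      rw [hr, mul_zero] at this
      refine h.stab _ (fun i => ?_) this
      have hxi := hx i
      by_cases hij : i = j
      · subst hij
        simp only [Pi.single_eq_same, mul_one, mul_add, Complex.add_re, hs2]
        simp only [Complex.mul_re, Complex.ofReal_re, Complex.ofReal_im]
        nlinarith
      · simp [hij]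
        positivity
    rcases lt_or_gt_of_ne (Ne.symm him) with hi | hi
    · refine key (-Complex.I * (starRingEnd ℂ r) * (-1)) ?_ ?_
      · simp; linarith
      · simp; ring
    · refine key (-Complex.I * (starRingEnd ℂ r) * (-1) * (-1)) ?_ ?_
      · simp; linarith
      · simp; ring
  have hsp := IsAlgClosed.splits g
  have hb := multiset_bound t ht g.roots hroots
  have hdd := hsp.eval_derivative_div_eval_of_ne_zero hg0
  have e1 := hsp.eval_eq_prod_roots (t : ℂ)
  have e2 := hsp.eval_eq_prod_roots (0 : ℂ)
  rw [← hdd, hder, hval0, ← Complex.ofReal_div, Complex.ofReal_re] at hb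
  have hb2 := mul_le_mul_of_nonneg_left hb (norm_nonneg g.leadingCoeff)
  rw [← mul_assoc, ← norm_mul, ← norm_mul, ← e1, ← e2, hval, hval0, Complex.norm_real,
    Complex.norm_real, Real.norm_of_nonneg hp.le] at hb2
  exact (le_abs_self _).trans hb2

lemma gurvits {n : ℕ} (p : MvPolynomial (Fin n) ℝ) (h : LSGood p n) (K : ℝ) (hK : 0 ≤ K)
    (hcap : ∀ x : Fin n → ℝ, (∀ i, 0 < x i) → K * ∏ i, x i ≤ MvPolynomial.eval x p) :
    K * Real.exp (-(n : ℝ)) ≤ p.coeff (∑ i, Finsupp.single i 1) := by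
  have key : ∀ S : Finset (Fin n), ∃ q : MvPolynomial (Fin n) ℝ, LSGood q (Sᶜ.card) ∧
      (∀ x : Fin n → ℝ, (∀ i, 0 < x i) →
        K * Real.exp (-(S.card : ℝ)) * ∏ i ∈ Sᶜ, x i ≤ MvPolynomial.eval x q) ∧
      q.coeff (∑ i ∈ Sᶜ, Finsupp.single i 1) = p.coeff (∑ i, Finsupp.single i 1) := by
    intro S
    induction S using Finset.induction_on with
    | empty => exact ⟨p, by simpa using h, by simpa using hcap, by simp⟩
    | insert j S hj ih =>
      obtain ⟨q, hq, hqc, hqe⟩ := ih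
      have hins : Sᶜ = insert j (insert j S)ᶜ := by
        ext i; by_cases hij : i = j
        · subst hij; simp [hj]
        · simp [hij]
      have hjn : j ∉ (insert j S)ᶜ := by simp
      have hcard : Sᶜ.card = (insert j S)ᶜ.card + 1 := by
        rw [hins, Finset.card_insert_of_notMem hjn]
      rw [hcard] at hq
      refine ⟨MvPolynomial.pderiv j q, hq.pderiv j, ?_, ?_⟩
      · intro x hx
        have hpos : ∀ {d} {q : MvPolynomial (Fin n) ℝ}, LSGood q d → 0 < MvPolynomial.eval x q := by
          intro d q hq
          have h1 := hq.eval_ge x (fun i => (hx i).le) (Finsupp.single j d)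
          have h2 := hq.pos (Finsupp.single j d) (by simp)
          refine lt_of_lt_of_le ?_ h1
          exact mul_pos h2 (Finset.prod_pos fun i _ => pow_pos (hx i) _)
        have hp0 := hpos hq
        have hp1 := hpos (hq.pderiv j)
        set A := MvPolynomial.eval x q
        set B := MvPolynomial.eval x (MvPolynomial.pderiv j q)
        have hb := hq.exp_bound j x hx hp0 (A / B) (by positivity)
        have hone : A / B * (B / A) = 1 := by field_simp
        change _ ≤ A * Real.exp (A / B * (B / A)) at hb
        rw [hone] at hb
        have hc := hqc (fun i => x i + A / B * (Pi.single j 1 : Fin n → ℝ) i) (fun i => by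
          have := hx i
          by_cases hij : i = j
          · subst hij; simp; positivity
          · simp [hij, this])
        have hc := hc.trans hb
        rw [hins, Finset.prod_insert hjn] at hc
        have hprod : ∏ i ∈ (insert j S)ᶜ, (x i + A / B * (Pi.single j 1 : Fin n → ℝ) i) =
            ∏ i ∈ (insert j S)ᶜ, x i := by
          apply Finset.prod_congr rfl
          intro i hi
          have hij : i ≠ j := by rintro rfl; exact hjn hi
          simp [hij]
        rw [hprod] at hc
        simp only [Pi.single_eq_same, mul_one] at hc
        have hPn : 0 ≤ ∏ i ∈ (insert j S)ᶜ, x i := Finset.prod_nonneg fun i _ => (hx i).le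
        set Pr := ∏ i ∈ (insert j S)ᶜ, x i
        rw [Finset.card_insert_of_notMem hj]
        push_cast
        rw [neg_add, Real.exp_add, Real.exp_neg 1]
        have hxj := hx j
        have hE := Real.exp_pos (-(S.card : ℝ))
        have h7 : K * Real.exp (-(S.card : ℝ)) * (A / B * Pr) ≤ A * Real.exp 1 := by
          refine le_trans ?_ hc
          gcongr
          linarith
        have h8 : K * Real.exp (-(S.card : ℝ)) * Pr ≤ B * Real.exp 1 := by
          have : K * Real.exp (-(S.card : ℝ)) * (A / B * Pr) =
            (A / B) * (K * Real.exp (-(S.card : ℝ)) * Pr) := by ring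
          rw [this] at h7
          have e : A * Real.exp 1 = (A / B) * (B * Real.exp 1) := by field_simp
          rw [e] at h7
          exact le_of_mul_le_mul_left h7 (by positivity)
        have := mul_le_mul_of_nonneg_right h8 (inv_nonneg.mpr (Real.exp_pos 1).le)
        calc _ = K * Real.exp (-(S.card : ℝ)) * Pr * (Real.exp 1)⁻¹ := by ring
          _ ≤ _ := this
          _ = B := by field_simp
      · rw [MvPolynomial.coeff_pderiv, ← hqe, hins, Finset.sum_insert hjn, add_comm]
        have : (∑ i ∈ (insert j S)ᶜ, Finsupp.single i 1 : Fin n →₀ ℕ) j = 0 := by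
          rw [Finsupp.finsetSum_apply]
          apply Finset.sum_eq_zero
          intro i hi
          have hij : i ≠ j := by rintro rfl; exact hjn hi
          simp [hij]
        rw [this]; simp
  obtain ⟨q, hq, hqc, hqe⟩ := key Finset.univ
  rw [← hqe]
  have h1 := hqc (fun _ => 1) (fun _ => one_pos)
  have hq0 : q = MvPolynomial.C (q.coeff 0) := by
    rw [← MvPolynomial.totalDegree_eq_zero_iff_eq_C,
      MvPolynomial.totalDegree_zero_iff_isHomogeneous]
    simpa using hq.hom
  rw [hq0] at h1
  simpa using h1

lemma good_prod {n : ℕ} (hn : 0 < n) (a : Fin n → Fin n → ℝ) (ha : ∀ i j, 0 < a i j)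
    (S : Finset (Fin n)) :
    LSGood (∏ i ∈ S, ∑ j, MvPolynomial.C (a i j) * MvPolynomial.X j) S.card where
  hom := by
    have := MvPolynomial.IsHomogeneous.prod S
      (fun i => ∑ j, MvPolynomial.C (a i j) * MvPolynomial.X j) (fun _ => 1) (fun i _ =>
        MvPolynomial.IsHomogeneous.sum _ _ _ fun j _ => MvPolynomial.isHomogeneous_C_mul_X _ _)
    simpa using this
  pos := by
    have hnn : ∀ m : Fin n →₀ ℕ,
        0 ≤ MvPolynomial.coeff m (∏ i ∈ S, ∑ j, MvPolynomial.C (a i j) * MvPolynomial.X j) := by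
      induction S using Finset.induction_on with
      | empty =>
        intro m
        simp only [Finset.prod_empty, MvPolynomial.coeff_one]
        split_ifs <;> norm_num
      | insert i S hi ih =>
        intro m
        rw [Finset.prod_insert hi, Finset.sum_mul, MvPolynomial.coeff_sum]
        apply Finset.sum_nonneg
        intro j _
        rw [mul_assoc, MvPolynomial.coeff_C_mul, MvPolynomial.coeff_X_mul']
        split_ifs
        · exact mul_nonneg (ha i j).le (ih _)
        · simp
    induction S using Finset.induction_on with
    | empty =>
      intro m hm
      have : m = 0 := by simpa [Finsupp.degree_eq_zero_iff] using hm
      subst this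
      simp
    | insert i S hi ih =>
      intro m hm
      have hnn' : ∀ m : Fin n →₀ ℕ,
        0 ≤ MvPolynomial.coeff m (∏ i ∈ S, ∑ j, MvPolynomial.C (a i j) * MvPolynomial.X j) := by
        intro m
        clear hnn ih hm
        induction S using Finset.induction_on generalizing m with
        | empty =>
          simp only [Finset.prod_empty, MvPolynomial.coeff_one]
          split_ifs <;> norm_num
        | insert i' S hi' ih =>
          rw [Finset.prod_insert hi', Finset.sum_mul, MvPolynomial.coeff_sum]
          apply Finset.sum_nonneg
          intro j _
          rw [mul_assoc, MvPolynomial.coeff_C_mul, MvPolynomial.coeff_X_mul']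
          split_ifs
          · exact mul_nonneg (ha i' j).le (ih (fun h => hi (by simp [h])) _)
          · simp
      have ih := ih hnn'
      rw [Finset.card_insert_of_notMem hi] at hm
      rw [Finset.prod_insert hi, Finset.sum_mul, MvPolynomial.coeff_sum]
      have hterm : ∀ j, MvPolynomial.coeff m (MvPolynomial.C (a i j) * MvPolynomial.X j *
          ∏ i ∈ S, ∑ j, MvPolynomial.C (a i j) * MvPolynomial.X j) =
          a i j * if j ∈ m.support then MvPolynomial.coeff (m - Finsupp.single j 1)
            (∏ i ∈ S, ∑ j, MvPolynomial.C (a i j) * MvPolynomial.X j) else 0 := by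
        intro j
        rw [mul_assoc, MvPolynomial.coeff_C_mul, MvPolynomial.coeff_X_mul']
      have hm0 : m ≠ 0 := by rintro rfl; simp at hm
      obtain ⟨j, hj⟩ := Finsupp.support_nonempty_iff.mpr hm0
      apply Finset.sum_pos'
      · intro j _
        rw [hterm]
        split_ifs
        · exact mul_nonneg (ha i j).le (hnn' _)
        · simp
      · refine ⟨j, Finset.mem_univ j, ?_⟩
        rw [hterm, if_pos hj]
        refine mul_pos (ha i j) (ih _ ?_)
        have h1 : m - Finsupp.single j 1 + Finsupp.single j 1 = m := by
          apply tsub_add_cancel_of_le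
          rw [Finsupp.single_le_iff]
          exact Nat.one_le_iff_ne_zero.mpr (Finsupp.mem_support_iff.mp hj)
        have h2 := congrArg Finsupp.degree h1
        rw [map_add, hm, Finsupp.degree_single] at h2
        omega
  stab := by
    intro z hz
    rw [map_prod, Finset.prod_ne_zero_iff]
    intro i _ h0
    have h1 := congrArg Complex.re h0
    simp only [map_sum, map_mul, MvPolynomial.aeval_C, MvPolynomial.aeval_X, Complex.re_sum,
      Complex.coe_algebraMap, Complex.re_ofReal_mul, Complex.zero_re] at h1
    have : 0 < ∑ j, a i j * (z j).re :=
      Finset.sum_pos (fun j _ => mul_pos (ha i j) (hz j)) ⟨⟨0, hn⟩, Finset.mem_univ _⟩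
    linarith

lemma coeff_prod_eq {n : ℕ} (a : Fin n → Fin n → ℝ) :
    MvPolynomial.coeff (∑ i, Finsupp.single i 1)
      (∏ i, ∑ j, MvPolynomial.C (a i j) * MvPolynomial.X j : MvPolynomial (Fin n) ℝ) =
      ∑ σ : Equiv.Perm (Fin n), ∏ i, a i (σ i) := by
  rw [Finset.prod_univ_sum, MvPolynomial.coeff_sum, Fintype.piFinset_univ]
  have hterm : ∀ p : Fin n → Fin n, MvPolynomial.coeff (∑ i, Finsupp.single i 1)
      (∏ i, (MvPolynomial.C (a i (p i)) * MvPolynomial.X (p i)) : MvPolynomial (Fin n) ℝ) =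
      if (∑ i, Finsupp.single (p i) 1 : Fin n →₀ ℕ) = ∑ i, Finsupp.single i 1 then
        ∏ i, a i (p i) else 0 := by
    intro p
    rw [Finset.prod_mul_distrib, ← map_prod, MvPolynomial.coeff_C_mul]
    have : (∏ i, MvPolynomial.X (p i) : MvPolynomial (Fin n) ℝ) =
        MvPolynomial.monomial (∑ i, Finsupp.single (p i) 1) 1 := by
      rw [MvPolynomial.monomial_sum_one]; rfl
    rw [this, MvPolynomial.coeff_monomial]
    simp
  symm
  apply Finset.sum_of_injOn (fun σ : Equiv.Perm (Fin n) => (σ : Fin n → Fin n))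
  · intro σ _ τ _ h
    exact Equiv.coe_fn_injective h
  · intro σ _; simp
  · intro p _ hp
    rw [hterm, if_neg]
    intro heq
    apply hp
    have hsurj : Function.Surjective p := by
      intro j
      have h1 := DFunLike.congr_fun heq j
      rw [Finsupp.finsetSum_apply, Finsupp.finsetSum_apply] at h1
      have h2 : ∑ i, (Finsupp.single i 1 : Fin n →₀ ℕ) j = 1 := by
        simp [Finsupp.single_apply]
      rw [h2] at h1
      by_contra hcon
      push Not at hcon
      rw [Finset.sum_eq_zero (fun i _ => by simp [hcon i])] at h1
      omega
    exact ⟨Equiv.ofBijective p (Finite.surjective_iff_bijective.mp hsurj), by simp, rfl⟩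
  · intro σ _
    rw [hterm, if_pos]
    exact Equiv.sum_comp σ (fun i => (Finsupp.single i 1 : Fin n →₀ ℕ))

lemma capacity_bound {n : ℕ} (a : Fin n → Fin n → ℝ) (ha : ∀ i j, 0 ≤ a i j) (d : ℝ) (hd : 0 < d)
    (hr : ∀ i, ∑ j, a i j = d) (hc : ∀ j, ∑ i, a i j = d) (x : Fin n → ℝ) (hx : ∀ i, 0 < x i) :
    d ^ n * ∏ i, x i ≤ ∏ i, ∑ j, a i j * x j := by
  have h1 : ∀ i, d * ∏ j, x j ^ (a i j / d) ≤ ∑ j, a i j * x j := by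
    intro i
    have := Real.geom_mean_le_arith_mean_weighted Finset.univ (fun j => a i j / d) x
      (fun j _ => div_nonneg (ha i j) hd.le) (by rw [← Finset.sum_div, hr i, div_self hd.ne'])
      (fun j _ => (hx j).le)
    calc _ ≤ d * ∑ j, a i j / d * x j := by gcongr
      _ = _ := by
        rw [Finset.mul_sum]
        refine Finset.sum_congr rfl fun j _ => ?_
        field_simp
  have h2 : ∏ i : Fin n, (d * ∏ j, x j ^ (a i j / d)) = d ^ n * ∏ i, x i := by
    rw [Finset.prod_mul_distrib, Finset.prod_comm]
    congr 1
    · simp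
    · refine Finset.prod_congr rfl fun j _ => ?_
      rw [← Real.rpow_sum_of_pos (hx j), ← Finset.sum_div, hc j, div_self hd.ne', Real.rpow_one]
  rw [← h2]
  refine Finset.prod_le_prod (fun i _ => ?_) (fun i _ => h1 i)
  exact mul_nonneg hd.le (Finset.prod_nonneg fun j _ => Real.rpow_nonneg (hx j).le _)

lemma perm_bound {n : ℕ} (hn : 0 < n) (a : Fin n → Fin n → ℝ) (ha : ∀ i j, 0 ≤ a i j) (d : ℝ)
    (hd : 0 < d) (hr : ∀ i, ∑ j, a i j = d) (hc : ∀ j, ∑ i, a i j = d) :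
    d ^ n * Real.exp (-(n : ℝ)) ≤ ∑ σ : Equiv.Perm (Fin n), ∏ i, a i (σ i) := by
  have h1 : ∀ ε : ℝ, 0 < ε →
      d ^ n * Real.exp (-(n : ℝ)) ≤ ∑ σ : Equiv.Perm (Fin n), ∏ i, (a i (σ i) + ε) := by
    intro ε hε
    have hg := good_prod hn (fun i j => a i j + ε) (fun i j => by have := ha i j; linarith)
      Finset.univ
    rw [Finset.card_univ, Fintype.card_fin] at hg
    have := gurvits _ hg (d ^ n) (by positivity) (fun x hx => by
      refine (capacity_bound a ha d hd hr hc x hx).trans ?_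
      simp only [map_prod, map_sum, map_mul, MvPolynomial.eval_C, MvPolynomial.eval_X]
      refine Finset.prod_le_prod (fun i _ => Finset.sum_nonneg fun j _ =>
        mul_nonneg (ha i j) (hx j).le) (fun i _ => Finset.sum_le_sum fun j _ => ?_)
      have := hx j
      nlinarith)
    rwa [coeff_prod_eq] at this
  have h2 : Filter.Tendsto (fun ε : ℝ => ∑ σ : Equiv.Perm (Fin n), ∏ i, (a i (σ i) + ε))
      (nhdsWithin 0 (Set.Ioi 0)) (nhds (∑ σ : Equiv.Perm (Fin n), ∏ i, (a i (σ i) + 0))) := by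
    apply Filter.Tendsto.mono_left _ nhdsWithin_le_nhds
    have : Continuous (fun ε : ℝ => ∑ σ : Equiv.Perm (Fin n), ∏ i, (a i (σ i) + ε)) := by
      fun_prop
    exact this.tendsto 0
  have h3 := ge_of_tendsto h2 (Filter.eventually_of_mem self_mem_nhdsWithin (fun ε hε => h1 ε hε))
  simpa using h3

lemma count_ext {n k : ℕ} (hk : k < n) (r : Fin k → Equiv.Perm (Fin n))
    (hr : ∀ i j, i ≠ j → ∀ x, r i x ≠ r j x) :
    ((n - k : ℕ) : ℝ) ^ n * Real.exp (-(n : ℝ)) ≤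
      ((univ.filter fun π : Equiv.Perm (Fin n) => ∀ i x, r i x ≠ π x).card : ℝ) := by
  have hn : 0 < n := by omega
  have hrow : ∀ x, ∑ y, (if ∀ i, r i x ≠ y then (1 : ℝ) else 0) = ((n - k : ℕ) : ℝ) := by
    intro x
    rw [Finset.sum_boole]
    congr 1
    have : (univ.filter fun y => ∀ i, r i x ≠ y) = (univ.image fun i => r i x)ᶜ := by
      ext y; simp
    rw [this, Finset.card_compl, Finset.card_image_of_injective]
    · simp
    · intro i j hij
      by_contra hne
      exact hr i j hne x hij
  have hcol : ∀ y, ∑ x, (if ∀ i, r i x ≠ y then (1 : ℝ) else 0) = ((n - k : ℕ) : ℝ) := by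
    intro y
    rw [Finset.sum_boole]
    congr 1
    have : (univ.filter fun x => ∀ i, r i x ≠ y) = (univ.image fun i => (r i).symm y)ᶜ := by
      ext x
      simp only [Finset.mem_filter, Finset.mem_compl, Finset.mem_image, Finset.mem_univ, true_and,
        not_exists]
      refine forall_congr' fun i => not_congr ?_
      rw [Equiv.symm_apply_eq, eq_comm]
    rw [this, Finset.card_compl, Finset.card_image_of_injective]
    · simp
    · intro i j hij
      by_contra hne
      have hij : (r i).symm y = (r j).symm y := hij
      apply hr i j hne ((r i).symm y)
      rw [Equiv.apply_symm_apply, hij, Equiv.apply_symm_apply]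
  have := perm_bound hn (fun x y => if ∀ i, r i x ≠ y then (1 : ℝ) else 0)
    (fun i j => by split_ifs <;> norm_num) ((n - k : ℕ) : ℝ) (by
      exact_mod_cast Nat.sub_pos_of_lt hk) hrow hcol
  refine this.trans (le_of_eq ?_)
  rw [← Finset.sum_boole]
  refine Finset.sum_congr rfl fun σ _ => ?_
  rw [Finset.prod_boole]
  congr 1
  simp only [Finset.mem_univ, true_implies, eq_iff_iff]
  exact forall_comm

lemma rect_count {n : ℕ} (k : ℕ) (hk : k ≤ n) :
    ∏ l ∈ Finset.range k, (((n - l : ℕ) : ℝ) ^ n * Real.exp (-(n : ℝ))) ≤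
      ((univ.filter fun r : Fin k → Equiv.Perm (Fin n) =>
        ∀ i j, i ≠ j → ∀ x, r i x ≠ r j x).card : ℝ) := by
  induction k with
  | zero => simp
  | succ k ih =>
    have ih := ih (by omega)
    rw [Finset.prod_range_succ]
    set R := (univ.filter fun r : Fin k → Equiv.Perm (Fin n) =>
        ∀ i j, i ≠ j → ∀ x, r i x ≠ r j x) with hR
    have h1 : ((R.sigma fun r => univ.filter fun π : Equiv.Perm (Fin n) =>
        ∀ i x, r i x ≠ π x).card) ≤ (univ.filter fun r : Fin (k + 1) → Equiv.Perm (Fin n) =>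
        ∀ i j, i ≠ j → ∀ x, r i x ≠ r j x).card := by
      apply Finset.card_le_card_of_injOn
        (fun s => (Fin.cons s.2 s.1 : Fin (k + 1) → Equiv.Perm (Fin n)))
      · rintro ⟨r, π⟩ hs
        simp only [hR, Finset.coe_sigma, Set.mem_sigma_iff, Finset.mem_coe, Finset.mem_filter,
          Finset.mem_univ, true_and] at hs ⊢
        obtain ⟨h1, h2⟩ := hs
        intro i j
        refine Fin.cases ?_ (fun i => ?_) i <;> refine Fin.cases ?_ (fun j => ?_) j
        · simp
        · intro _ x; simpa using (h2 j x).symm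
        · intro _ x; simpa using (h2 i x)
        · intro hij x; simpa using h1 i j (by simpa using hij) x
      · rintro ⟨r, π⟩ _ ⟨r', π'⟩ _ h
        have := Fin.cons_injective2 h
        obtain ⟨rfl, rfl⟩ := this
        rfl
    have h2 : (((R.sigma fun r => univ.filter fun π : Equiv.Perm (Fin n) =>
        ∀ i x, r i x ≠ π x).card : ℕ) : ℝ) ≥
        (R.card : ℝ) * (((n - k : ℕ) : ℝ) ^ n * Real.exp (-(n : ℝ))) := by
      rw [Finset.card_sigma]
      push_cast
      rw [← nsmul_eq_mul]
      apply Finset.card_nsmul_le_sum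
      intro r hr
      exact count_ext (by omega) r (by simpa [hR] using hr)
    calc _ ≤ (R.card : ℝ) * (((n - k : ℕ) : ℝ) ^ n * Real.exp (-(n : ℝ))) := by gcongr
      _ ≤ _ := h2
      _ ≤ _ := by exact_mod_cast h1

lemma latin_count (n : ℕ) :
    ((n.factorial : ℝ)) ^ n * Real.exp (-((n : ℝ) ^ 2)) ≤
      ((univ : Finset (LatinSquare n)).card : ℝ) := by
  have h := rect_count (n := n) n le_rfl
  have h1 : ((univ : Finset (LatinSquare n)).card) = (univ.filter fun r : Fin n → Equiv.Perm (Fin n) =>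
        ∀ i j, i ≠ j → ∀ x, r i x ≠ r j x).card := by
    rw [Finset.card_univ, Fintype.card_subtype]
    apply congrArg
    ext r
    simp only [Finset.mem_filter, Finset.mem_univ, true_and]
    rfl
  rw [h1]
  refine le_trans (le_of_eq ?_) h
  rw [Finset.prod_mul_distrib, Finset.prod_pow, ← Nat.descFactorial_self n,
    Nat.descFactorial_eq_prod_range]
  push_cast
  congr 1
  rw [Finset.prod_const, Finset.card_range, ← Real.exp_nat_mul]
  congr 1
  ring

lemma sum_update_eq {ι K : Type*} [Fintype ι] [DecidableEq ι] [Fintype K] [DecidableEq K]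
    (h : (ι → K) → ℝ) (c : ι) :
    ∑ f : ι → K, ∑ k : K, h (Function.update f c k) = (Fintype.card K : ℝ) * ∑ f : ι → K, h f := by
  have h1 : ∑ q : (ι → K) × K, h (Function.update q.1 c q.2) = ∑ q : (ι → K) × K, h q.1 := by
    apply Finset.sum_nbij' (fun q => (Function.update q.1 c q.2, q.1 c))
      (fun q => (Function.update q.1 c q.2, q.1 c))
    · simp
    · simp
    · intro q _; ext <;> simp
    · intro q _; ext <;> simp
    · intro q _; rfl
  rw [Fintype.sum_prod_type, Fintype.sum_prod_type] at h1
  rw [h1, Finset.mul_sum]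
  simp

lemma kraft {ι K α : Type*} [Fintype ι] [DecidableEq ι] [Fintype K] [DecidableEq K] [Nonempty K]
    [LinearOrder α] (ρ : ι → α) (S : ι → (ι → K) → Finset K)
    (hS : ∀ c c' f k, ρ c ≤ ρ c' → S c (Function.update f c' k) = S c f) :
    ∑ f : ι → K, ∏ c, (if f c ∈ S c f then ((S c f).card : ℝ)⁻¹ else 0) ≤ 1 := by
  have hK : (0 : ℝ) < Fintype.card K := by exact_mod_cast Fintype.card_pos
  set g : ι → (ι → K) → ℝ := fun c f => if f c ∈ S c f then ((S c f).card : ℝ)⁻¹ else 0 with hg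
  have hg0 : ∀ c f, 0 ≤ g c f := by
    intro c f; simp only [hg]; split_ifs <;> positivity
  have key : ∀ T : Finset ι, (Fintype.card K : ℝ) ^ T.card * ∑ f : ι → K, ∏ c ∈ T, g c f ≤
      (Fintype.card K : ℝ) ^ (Fintype.card ι) := by
    intro T
    induction T using Finset.induction_on_max_value ρ with
    | empty => simp
    | insert c T hc hmax ih =>
      refine le_trans ?_ ih
      rw [Finset.card_insert_of_notMem hc, pow_succ, mul_assoc]
      refine mul_le_mul_of_nonneg_left ?_ (by positivity)
      rw [← sum_update_eq _ c]
      refine Finset.sum_le_sum fun f _ => ?_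
      have h1 : ∀ k, ∏ c' ∈ insert c T, g c' (Function.update f c k) =
          (if k ∈ S c f then ((S c f).card : ℝ)⁻¹ else 0) * ∏ c' ∈ T, g c' f := by
        intro k
        rw [Finset.prod_insert hc]
        congr 1
        · simp only [hg]; rw [hS c c f k le_rfl]; simp
        · refine Finset.prod_congr rfl fun c' hc' => ?_
          have hne : c' ≠ c := by rintro rfl; exact hc hc'
          simp only [hg]; rw [hS c' c f k (hmax c' hc')]; simp [hne]
      simp only [h1]
      rw [← Finset.sum_mul]
      have h2 : ∑ k, (if k ∈ S c f then ((S c f).card : ℝ)⁻¹ else 0) ≤ 1 := by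
        rw [Finset.sum_ite_mem, Finset.univ_inter, Finset.sum_const, nsmul_eq_mul]
        exact mul_inv_le_one
      have h3 : 0 ≤ ∏ c' ∈ T, g c' f := Finset.prod_nonneg fun c' _ => hg0 c' f
      nlinarith
  have := key Finset.univ
  rw [Finset.card_univ] at this
  have hp : (0 : ℝ) < (Fintype.card K : ℝ) ^ (Fintype.card ι) := by positivity
  exact le_of_mul_le_mul_left (by linarith) hp

lemma sum_perm_one {n : ℕ} (g : Fin n → ℝ) (i : Fin n) :
    (n : ℝ) * ∑ σ : Equiv.Perm (Fin n), g (σ i) = (n.factorial : ℝ) * ∑ a, g a := by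
  have h1 : ∀ i', ∑ σ : Equiv.Perm (Fin n), g (σ i') = ∑ σ : Equiv.Perm (Fin n), g (σ i) := by
    intro i'
    rw [← Equiv.sum_comp (Equiv.mulRight (Equiv.swap i i'))]
    simp
  have h2 : ∑ i', ∑ σ : Equiv.Perm (Fin n), g (σ i') = (n : ℝ) * ∑ σ : Equiv.Perm (Fin n), g (σ i) := by
    rw [Finset.sum_congr rfl fun i' _ => h1 i']; simp
  rw [← h2, Finset.sum_comm]
  rw [Finset.sum_congr rfl fun σ _ => Equiv.sum_comp σ g]
  simp [Fintype.card_perm]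

def wt {n : ℕ} (a : Fin n) : ℝ := 1 / ((n : ℝ) - (a : ℕ))

lemma wt_den_pos {n : ℕ} (a : Fin n) : 0 < (n : ℝ) - (a : ℕ) := by
  have : ((a : ℕ) : ℝ) < n := by exact_mod_cast a.2
  linarith

lemma wt_pos {n : ℕ} (a : Fin n) : 0 < wt a := one_div_pos.mpr (wt_den_pos a)

lemma sum_perm_two {n : ℕ} (i i' : Fin n) (hne : i' ≠ i) :
    (n : ℝ) * ∑ σ : Equiv.Perm (Fin n), (if σ i ≤ σ i' then wt (σ i) else 0) ≤
      (n.factorial : ℝ) := by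
  have hn2 : 2 ≤ n := by
    by_contra hcon
    have h1 := i.2
    have h2 := i'.2
    exact hne (Fin.ext (by omega))
  have hn2' : (2 : ℝ) ≤ n := by exact_mod_cast hn2
  have h1 : ∀ i'' ∈ univ.erase i, ∑ σ : Equiv.Perm (Fin n), (if σ i ≤ σ i'' then wt (σ i) else 0) =
      ∑ σ : Equiv.Perm (Fin n), (if σ i ≤ σ i' then wt (σ i) else 0) := by
    intro i'' hi''
    have hi'' : i'' ≠ i := by simpa using hi''
    rw [← Equiv.sum_comp (Equiv.mulRight (Equiv.swap i' i''))]
    refine Finset.sum_congr rfl fun σ _ => ?_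
    simp [Equiv.swap_apply_of_ne_of_ne hne.symm hi''.symm]
  have h2 : ∑ i'' ∈ univ.erase i, ∑ σ : Equiv.Perm (Fin n), (if σ i ≤ σ i'' then wt (σ i) else 0) =
      ((n : ℝ) - 1) * ∑ σ : Equiv.Perm (Fin n), (if σ i ≤ σ i' then wt (σ i) else 0) := by
    rw [Finset.sum_congr rfl h1]
    rw [Finset.sum_const, Finset.card_erase_of_mem (Finset.mem_univ i), nsmul_eq_mul,
      Finset.card_univ, Fintype.card_fin, Nat.cast_sub (by omega)]
    simp
  rw [Finset.sum_comm] at h2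
  have h3 : ∀ σ : Equiv.Perm (Fin n),
      ∑ i'' ∈ univ.erase i, (if σ i ≤ σ i'' then wt (σ i) else 0) ≤ ((n : ℝ) - 1) / n := by
    intro σ
    rw [← Finset.sum_filter, Finset.sum_const, nsmul_eq_mul]
    have hcard : ((univ.erase i).filter fun i'' => σ i ≤ σ i'').card = n - 1 - (σ i : ℕ) := by
      rw [← Fin.card_Ioi]
      apply Finset.card_bij (fun x _ => σ x)
      · intro x hx
        simp only [Finset.mem_filter, Finset.mem_erase, Finset.mem_univ, and_true] at hx
        rw [Finset.mem_Ioi]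
        exact lt_of_le_of_ne hx.2 (fun h => hx.1 (σ.injective h).symm)
      · intro x _ y _ h; exact σ.injective h
      · intro b hb
        rw [Finset.mem_Ioi] at hb
        refine ⟨σ.symm b, ?_, by simp⟩
        simp only [Finset.mem_filter, Finset.mem_erase, Finset.mem_univ, and_true]
        refine ⟨?_, by simpa using hb.le⟩
        rintro h
        rw [← h] at hb; simp at hb
    rw [hcard]
    have hd := wt_den_pos (σ i)
    have ha : ((n - 1 - (σ i : ℕ) : ℕ) : ℝ) = (n : ℝ) - 1 - ((σ i : ℕ) : ℝ) := by
      have := (σ i).2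
      rw [Nat.cast_sub (by omega), Nat.cast_sub (by omega)]; simp
    rw [ha, wt, mul_one_div, div_le_div_iff₀ hd (by linarith)]
    have : (0 : ℝ) ≤ ((σ i : ℕ) : ℝ) := by positivity
    nlinarith
  have h4 := Finset.sum_le_sum fun σ (_ : σ ∈ (Finset.univ : Finset (Equiv.Perm (Fin n)))) => h3 σ
  rw [h2] at h4
  simp only [Finset.sum_const, Finset.card_univ, Fintype.card_perm, Fintype.card_fin,
    nsmul_eq_mul] at h4
  have h5 : (0 : ℝ) < (n : ℝ) - 1 := by linarith
  have h6 : ((n : ℝ) - 1) * ∑ σ : Equiv.Perm (Fin n), (if σ i ≤ σ i' then wt (σ i) else 0) ≤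
      ((n : ℝ) - 1) * ((n.factorial : ℝ) / n) := by
    refine h4.trans (le_of_eq ?_); ring
  have h7 := le_of_mul_le_mul_left h6 h5
  rw [le_div_iff₀ (by linarith)] at h7
  linarith

def Hn (n : ℕ) : ℝ := ∑ a : Fin n, wt a

def scell {n : ℕ} (E : Finset (Fin n × Fin n × Fin n)) (P : Finset (Fin n × Fin n))
    (σ τ : Equiv.Perm (Fin n)) (c : Fin n × Fin n) (f : Fin n × Fin n → Fin n) : Finset (Fin n) :=
  univ.filter fun k => (c ∈ P ∨ (c.1, c.2, k) ∉ E) ∧ (∀ i', σ i' < σ c.1 → f (i', c.2) ≠ k) ∧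
    (∀ j', τ j' < τ c.2 → f (c.1, j') ≠ k)

def ecell {n : ℕ} (E : Finset (Fin n × Fin n × Fin n)) (c : Fin n × Fin n) : ℕ :=
  (univ.filter fun k => (c.1, c.2, k) ∈ E).card

def lfun {n : ℕ} (L : LatinSquare n) : Fin n × Fin n → Fin n := fun c => L.1 c.1 c.2

lemma lfun_injective {n : ℕ} : Function.Injective (lfun (n := n)) := by
  intro L L' h
  apply Subtype.ext
  funext i
  ext j
  have := congrFun h (i, j)
  simp only [lfun] at this
  rw [this]

def bcell {n : ℕ} (E : Finset (Fin n × Fin n × Fin n)) (P : Finset (Fin n × Fin n))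
    (c : Fin n × Fin n) : ℝ :=
  2 * Real.log (n.factorial) / n - Real.log n + (Hn n) ^ 2 / n -
    (if c ∈ P then 0 else (ecell E c : ℝ)) / n

lemma self_mem_scell {n : ℕ} (E : Finset (Fin n × Fin n × Fin n)) (P : Finset (Fin n × Fin n))
    (σ τ : Equiv.Perm (Fin n)) (c : Fin n × Fin n) (L : LatinSquare n)
    (h : c ∈ P ∨ (c.1, c.2, lfun L c) ∉ E) : lfun L c ∈ scell E P σ τ c (lfun L) := by
  simp only [scell, Finset.mem_filter, Finset.mem_univ, true_and]
  refine ⟨h, fun i' hi' => ?_, fun j' hj' heq => ?_⟩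
  · exact L.2 i' c.1 (by rintro rfl; exact lt_irrefl _ hi') c.2
  · have : j' = c.2 := (L.1 c.1).injective heq
    rw [this] at hj'; exact lt_irrefl _ hj'

lemma sum_log_wt {n : ℕ} : ∑ a : Fin n, Real.log ((n : ℝ) - (a : ℕ)) = Real.log (n.factorial) := by
  rw [← Real.log_prod (fun a _ => (wt_den_pos a).ne')]
  congr 1
  rw [← Nat.descFactorial_self n, Nat.descFactorial_eq_prod_range, Finset.prod_range]
  push_cast
  refine Finset.prod_congr rfl fun a _ => ?_
  rw [Nat.cast_sub a.2.le]

lemma cell_bound {n : ℕ} (hn : 0 < n) (E : Finset (Fin n × Fin n × Fin n))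
    (P : Finset (Fin n × Fin n)) (c : Fin n × Fin n) (L : LatinSquare n)
    (h : c ∈ P ∨ (c.1, c.2, lfun L c) ∉ E) :
    ∑ σ : Equiv.Perm (Fin n), ∑ τ : Equiv.Perm (Fin n),
      Real.log ((scell E P σ τ c (lfun L)).card) ≤ (n.factorial : ℝ) ^ 2 * bcell E P c := by
  obtain ⟨i, j⟩ := c
  have hn' : (0 : ℝ) < n := by exact_mod_cast hn
  have hcolinj : Function.Injective fun i' => L.1 i' j := by
    intro a b hab
    by_contra hne
    exact L.2 a b hne j hab
  have hcol : Function.Surjective fun i' => L.1 i' j := Finite.surjective_of_injective hcolinj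
  choose row hrow using hcol
  have hrow : ∀ k, L.1 (row k) j = k := hrow
  set col : Fin n → Fin n := fun k => (L.1 i).symm k with hcoldef
  set allowed : Finset (Fin n) := univ.filter fun k => ((i, j) ∈ P ∨ (i, j, k) ∉ E) with hal
  set fR : Fin n → Equiv.Perm (Fin n) → ℝ := fun k σ => if σ i ≤ σ (row k) then wt (σ i) else 0 with hfR
  set fC : Fin n → Equiv.Perm (Fin n) → ℝ := fun k τ => if τ j ≤ τ (col k) then wt (τ j) else 0 with hfC
  -- pointwise
  have hpt : ∀ σ τ : Equiv.Perm (Fin n), Real.log ((scell E P σ τ (i, j) (lfun L)).card) ≤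
      (Real.log ((n : ℝ) - (σ i : ℕ)) + Real.log ((n : ℝ) - (τ j : ℕ)) - Real.log n) +
        ((n : ℝ) * ∑ k ∈ allowed, fR k σ * fC k τ) - 1 := by
    intro σ τ
    have hmem := self_mem_scell E P σ τ (i, j) L h
    have hNpos : (0 : ℝ) < ((scell E P σ τ (i, j) (lfun L)).card : ℝ) := by
      exact_mod_cast Finset.card_pos.mpr ⟨_, hmem⟩
    set N : ℝ := ((scell E P σ τ (i, j) (lfun L)).card : ℝ) with hN
    have hσ := wt_den_pos (σ i)
    have hτ := wt_den_pos (τ j)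
    have h1 := Real.log_le_sub_one_of_pos (x := N * (n * (wt (σ i) * wt (τ j)))) (by
      have := wt_pos (σ i); have := wt_pos (τ j); positivity)
    rw [Real.log_mul hNpos.ne' (by have := wt_pos (σ i); have := wt_pos (τ j); positivity),
      Real.log_mul hn'.ne' (by have := wt_pos (σ i); have := wt_pos (τ j); positivity),
      Real.log_mul (wt_pos _).ne' (wt_pos _).ne', wt, wt, one_div, one_div, Real.log_inv,
      Real.log_inv] at h1
    have h2 : N * (wt (σ i) * wt (τ j)) ≤ ∑ k ∈ allowed, fR k σ * fC k τ := by
      rw [hN, ← nsmul_eq_mul, ← Finset.sum_const]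
      have hsub : scell E P σ τ (i, j) (lfun L) ⊆ allowed := by
        intro k hk
        simp only [scell, Finset.mem_filter, Finset.mem_univ, true_and] at hk
        simp only [hal, Finset.mem_filter, Finset.mem_univ, true_and]
        exact hk.1
      refine (Finset.sum_le_sum fun k hk => ?_).trans
        (Finset.sum_le_sum_of_subset_of_nonneg hsub fun k _ _ => ?_)
      · simp only [scell, Finset.mem_filter, Finset.mem_univ, true_and] at hk
        obtain ⟨-, hk1, hk2⟩ := hk
        have e1 : σ i ≤ σ (row k) := by
          by_contra hcon
          exact hk1 (row k) (not_le.mp hcon) (hrow k)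
        have e2 : τ j ≤ τ (col k) := by
          by_contra hcon
          exact hk2 (col k) (not_le.mp hcon) (by simp [lfun, hcoldef])
        simp only [hfR, hfC, if_pos e1, if_pos e2]
        exact le_rfl
      · apply mul_nonneg
        · simp only [hfR]; split_ifs; exacts [(wt_pos _).le, le_rfl]
        · simp only [hfC]; split_ifs; exacts [(wt_pos _).le, le_rfl]
    have h3 := mul_le_mul_of_nonneg_left h2 hn'.le
    simp only [wt, one_div] at h3
    linarith
  have hsum := Finset.sum_le_sum fun σ (_ : σ ∈ (univ : Finset (Equiv.Perm (Fin n)))) =>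
    Finset.sum_le_sum fun τ (_ : τ ∈ (univ : Finset (Equiv.Perm (Fin n)))) => hpt σ τ
  refine hsum.trans ?_
  -- compute
  have hA : ∀ i : Fin n, ∑ σ : Equiv.Perm (Fin n), Real.log ((n : ℝ) - (σ i : ℕ)) =
      n.factorial * Real.log n.factorial / n := by
    intro i
    have := sum_perm_one (fun a : Fin n => Real.log ((n : ℝ) - (a : ℕ))) i
    rw [sum_log_wt] at this
    field_simp
    linarith
  have hW : ∀ i : Fin n, ∑ σ : Equiv.Perm (Fin n), wt (σ i) = n.factorial * Hn n / n := by
    intro i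
    have := sum_perm_one (fun a : Fin n => wt a) i
    field_simp
    rw [Hn]
    linarith
  have hfac : (0 : ℝ) < n.factorial := by exact_mod_cast n.factorial_pos
  have hrow_self : row (L.1 i j) = i := hcolinj (hrow _)
  have hcol_self : col (L.1 i j) = j := by simp [hcoldef]
  have hmemal : L.1 i j ∈ allowed := by
    simp only [hal, Finset.mem_filter, Finset.mem_univ, true_and]; exact h
  have hS : ∑ σ : Equiv.Perm (Fin n), ∑ τ : Equiv.Perm (Fin n), ∑ k ∈ allowed, fR k σ * fC k τ =
      ∑ k ∈ allowed, (∑ σ, fR k σ) * (∑ τ, fC k τ) := by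
    rw [Finset.sum_congr rfl fun σ _ => Finset.sum_comm, Finset.sum_comm]
    refine Finset.sum_congr rfl fun k _ => ?_
    rw [Finset.sum_mul_sum]
  have hS2 : ∑ k ∈ allowed, (∑ σ, fR k σ) * (∑ τ, fC k τ) ≤
      ((n.factorial : ℝ) / n) ^ 2 * ((allowed.card : ℝ) + (Hn n) ^ 2) := by
    rw [← Finset.add_sum_erase _ _ hmemal]
    have t1 : (∑ σ, fR (L.1 i j) σ) * (∑ τ, fC (L.1 i j) τ) =
        ((n.factorial : ℝ) / n) ^ 2 * (Hn n) ^ 2 := by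
      simp only [hfR, hfC, hrow_self, hcol_self, le_refl, if_true, hW]
      ring
    have t2 : ∑ k ∈ allowed.erase (L.1 i j), (∑ σ, fR k σ) * (∑ τ, fC k τ) ≤
        ((n.factorial : ℝ) / n) ^ 2 * (allowed.card : ℝ) := by
      have : ∀ k ∈ allowed.erase (L.1 i j), (∑ σ, fR k σ) * (∑ τ, fC k τ) ≤
          ((n.factorial : ℝ) / n) ^ 2 := by
        intro k hk
        have hk : k ≠ L.1 i j := (Finset.mem_erase.mp hk).1
        have r1 : row k ≠ i := by
          intro hh; apply hk; rw [← hrow k, hh]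
        have r2 : col k ≠ j := by
          intro hh; apply hk; rw [← hh]; simp [hcoldef]
        have s1 := sum_perm_two i (row k) r1
        have s2 := sum_perm_two j (col k) r2
        rw [mul_comm, ← le_div_iff₀ hn'] at s1 s2
        rw [sq]
        refine mul_le_mul s1 s2 (Finset.sum_nonneg fun τ _ => ?_) (by positivity)
        simp only [hfC]; split_ifs; exacts [(wt_pos _).le, le_rfl]
      refine (Finset.sum_le_card_nsmul _ _ _ this).trans ?_
      rw [nsmul_eq_mul, mul_comm]
      refine mul_le_mul_of_nonneg_left ?_ (by positivity)
      exact_mod_cast Finset.card_le_card (Finset.erase_subset _ _)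
    rw [t1]; linarith
  have hcard : (allowed.card : ℝ) = n - (if (i, j) ∈ P then 0 else (ecell E (i, j) : ℝ)) := by
    by_cases hP : (i, j) ∈ P
    · simp [hal, hP]
    · have e1 : allowed = (univ.filter fun k => (i, j, k) ∈ E)ᶜ := by
        ext k; simp [hal, hP]
      rw [e1, Finset.card_compl, Nat.cast_sub (Finset.card_le_univ _)]
      simp [hP, ecell]
  simp only [Finset.sum_sub_distrib, Finset.sum_add_distrib, ← Finset.mul_sum, Finset.sum_const,
    Finset.card_univ, Fintype.card_perm, Fintype.card_fin, nsmul_eq_mul, hA, hS]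
  have hS3 := mul_le_mul_of_nonneg_left hS2 hn'.le
  rw [hcard] at hS3
  unfold bcell
  set e : ℝ := (if (i, j) ∈ P then 0 else (ecell E (i, j) : ℝ))
  have hfin : (n : ℝ) * (((n.factorial : ℝ) / n) ^ 2 * ((n : ℝ) - e + (Hn n) ^ 2)) =
      (n.factorial : ℝ) ^ 2 * (1 - e / n + (Hn n) ^ 2 / n) := by
    field_simp
  rw [hfin] at hS3
  have hfin2 : (n.factorial : ℝ) * ((n.factorial : ℝ) * Real.log n.factorial / n) =
     (n.factorial : ℝ) ^ 2 * (Real.log n.factorial / n) := by ring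
  have hfin3 : (n.factorial : ℝ) * ((n.factorial : ℝ) * Real.log n) =
     (n.factorial : ℝ) ^ 2 * (Real.log n) := by ring
  have hfin4 : 2 * Real.log n.factorial / (n : ℝ) = 2 * (Real.log n.factorial / n) := by ring
  rw [hfin2, hfin3, hfin4]
  nlinarith

lemma family_bound {n : ℕ} (hn : 0 < n) (E : Finset (Fin n × Fin n × Fin n))
    (P : Finset (Fin n × Fin n)) (F : Finset (LatinSquare n))
    (hF : ∀ L ∈ F, ∀ c, c ∈ P ∨ (c.1, c.2, lfun L c) ∉ E) :
    (F.card : ℝ) ≤ Real.exp (∑ c, bcell E P c) := by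
  haveI : Nonempty (Fin n) := ⟨⟨0, hn⟩⟩
  set B := ∑ c, bcell E P c with hB
  set X : LatinSquare n → Equiv.Perm (Fin n) → Equiv.Perm (Fin n) → ℝ := fun L σ τ =>
    ∑ c, Real.log ((scell E P σ τ c (lfun L)).card) with hX
  have hfac : (0 : ℝ) < n.factorial := by exact_mod_cast n.factorial_pos
  have h1 : ∀ σ τ : Equiv.Perm (Fin n), ∑ L ∈ F, Real.exp (-X L σ τ) ≤ 1 := by
    intro σ τ
    have hk := kraft (ι := Fin n × Fin n) (K := Fin n) (fun c => toLex (σ c.1, τ c.2))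
      (scell E P σ τ) (by
        intro c c' f k hle
        simp only [scell]
        apply Finset.filter_congr
        intro k' _
        have e1 : ∀ i', σ i' < σ c.1 → Function.update f c' k (i', c.2) = f (i', c.2) := by
          intro i' hi'
          apply Function.update_of_ne
          rintro rfl
          rw [Prod.Lex.toLex_le_toLex] at hle
          simp only [lt_irrefl, le_refl, and_true] at hle
          rcases hle with hle | hle
          · exact lt_asymm hle hi'
          · exact hi'.ne hle.symm
        have e2 : ∀ j', τ j' < τ c.2 → Function.update f c' k (c.1, j') = f (c.1, j') := by
          intro j' hj'
          apply Function.update_of_ne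
          rintro rfl
          rw [Prod.Lex.toLex_le_toLex] at hle
          simp only [lt_irrefl, true_and, false_or] at hle
          exact absurd hj' (not_lt.mpr hle)
        refine and_congr_right fun _ => and_congr ?_ ?_
        · exact forall_congr' fun i' => imp_congr_right fun hi' => by rw [e1 i' hi']
        · exact forall_congr' fun j' => imp_congr_right fun hj' => by rw [e2 j' hj'])
    refine le_trans ?_ hk
    have h2 : ∑ L ∈ F, Real.exp (-X L σ τ) = ∑ f ∈ F.image lfun, ∏ c,
        (if f c ∈ scell E P σ τ c f then ((scell E P σ τ c f).card : ℝ)⁻¹ else 0) := by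
      rw [Finset.sum_image (fun _ _ _ _ h => lfun_injective h)]
      refine Finset.sum_congr rfl fun L hL => ?_
      rw [hX]
      simp only
      rw [← Finset.sum_neg_distrib, Real.exp_sum]
      refine Finset.prod_congr rfl fun c _ => ?_
      have hm := self_mem_scell E P σ τ c L (hF L hL c)
      rw [if_pos hm, Real.exp_neg, Real.exp_log]
      exact_mod_cast Finset.card_pos.mpr ⟨_, hm⟩
    rw [h2]
    refine Finset.sum_le_sum_of_subset_of_nonneg (Finset.subset_univ _) fun f _ _ => ?_
    refine Finset.prod_nonneg fun c _ => ?_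
    split_ifs <;> positivity
  have h2 : ∑ σ : Equiv.Perm (Fin n), ∑ τ : Equiv.Perm (Fin n), ∑ L ∈ F, Real.exp (-X L σ τ) ≤
      (n.factorial : ℝ) ^ 2 := by
    refine (Finset.sum_le_sum fun σ _ => Finset.sum_le_sum fun τ _ => h1 σ τ).trans (le_of_eq ?_)
    simp [Fintype.card_perm, sq]
  have h3 : ∀ L ∈ F, Real.exp (-B) * (n.factorial : ℝ) ^ 2 ≤
      ∑ σ : Equiv.Perm (Fin n), ∑ τ : Equiv.Perm (Fin n), Real.exp (-X L σ τ) := by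
    intro L hL
    have hXs : ∑ σ : Equiv.Perm (Fin n), ∑ τ : Equiv.Perm (Fin n), X L σ τ ≤
        (n.factorial : ℝ) ^ 2 * B := by
      simp only [hX]
      rw [Finset.sum_congr rfl fun σ _ => Finset.sum_comm, Finset.sum_comm, hB, Finset.mul_sum]
      exact Finset.sum_le_sum fun c _ => cell_bound hn E P c L (hF L hL c)
    have hpt : ∀ σ τ : Equiv.Perm (Fin n), Real.exp (-B) * (1 + B - X L σ τ) ≤
        Real.exp (-X L σ τ) := by
      intro σ τ
      have := Real.add_one_le_exp (B - X L σ τ)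
      calc _ ≤ Real.exp (-B) * Real.exp (B - X L σ τ) :=
            mul_le_mul_of_nonneg_left (by linarith) (Real.exp_pos _).le
        _ = _ := by rw [← Real.exp_add]; congr 1; ring
    refine le_trans ?_ (Finset.sum_le_sum fun σ _ => Finset.sum_le_sum fun τ _ => hpt σ τ)
    simp only [← Finset.mul_sum]
    refine mul_le_mul_of_nonneg_left ?_ (Real.exp_pos _).le
    simp only [Finset.sum_sub_distrib, Finset.sum_const, Finset.card_univ, Fintype.card_perm,
      Fintype.card_fin, nsmul_eq_mul]
    nlinarith
  have h4 : (F.card : ℝ) * (Real.exp (-B) * (n.factorial : ℝ) ^ 2) ≤ (n.factorial : ℝ) ^ 2 := by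
    rw [← nsmul_eq_mul]
    refine (Finset.card_nsmul_le_sum _ _ _ h3).trans ?_
    refine le_trans (le_of_eq ?_) h2
    rw [Finset.sum_comm]
    refine Finset.sum_congr rfl fun σ _ => ?_
    rw [Finset.sum_comm]
  have h5 : (F.card : ℝ) * Real.exp (-B) ≤ 1 := by
    have hp : (0 : ℝ) < (n.factorial : ℝ) ^ 2 := by positivity
    have : (F.card : ℝ) * Real.exp (-B) * (n.factorial : ℝ) ^ 2 ≤ 1 * (n.factorial : ℝ) ^ 2 := by
      linarith
    exact le_of_mul_le_mul_right this hp
  rw [Real.exp_neg, ← div_eq_mul_inv, div_le_one (Real.exp_pos _)] at h5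
  exact h5

def pset {n : ℕ} (E : Finset (Fin n × Fin n × Fin n)) (L : LatinSquare n) : Finset (Fin n × Fin n) :=
  univ.filter fun p : Fin n × Fin n => (p.1, p.2, (L.1 p.1) p.2) ∈ E

lemma sum_ecell {n : ℕ} (E : Finset (Fin n × Fin n × Fin n)) :
    ∑ c, ecell E c = E.card := by
  have : E.card = ∑ c : Fin n × Fin n, (E.filter fun t => (t.1, t.2.1) = c).card :=
    Finset.card_eq_sum_card_fiberwise (s := E) (t := (Finset.univ : Finset (Fin n × Fin n)))
      (f := fun t : Fin n × Fin n × Fin n => (t.1, t.2.1))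
      (fun t _ => Finset.mem_coe.mpr (Finset.mem_univ _))
  rw [this]
  refine Finset.sum_congr rfl fun c _ => ?_
  apply Finset.card_bij (fun k _ => (c.1, c.2, k))
  · intro k hk; simpa using hk
  · intro k _ k' _ h; simpa using h
  · rintro ⟨a, b, k⟩ ht
    simp only [Finset.mem_filter] at ht
    obtain ⟨h1, h2⟩ := ht
    subst h2
    exact ⟨k, by simpa using h1, rfl⟩

lemma sum_bcell {n : ℕ} (hn : 0 < n) (E : Finset (Fin n × Fin n × Fin n))
    (P : Finset (Fin n × Fin n)) (c δ : ℝ) (hE : c * (n : ℝ) ^ 3 ≤ (E.card : ℝ))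
    (hP : (P.card : ℝ) ≤ δ * (n : ℝ) ^ 2) :
    ∑ x, bcell E P x ≤ (n : ℝ) ^ 2 * (2 * Real.log (n.factorial) / n - Real.log n +
      (Hn n) ^ 2 / n - c + δ) := by
  have hn' : (0 : ℝ) < n := by exact_mod_cast hn
  have h1 : (E.card : ℝ) - n * P.card ≤ ∑ x, (if x ∈ P then 0 else (ecell E x : ℝ)) := by
    have h2 : ∑ x, (if x ∈ P then 0 else (ecell E x : ℝ)) = ∑ x, (ecell E x : ℝ) -
        ∑ x ∈ P, (ecell E x : ℝ) := by
      rw [eq_sub_iff_add_eq, ← Finset.univ_inter P, ← Finset.sum_ite_mem, ← Finset.sum_add_distrib]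
      refine Finset.sum_congr rfl fun x _ => ?_
      split_ifs <;> simp_all
    rw [h2]
    have h3 : ∑ x, (ecell E x : ℝ) = E.card := by exact_mod_cast sum_ecell E
    have h4 : ∑ x ∈ P, (ecell E x : ℝ) ≤ P.card • (n : ℝ) := by
      apply Finset.sum_le_card_nsmul
      intro x _
      have := Finset.card_le_univ (univ.filter fun k => (x.1, x.2, k) ∈ E)
      rw [Fintype.card_fin] at this
      exact_mod_cast this
    rw [nsmul_eq_mul] at h4
    rw [h3]; linarith
  unfold bcell
  rw [Finset.sum_sub_distrib, ← Finset.sum_div, Finset.sum_const, Finset.card_univ,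
    Fintype.card_prod, Fintype.card_fin, nsmul_eq_mul]
  push_cast
  have h5 : (c - δ) * (n : ℝ) ^ 2 ≤ (∑ x, (if x ∈ P then 0 else (ecell E x : ℝ))) / n := by
    rw [le_div_iff₀ hn']
    have := mul_le_mul_of_nonneg_left hP hn'.le
    nlinarith
  nlinarith

lemma count_sets {N : Type*} [Fintype N] [DecidableEq N] (x D : ℝ) (hx : 0 < x) (hx1 : x ≤ 1) :
    (((univ : Finset (Finset N)).filter fun P => (P.card : ℝ) < D).card : ℝ) ≤
      Real.exp (D * (-Real.log x) + x * Fintype.card N) := by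
  have hl : Real.log x ≤ 0 := Real.log_nonpos hx.le hx1
  have h1 : (((univ : Finset (Finset N)).filter fun P => (P.card : ℝ) < D).card : ℝ) ≤
      ∑ P : Finset N, Real.exp (D * (-Real.log x)) * x ^ P.card := by
    rw [Finset.card_eq_sum_ones]
    push_cast
    refine (Finset.sum_le_sum fun P hP => ?_).trans
      (Finset.sum_le_sum_of_subset_of_nonneg (Finset.subset_univ _) fun P _ _ => by positivity)
    have hP : (P.card : ℝ) < D := by simpa using hP
    have : x ^ P.card = Real.exp (P.card * Real.log x) := by
      rw [Real.exp_nat_mul, Real.exp_log hx]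
    rw [this, ← Real.exp_add]
    apply Real.one_le_exp
    nlinarith
  refine h1.trans ?_
  rw [← Finset.mul_sum, Real.exp_add]
  refine mul_le_mul_of_nonneg_left ?_ (Real.exp_pos _).le
  have h2 : ∑ P : Finset N, x ^ P.card = (1 + x) ^ (Fintype.card N) := by
    have := Finset.sum_pow_mul_eq_add_pow x 1 (univ : Finset N)
    simpa [Finset.powerset_univ, add_comm] using this
  rw [h2, mul_comm, Real.exp_nat_mul]
  have := Real.add_one_le_exp x
  gcongr
  linarith

lemma log_fac (n : ℕ) (hn : 0 < n) :
    Real.log (n.factorial) ≤ n * Real.log n - n + 1 + Real.log n := by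
  induction n, hn using Nat.le_induction with
  | base => simp
  | succ n hn ih =>
    have hn' : (0 : ℝ) < n := by exact_mod_cast hn
    rw [Nat.factorial_succ]
    push_cast
    rw [Real.log_mul (by positivity) (by positivity)]
    have h1 := Real.log_le_sub_one_of_pos (x := (n : ℝ) / (n + 1)) (by positivity)
    rw [Real.log_div (by positivity) (by positivity)] at h1
    have h2 : (n : ℝ) / (n + 1) - 1 = -1 / (n + 1) := by field_simp; ring
    rw [h2] at h1
    have h3 := mul_le_mul_of_nonneg_left h1 (show (0 : ℝ) ≤ n + 1 by positivity)
    have h4 : ((n : ℝ) + 1) * (-1 / (n + 1)) = -1 := by field_simp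
    rw [h4] at h3
    nlinarith

lemma Hn_le (n : ℕ) : Hn n ≤ 1 + Real.log n := by
  have h := harmonic_le_one_add_log n
  refine le_trans (le_of_eq ?_) h
  rw [harmonic, ← Finset.sum_range_reflect, Finset.sum_range]
  unfold Hn wt
  push_cast
  refine Finset.sum_congr rfl fun a _ => ?_
  have := a.2
  have e : ((n - 1 - (a : ℕ) : ℕ) : ℝ) + 1 = (n : ℝ) - (a : ℕ) := by
    rw [Nat.cast_sub (by omega), Nat.cast_sub (by omega)]; push_cast; ring
  rw [e, one_div]

lemma Hn_nonneg (n : ℕ) : 0 ≤ Hn n := Finset.sum_nonneg fun a _ => (wt_pos a).le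

lemma err_small (c : ℝ) (hc : 0 < c) : ∃ n₀ : ℕ, ∀ n : ℕ, n₀ ≤ n → 0 < n ∧
    (1 + Real.log n) / n + (1 + Real.log n) ^ 2 / n < c / 2 := by
  have h1 : Filter.Tendsto (fun x : ℝ => (1 + Real.log x) / x + (1 + Real.log x) ^ 2 / x)
      Filter.atTop (nhds 0) := by
    have a0 : Filter.Tendsto (fun x : ℝ => x⁻¹) Filter.atTop (nhds 0) := tendsto_inv_atTop_zero
    have a1 := Real.tendsto_pow_log_div_mul_add_atTop 1 0 1 one_ne_zero
    have a2 := Real.tendsto_pow_log_div_mul_add_atTop 1 0 2 one_ne_zero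
    have := ((a0.const_mul 2).add (a1.const_mul 3)).add a2
    simp only [mul_zero, add_zero] at this
    refine this.congr fun x => ?_
    simp only [one_mul, pow_one]
    ring
  have h2 := h1.comp (tendsto_natCast_atTop_atTop (R := ℝ))
  have h3 := (h2.eventually (gt_mem_nhds (show (0 : ℝ) < c / 2 by positivity))).and
    (Filter.eventually_gt_atTop 0)
  obtain ⟨n₀, h⟩ := Filter.eventually_atTop.mp h3
  exact ⟨n₀, fun n hn => ⟨(h n hn).2, (h n hn).1⟩⟩

/-- **Theorem (large deviations for Latin squares).** Let `0 < c ≤ 1`.  There exists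
`n₀(c)` such that for all `n ≥ n₀(c)` and every family `𝓔 ⊆ T_n(2)` with `|𝓔| ≥ c·n³`,
a uniformly random Latin square `L` of order `n` satisfies
`P[f_𝓔(L) < 10⁻³·c²·n²] < e^{−10⁻³·c²·n²}`. -/
theorem latin_square_large_deviations (c : ℝ) (hc0 : 0 < c) (hc1 : c ≤ 1) :
    ∃ n₀ : ℕ, ∀ n : ℕ, n₀ ≤ n → ∀ E : Finset (Fin n × Fin n × Fin n),
      c * (n : ℝ) ^ 3 ≤ (E.card : ℝ) →
      (((univ : Finset (LatinSquare n)).filter fun L =>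
          (fE E L : ℝ) < (10 : ℝ) ^ (-(3 : ℤ)) * c ^ 2 * (n : ℝ) ^ 2).card : ℝ) /
        ((univ : Finset (LatinSquare n)).card : ℝ) <
        Real.exp (-((10 : ℝ) ^ (-(3 : ℤ)) * c ^ 2 * (n : ℝ) ^ 2)) := by
  obtain ⟨n₀, hn₀⟩ := err_small c hc0
  refine ⟨n₀, fun n hn E hE => ?_⟩
  obtain ⟨hnpos, herr⟩ := hn₀ n hn
  have hn' : (0 : ℝ) < n := by exact_mod_cast hnpos
  have hδ : (10 : ℝ) ^ (-(3 : ℤ)) * c ^ 2 = c ^ 2 / 1000 := by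
    norm_num; ring
  rw [hδ]
  set δ : ℝ := c ^ 2 / 1000 with hδdef
  have hδpos : 0 < δ := by positivity
  have hδc : δ ≤ c / 1000 := by rw [hδdef]; gcongr; nlinarith
  set bad := (univ : Finset (LatinSquare n)).filter fun L => (fE E L : ℝ) < δ * (n : ℝ) ^ 2 with hbad
  set PS := (univ : Finset (Finset (Fin n × Fin n))).filter fun P =>
    (P.card : ℝ) < δ * (n : ℝ) ^ 2 with hPS
  set β : ℝ := 2 * Real.log (n.factorial) / n - Real.log n + (Hn n) ^ 2 / n - c + δ with hβ
  have hcount : (bad.card : ℝ) ≤ PS.card * Real.exp ((n : ℝ) ^ 2 * β) := by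
    have h1 : bad.card = ∑ P ∈ PS, (bad.filter fun L => pset E L = P).card := by
      apply Finset.card_eq_sum_card_fiberwise
      intro L hL
      simp only [hbad, Finset.coe_filter, Finset.mem_univ, true_and] at hL
      simp only [hPS, Finset.coe_filter, Finset.mem_univ, true_and]
      exact hL
    rw [h1]
    push_cast
    rw [← nsmul_eq_mul]
    apply Finset.sum_le_card_nsmul
    intro P hP
    have hP : (P.card : ℝ) < δ * (n : ℝ) ^ 2 := by simpa [hPS] using hP
    refine (family_bound hnpos E P _ ?_).trans
      (Real.exp_le_exp.mpr (sum_bcell hnpos E P c δ hE hP.le))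
    intro L hL x
    obtain ⟨-, rfl⟩ := Finset.mem_filter.mp hL
    by_cases hx : (x.1, x.2, lfun L x) ∈ E
    · left
      simp only [pset, Finset.mem_filter, Finset.mem_univ, true_and]
      exact hx
    · exact Or.inr hx
  have hsets := count_sets (N := Fin n × Fin n) (c / 4) (δ * (n : ℝ) ^ 2) (by positivity)
    (by linarith)
  have hlc : -Real.log (c / 4) ≤ 4 / c := by
    rw [← Real.log_inv, inv_div]
    have := Real.log_le_sub_one_of_pos (x := 4 / c) (by positivity)
    linarith
  have hδl : δ * (-Real.log (c / 4)) ≤ c / 250 := by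
    calc _ ≤ δ * (4 / c) := by gcongr
      _ = c / 250 := by rw [hδdef]; field_simp; norm_num
  rw [Fintype.card_prod, Fintype.card_fin] at hsets
  push_cast at hsets
  have hsets2 : (PS.card : ℝ) ≤ Real.exp ((n : ℝ) ^ 2 * (c / 250 + c / 4)) := by
    refine hsets.trans (Real.exp_le_exp.mpr ?_)
    have : (0 : ℝ) ≤ (n : ℝ) ^ 2 := by positivity
    nlinarith
  have hlat := latin_count n
  have hfac : (0 : ℝ) < n.factorial := by exact_mod_cast n.factorial_pos
  have hlat2 : Real.exp (n * Real.log n.factorial - (n : ℝ) ^ 2) ≤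
      ((univ : Finset (LatinSquare n)).card : ℝ) := by
    refine le_trans (le_of_eq ?_) hlat
    rw [sub_eq_add_neg, Real.exp_add, Real.exp_nat_mul, Real.exp_log hfac]
  have hlatpos : (0 : ℝ) < ((univ : Finset (LatinSquare n)).card : ℝ) :=
    (Real.exp_pos _).trans_le hlat2
  rw [div_lt_iff₀ hlatpos]
  have hb : (bad.card : ℝ) ≤ Real.exp ((n : ℝ) ^ 2 * (c / 250 + c / 4) + (n : ℝ) ^ 2 * β) := by
    rw [Real.exp_add]
    exact hcount.trans (mul_le_mul_of_nonneg_right hsets2 (Real.exp_pos _).le)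
  refine lt_of_le_of_lt hb ?_
  refine lt_of_lt_of_le ?_ (mul_le_mul_of_nonneg_left hlat2 (Real.exp_pos _).le)
  rw [← Real.exp_add, Real.exp_lt_exp]
  have hlf := log_fac n hnpos
  have hH : (Hn n) ^ 2 / n ≤ (1 + Real.log n) ^ 2 / n := by
    have h1 := Hn_le n
    have h2 := Hn_nonneg n
    gcongr
  set A := Real.log n.factorial / n with hA
  have hA1 : 2 * Real.log n.factorial / n = 2 * A := by rw [hA]; ring
  have hA2 : n * Real.log n.factorial = (n : ℝ) ^ 2 * A := by rw [hA]; field_simp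
  have hA3 : A ≤ Real.log n - 1 + (1 + Real.log n) / n := by
    rw [hA, div_le_iff₀ hn', add_mul, div_mul_cancel₀ _ hn'.ne']
    linarith
  rw [hA1] at hβ
  rw [hA2]
  have hfin : c / 250 + c / 4 + β + δ - A + 1 < 0 := by
    rw [hβ]; linarith
  have hn2 : (0 : ℝ) < (n : ℝ) ^ 2 := by positivity
  have := mul_neg_of_pos_of_neg hn2 hfin
  linarith
end
end

section
/- Let 0 < γ ≤ 1/2 with γn/2 an integer, let E_1,…,E_n ⊆ [n]² be sets with max_{1≤i≤n}|{j : (i,j) ∈ E_m}| ≤ n/2 for every 1 ≤ m ≤ n, and let I ⊆ [n] with |I| = γn/2 be such that |E_i| ≥ γ·n² for all i ∈ I. Then the number of Latin squares L=(π_1,…,π_n) of order n satisfying g_{E_i}(π_i) < γn/10 for all i ∈ I is at most (2n)^{γn} · (∏_{k=1}^n (k!)^{n/k}) · e^{−γ²n²/40}. -/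
open Finset
open scoped Classical

noncomputable section

/-- For `E ⊆ [n]²` and a permutation `π` of `[n]`,
`g_E(π) = |{i ∈ [n] : (i, π(i)) ∈ E}|`. -/
def gE {n : ℕ} (E : Finset (Fin n × Fin n)) (π : Equiv.Perm (Fin n)) : ℕ :=
  (univ.filter fun i : Fin n => (i, π i) ∈ E).card


lemma entropy_aux {Ω β : Type} [DecidableEq β] (S : Finset Ω) (φ : Ω → β) (D : Finset β)
    (h : ∀ σ ∈ S, φ σ ∈ D) :
    (S.card : ℝ) * Real.log S.card ≤
      ∑ σ ∈ S, (Real.log D.card + Real.log ((S.filter fun τ => φ τ = φ σ).card : ℝ)) := by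
  rcases S.eq_empty_or_nonempty with rfl | hS
  · simp
  have hSc : (0 : ℝ) < S.card := by exact_mod_cast hS.card_pos
  have hDc : (0 : ℝ) < D.card := by
    obtain ⟨σ, hσ⟩ := hS
    exact_mod_cast Finset.card_pos.2 ⟨_, h σ hσ⟩
  have ht : ∀ σ ∈ S, (0 : ℝ) < ((S.filter fun τ => φ τ = φ σ).card : ℝ) := by
    intro σ hσ
    exact_mod_cast Finset.card_pos.2 ⟨σ, by simp [hσ]⟩
  have key : ∑ σ ∈ S, (1 / ((S.filter fun τ => φ τ = φ σ).card : ℝ)) ≤ D.card := by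
    rw [← Finset.sum_fiberwise_of_maps_to h]
    calc _ ≤ ∑ b ∈ D, (1 : ℝ) := by
          apply Finset.sum_le_sum
          intro b _
          have : ∀ σ ∈ S.filter (fun i => φ i = b),
              (1 / ((S.filter fun τ => φ τ = φ σ).card : ℝ)) =
              1 / ((S.filter fun τ => φ τ = b).card : ℝ) := by
            intro σ hσ
            rw [(Finset.mem_filter.1 hσ).2]
          rw [Finset.sum_congr rfl this, Finset.sum_const, nsmul_eq_mul]
          rw [mul_one_div]
          exact div_self_le_one _
      _ = _ := by simp
  have h1 : ∀ σ ∈ S, Real.log S.card ≤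
      (Real.log D.card + Real.log ((S.filter fun τ => φ τ = φ σ).card : ℝ)) +
      ((S.card : ℝ) / D.card * (1 / ((S.filter fun τ => φ τ = φ σ).card : ℝ)) - 1) := by
    intro σ hσ
    have := ht σ hσ
    have h2 := Real.log_le_sub_one_of_pos
      (x := (S.card : ℝ) / D.card * (1 / ((S.filter fun τ => φ τ = φ σ).card : ℝ))) (by positivity)
    rw [Real.log_mul (by positivity) (by positivity), Real.log_div (by positivity) (by positivity),
      Real.log_div (by positivity) (by positivity), Real.log_one] at h2
    linarith
  have h2 := Finset.sum_le_sum h1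
  rw [Finset.sum_const, nsmul_eq_mul, Finset.sum_add_distrib, Finset.sum_sub_distrib,
    ← Finset.mul_sum, Finset.sum_const, nsmul_eq_mul, mul_one] at h2
  have h3 : (S.card : ℝ) / D.card * ∑ σ ∈ S, (1 / ((S.filter fun τ => φ τ = φ σ).card : ℝ)) ≤
      S.card := by
    calc _ ≤ (S.card : ℝ) / D.card * D.card := by gcongr
      _ = _ := by field_simp
  linarith

def FF (d : ℕ) : ℝ := Real.log (d.factorial : ℝ) / d

lemma FF_nonneg (d : ℕ) : 0 ≤ FF d := by
  unfold FF
  apply div_nonneg (Real.log_nonneg _) (by positivity)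
  exact_mod_cast d.factorial_pos

lemma FF_rec (d : ℕ) (hd : 1 ≤ d) :
    Real.log d + ((d : ℝ) - 1) * FF (d - 1) = d * FF d := by
  obtain ⟨c, rfl⟩ : ∃ c, d = c + 1 := ⟨d - 1, by omega⟩
  unfold FF
  simp only [Nat.add_sub_cancel, Nat.factorial_succ]
  push_cast
  rw [Real.log_mul (by positivity) (by positivity)]
  rcases Nat.eq_zero_or_pos c with rfl | hc
  · simp
  have : (c : ℝ) ≠ 0 := by positivity
  have : (c : ℝ) + 1 ≠ 0 := by positivity
  field_simp
  ring

def SS {α : Type} [Fintype α] [DecidableEq α] (A : α → Finset α) (R : Finset α) (σ₀ : Equiv.Perm α) :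
    Finset (Equiv.Perm α) :=
  univ.filter fun σ => (∀ x, x ∉ R → σ x = σ₀ x) ∧ ∀ x ∈ R, σ x ∈ A x

lemma image_eq {α : Type} [Fintype α] [DecidableEq α] (R : Finset α) (σ σ₀ : Equiv.Perm α)
    (h : ∀ x, x ∉ R → σ x = σ₀ x) : R.image σ = R.image σ₀ := by
  have h2 : ∀ τ : Equiv.Perm α, R.image τ = (Rᶜ.image τ)ᶜ := by
    intro τ
    ext y
    simp only [mem_image, mem_compl, not_exists, not_and]
    constructor
    · rintro ⟨x, hx, rfl⟩ z hz hzx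
      exact hz (τ.injective hzx ▸ hx)
    · intro hy
      refine ⟨τ.symm y, ?_, by simp⟩
      by_contra hc
      exact hy _ hc (by simp)
  rw [h2, h2]
  congr 1
  apply Finset.image_congr
  intro x hx
  apply h
  simpa using hx

lemma bregman_log {α : Type} [Fintype α] [DecidableEq α] (A : α → Finset α) :
    ∀ (m : ℕ) (R : Finset α) (σ₀ : Equiv.Perm α), R.card = m →
      Real.log ((SS A R σ₀).card : ℝ) ≤ ∑ x ∈ R, FF ((A x ∩ R.image σ₀).card) := by
  intro m
  induction m with
  | zero =>
    intro R σ₀ hR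
    rw [Finset.card_eq_zero] at hR
    subst hR
    have : SS A ∅ σ₀ = {σ₀} := by
      ext σ
      simp [SS, Equiv.ext_iff]
    simp [this]
  | succ m ih =>
    intro R σ₀ hR
    set S := SS A R σ₀ with hS
    rcases S.eq_empty_or_nonempty with hE | hne
    · rw [hE]; simp
      exact Finset.sum_nonneg fun _ _ => FF_nonneg _
    have hSc : (0 : ℝ) < S.card := by exact_mod_cast hne.card_pos
    set C := R.image σ₀ with hC
    have hmem : ∀ σ ∈ S, (∀ x, x ∉ R → σ x = σ₀ x) ∧ ∀ x ∈ R, σ x ∈ A x := by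
      intro σ hσ
      simpa [hS, SS] using hσ
    have himg : ∀ σ ∈ S, R.image σ = C := fun σ hσ => image_eq R σ σ₀ (hmem σ hσ).1
    have hD : ∀ i ∈ R, ∀ σ ∈ S, σ i ∈ A i ∩ C := by
      intro i hi σ hσ
      rw [Finset.mem_inter, ← himg σ hσ]
      exact ⟨(hmem σ hσ).2 i hi, Finset.mem_image_of_mem _ hi⟩
    have h1 : ∀ i ∈ R, (S.card : ℝ) * Real.log S.card ≤
        ∑ σ ∈ S, (Real.log (A i ∩ C).card +
          ∑ x ∈ R.erase i, FF ((A x ∩ (R.erase i).image σ).card)) := by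
      intro i hi
      refine (entropy_aux S (fun σ => σ i) (A i ∩ C) (hD i hi)).trans ?_
      apply Finset.sum_le_sum
      intro σ hσ
      gcongr
      refine le_trans ?_ (ih (R.erase i) σ (by rw [Finset.card_erase_of_mem hi, hR]; rfl))
      apply Real.log_le_log
      · exact_mod_cast Finset.card_pos.2 ⟨σ, by simp [hσ]⟩
      · norm_cast
        apply Finset.card_le_card
        intro τ hτ
        rw [Finset.mem_filter] at hτ
        have hτ1 := hmem τ hτ.1
        have hσ1 := hmem σ hσ
        simp only [SS, mem_filter, mem_univ, true_and, Finset.mem_erase]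
        refine ⟨fun x hx => ?_, fun x hx => hτ1.2 x hx.2⟩
        by_cases hxi : x = i
        · rw [hxi]; exact hτ.2
        · have : x ∉ R := fun h => hx ⟨hxi, h⟩
          rw [hτ1.1 x this, hσ1.1 x this]
    have h2 := Finset.sum_le_sum h1
    rw [Finset.sum_const, nsmul_eq_mul, Finset.sum_comm] at h2
    have h3 : ∀ σ ∈ S, ∑ i ∈ R, (Real.log (A i ∩ C).card +
          ∑ x ∈ R.erase i, FF ((A x ∩ (R.erase i).image σ).card)) =
          R.card * ∑ x ∈ R, FF ((A x ∩ C).card) := by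
      intro σ hσ
      have hσ1 := hmem σ hσ
      have e1 : ∑ i ∈ R, ∑ x ∈ R.erase i, FF ((A x ∩ (R.erase i).image σ).card) =
          ∑ x ∈ R, ∑ i ∈ R.erase x, FF ((A x ∩ (R.erase i).image σ).card) := by
        apply Finset.sum_comm'
        intro x y
        simp only [mem_erase]
        tauto
      rw [Finset.sum_add_distrib, e1, ← Finset.sum_add_distrib, Finset.mul_sum]
      apply Finset.sum_congr rfl
      intro x hx
      set d := (A x ∩ C).card with hd
      have hd1 : 1 ≤ d := Finset.card_pos.2 ⟨_, hD x hx σ hσ⟩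
      have e2 : ∀ i ∈ R.erase x, FF ((A x ∩ (R.erase i).image σ).card) =
          if σ i ∈ A x then FF (d - 1) else FF d := by
        intro i hi
        have hiR := Finset.mem_of_mem_erase hi
        have e3 : A x ∩ (R.erase i).image σ = (A x ∩ C).erase (σ i) := by
          rw [Finset.image_erase σ.injective, himg σ hσ]
          ext y; simp only [mem_inter, mem_erase]; tauto
        rw [e3]
        split_ifs with hc
        · rw [Finset.card_erase_of_mem]
          exact Finset.mem_inter.2 ⟨hc, by rw [← himg σ hσ]; exact Finset.mem_image_of_mem _ hiR⟩
        · rw [Finset.erase_eq_of_notMem]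
          intro h; exact hc (Finset.mem_inter.1 h).1
      rw [Finset.sum_congr rfl e2, Finset.sum_ite, Finset.sum_const, Finset.sum_const,
        nsmul_eq_mul, nsmul_eq_mul]
      have c1 : (R.filter (fun i => σ i ∈ A x)).card = d := by
        rw [hd, ← Finset.card_image_of_injective _ σ.injective]
        congr 1
        ext y
        rw [← himg σ hσ]
        simp only [mem_image, mem_filter, mem_inter]
        constructor
        · rintro ⟨a, ⟨h, h'⟩, rfl⟩; exact ⟨h', a, h, rfl⟩
        · rintro ⟨h', a, h, rfl⟩; exact ⟨a, ⟨h, h'⟩, rfl⟩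
      have c2 : ((R.erase x).filter (fun i => σ i ∈ A x)).card = d - 1 := by
        rw [Finset.filter_erase, Finset.card_erase_of_mem, c1]
        simp [hx, hσ1.2 x hx]
      have c3 : (((R.erase x).filter (fun i => σ i ∈ A x)).card : ℝ) +
          (((R.erase x).filter (fun i => ¬ σ i ∈ A x)).card : ℝ) = R.card - 1 := by
        have := Finset.card_filter_add_card_filter_not (s := R.erase x) (fun i => σ i ∈ A x)
        rw [Finset.card_erase_of_mem hx] at this
        have hp : 1 ≤ R.card := by omega
        rw [← Nat.cast_add, this, Nat.cast_sub hp]; simp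
      rw [c2, Nat.cast_sub hd1] at c3
      rw [c2, Nat.cast_sub hd1]
      have := FF_rec d hd1
      push_cast at c3 ⊢
      have c4 : (((R.erase x).filter (fun i => ¬ σ i ∈ A x)).card : ℝ) = R.card - d := by linarith
      rw [c4]
      linarith
    rw [Finset.sum_congr rfl h3, Finset.sum_const, nsmul_eq_mul] at h2
    have hRp : (0 : ℝ) < R.card := by rw [hR]; positivity
    have h4 : ((R.card : ℝ) * S.card) * Real.log S.card ≤
      ((R.card : ℝ) * S.card) * ∑ x ∈ R, FF ((A x ∩ C).card) := by linarith
    exact le_of_mul_le_mul_left h4 (by positivity)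

lemma bregman {α : Type} [Fintype α] [DecidableEq α] (A : α → Finset α) :
    (((univ : Finset (Equiv.Perm α)).filter fun σ => ∀ x, σ x ∈ A x).card : ℝ) ≤
      ∏ x, Real.exp (FF (A x).card) := by
  have h := bregman_log A _ univ (Equiv.refl α) rfl
  have e1 : SS A univ (Equiv.refl α) = univ.filter fun σ => ∀ x, σ x ∈ A x := by
    simp [SS]
  have e2 : (univ : Finset α).image (Equiv.refl α) = univ := by
    ext; simp
  rw [e1, e2] at h
  simp only [Finset.inter_univ] at h
  rw [← Real.exp_sum]
  exact (Real.le_exp_log _).trans (Real.exp_le_exp.2 h)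

lemma log_fact_upper (d : ℕ) (hd : 1 ≤ d) :
    Real.log (d.factorial : ℝ) ≤ 1 + 1 / 2 * Real.log d + d * Real.log d - d := by
  obtain ⟨c, rfl⟩ : ∃ c, d = c + 1 := ⟨d - 1, by omega⟩
  have h := Stirling.log_stirlingSeq'_antitone (Nat.zero_le c)
  simp only [Function.comp, Nat.succ_eq_add_one, zero_add] at h
  rw [Stirling.log_stirlingSeq_formula, Stirling.log_stirlingSeq_formula] at h
  have hp : (0 : ℝ) < ((c + 1 : ℕ) : ℝ) := by positivity
  rw [Real.log_mul (by norm_num) hp.ne', Real.log_div hp.ne' (by positivity), Real.log_exp] at h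
  simp at h
  push_cast at h ⊢
  linarith

lemma log_fact_lower (k : ℕ) (hk : 1 ≤ k) :
    k * Real.log k - k ≤ Real.log (k.factorial : ℝ) := by
  have hp : (0 : ℝ) < k := by exact_mod_cast hk
  have h := Real.pow_div_factorial_le_exp (k : ℝ) hp.le k
  have h2 := Real.log_le_log (by positivity) h
  rw [Real.log_exp, Real.log_div (by positivity) (by positivity), Real.log_pow] at h2
  linarith

lemma FF_upper (n d : ℕ) (hn : 4 ≤ n) (hd : 1 ≤ d) (hdn : d ≤ n) :
    FF d ≤ Real.log (d + 3 / 2 * Real.log (2 * n)) - 1 := by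
  set s := 3 / 2 * Real.log (2 * n) with hs
  have hdp : (0 : ℝ) < d := by exact_mod_cast hd
  have hl2 := Real.log_two_gt_d9
  have hl2' := Real.log_two_lt_d9
  have hs1 : 3.11 ≤ s := by
    have : Real.log 8 ≤ Real.log (2 * n) := by
      apply Real.log_le_log (by norm_num)
      have : (4 : ℝ) ≤ n := by exact_mod_cast hn
      linarith
    have h8 : Real.log 8 = 3 * Real.log 2 := by
      rw [show (8 : ℝ) = 2 ^ 3 by norm_num, Real.log_pow]; norm_num
    rw [hs]; linarith
  set l := Real.log d with hl
  have hl0 : 0 ≤ l := Real.log_nonneg (by exact_mod_cast hd)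
  have hs2 : 3 / 2 * l + 1.03 ≤ s := by
    have : Real.log (2 * d) ≤ Real.log (2 * n) := by
      apply Real.log_le_log (by positivity)
      have : (d : ℝ) ≤ n := by exact_mod_cast hdn
      linarith
    rw [Real.log_mul (by norm_num) hdp.ne'] at this
    rw [hs]; linarith
  have key : 1 + 1 / 2 * l ≤ d * Real.log (1 + s / d) := by
    have h1 := Real.le_log_one_add_of_nonneg (x := s / d) (by positivity)
    have h2 : d * (2 * (s / d) / (s / d + 2)) = 2 * d * s / (s + 2 * d) := by
      field_simp
    have h3 : 1 + 1 / 2 * l ≤ 2 * d * s / (s + 2 * d) := by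
      rw [le_div_iff₀ (by positivity)]
      rcases Nat.lt_or_ge 1 d with h | h
      · have hd2 : (2 : ℝ) ≤ d := by exact_mod_cast h
        have hld : l ≤ Real.log 2 + (d / 2 - 1) := by
          have := Real.log_le_sub_one_of_pos (x := (d : ℝ) / 2) (by positivity)
          rw [Real.log_div hdp.ne' (by norm_num)] at this
          linarith
        have a1 : 2 + l ≤ 1.6 * d := by linarith
        have a2 : 2 + l ≤ 1.2 * s := by linarith
        have b1 := mul_le_mul_of_nonneg_right a1 (by linarith : 0 ≤ s)
        have b2 := mul_le_mul_of_nonneg_right a2 hdp.le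
        nlinarith
      · have : d = 1 := by omega
        have hd' : (d : ℝ) = 1 := by exact_mod_cast this
        have hl' : l = 0 := by rw [hl, hd']; simp
        rw [hd', hl']; linarith
    calc _ ≤ _ := h3
      _ = _ := h2.symm
      _ ≤ _ := by gcongr
  have hf := log_fact_upper d hd
  have e : Real.log (d + s) = l + Real.log (1 + s / d) := by
    rw [hl, ← Real.log_mul hdp.ne' (by positivity)]
    congr 1
    field_simp
  unfold FF
  rw [e, div_le_iff₀ hdp]
  nlinarith

lemma FF_lin (n k d : ℕ) (hn : 4 ≤ n) (hk : 1 ≤ k) (hkn : k ≤ n) (hd : d ≤ k) :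
    Real.exp (FF d) ≤ Real.exp (FF k) * ((d + 3 / 2 * Real.log (2 * n)) / k) := by
  have hkp : (0 : ℝ) < k := by exact_mod_cast hk
  have hs1 : 3.11 ≤ 3 / 2 * Real.log (2 * n) := by
    have hl2 := Real.log_two_gt_d9
    have : Real.log 8 ≤ Real.log (2 * n) := by
      apply Real.log_le_log (by norm_num)
      have : (4 : ℝ) ≤ n := by exact_mod_cast hn
      linarith
    have h8 : Real.log 8 = 3 * Real.log 2 := by
      rw [show (8 : ℝ) = 2 ^ 3 by norm_num, Real.log_pow]; norm_num
    linarith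
  have h1 : Real.exp (FF d) ≤ Real.exp (-1) * (d + 3 / 2 * Real.log (2 * n)) := by
    rcases Nat.eq_zero_or_pos d with rfl | hd0
    · simp only [FF, Nat.factorial_zero, Nat.cast_one, Real.log_one, zero_div, Real.exp_zero,
        Nat.cast_zero, zero_add]
      rw [Real.exp_neg, inv_mul_eq_div, le_div_iff₀ (Real.exp_pos _)]
      have := Real.exp_one_lt_d9
      linarith
    · have h := FF_upper n d hn hd0 (hd.trans hkn)
      calc _ ≤ Real.exp (Real.log (d + 3 / 2 * Real.log (2 * n)) - 1) := Real.exp_le_exp.2 h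
        _ = _ := by rw [sub_eq_add_neg, Real.exp_add, Real.exp_log (by positivity), mul_comm]
  have h2 : Real.exp (-1) ≤ Real.exp (FF k) / k := by
    rw [le_div_iff₀ hkp]
    calc Real.exp (-1) * k = Real.exp (Real.log k - 1) := by
          rw [sub_eq_add_neg, Real.exp_add, Real.exp_log hkp, mul_comm]
      _ ≤ _ := by
        apply Real.exp_le_exp.2
        unfold FF
        rw [le_div_iff₀ hkp]
        have := log_fact_lower k hk
        linarith
  calc _ ≤ _ := h1
    _ ≤ Real.exp (FF k) / k * (d + 3 / 2 * Real.log (2 * n)) := by gcongr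
    _ = _ := by ring

lemma thin {α : Type} [Fintype α] [DecidableEq α] (A B : α → Finset α) :
    ∑ π ∈ (univ : Finset (Equiv.Perm α)).filter (fun σ => ∀ x, σ x ∈ A x),
      ∏ x, (((B x).powerset.filter fun T => π x ∉ T).card : ℝ) ≤
    ∏ x, ∑ T ∈ (B x).powerset, Real.exp (FF (A x \ T).card) := by
  rw [Finset.prod_univ_sum]
  calc _ = ∑ π ∈ (univ : Finset (Equiv.Perm α)).filter (fun σ => ∀ x, σ x ∈ A x),
        ∑ T ∈ Fintype.piFinset (fun x => (B x).powerset),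
          if (∀ x, π x ∉ T x) then (1 : ℝ) else 0 := by
        apply Finset.sum_congr rfl
        intro π _
        rw [Finset.sum_boole, ← Nat.cast_prod, ← Fintype.card_piFinset]
        congr 2
        ext T
        simp only [Fintype.mem_piFinset, mem_filter]
        exact forall_and
    _ ≤ _ := by
        rw [Finset.sum_comm]
        apply Finset.sum_le_sum
        intro T _
        refine le_trans (le_of_eq ?_) (bregman (fun x => A x \ T x))
        rw [Finset.sum_boole, Finset.filter_filter]
        congr 2
        ext π
        simp only [mem_filter, mem_univ, true_and, mem_sdiff]
        exact forall_and.symm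

lemma card_avoid {α : Type} [DecidableEq α] (B : Finset α) (p : α) :
    ((B.powerset.filter fun T => p ∉ T).card : ℝ) =
      2 ^ B.card * (if p ∈ B then 1 / 2 else 1) := by
  have : (B.powerset.filter fun T => p ∉ T) = (B.erase p).powerset := by
    ext T
    simp only [mem_filter, mem_powerset, Finset.subset_erase]
  rw [this, Finset.card_powerset]
  split_ifs with h
  · rw [Finset.card_erase_of_mem h]
    have : 1 ≤ B.card := Finset.card_pos.2 ⟨p, h⟩
    obtain ⟨c, hc⟩ : ∃ c, B.card = c + 1 := ⟨B.card - 1, by omega⟩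
    rw [hc, Nat.add_sub_cancel]; push_cast; rw [pow_succ]; ring
  · rw [Finset.erase_eq_of_notMem h]; simp

lemma sum_card_pow {α : Type} [DecidableEq α] (B : Finset α) :
    ∑ T ∈ B.powerset, (T.card : ℝ) = 2 ^ B.card * (B.card / 2) := by
  have h : ∑ T ∈ B.powerset, (T.card : ℝ) = ∑ T ∈ B.powerset, ((B.card : ℝ) - T.card) := by
    apply Finset.sum_bij' (fun T _ => B \ T) (fun T _ => B \ T)
    · intro T _; simp
    · intro T _; simp
    · intro T hT; simpa using hT
    · intro T hT; simpa using hT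
    · intro T hT
      have := Finset.card_sdiff_add_card_eq_card (Finset.mem_powerset.1 hT)
      rw [← this]; push_cast; ring
  rw [Finset.sum_sub_distrib, Finset.sum_const, Finset.card_powerset, nsmul_eq_mul] at h
  push_cast at h
  linarith

lemma row_sum (n k : ℕ) (hn : 4 ≤ n) (hk : 1 ≤ k) (hkn : k ≤ n) {α : Type} [DecidableEq α] (A B : Finset α)
    (hBA : B ⊆ A) (hA : A.card = k) :
    ∑ T ∈ B.powerset, Real.exp (FF (A \ T).card) ≤
      2 ^ B.card * (Real.exp (FF k) *
        Real.exp ((3 / 2 * Real.log (2 * n) - B.card / 2) / k)) := by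
  have hkp : (0 : ℝ) < k := by exact_mod_cast hk
  set s := 3 / 2 * Real.log (2 * n)
  calc _ ≤ ∑ T ∈ B.powerset, (Real.exp (FF k) / k) * ((k + s) - T.card) := by
        apply Finset.sum_le_sum
        intro T hT
        have hTA := (Finset.mem_powerset.1 hT).trans hBA
        have hc := Finset.card_sdiff_add_card_eq_card hTA
        rw [hA] at hc
        refine (FF_lin n k (A \ T).card hn hk hkn (by omega)).trans (le_of_eq ?_)
        have : (k : ℝ) = (A \ T).card + T.card := by exact_mod_cast hc.symm
        change _ * ((_ + s) / _) = _
        rw [show ((k : ℝ) + s) - T.card = (A \ T).card + s by rw [this]; ring]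
        ring
    _ = 2 ^ B.card * (Real.exp (FF k) * (1 + (s - B.card / 2) / k)) := by
        rw [← Finset.mul_sum, Finset.sum_sub_distrib, sum_card_pow, Finset.sum_const,
          Finset.card_powerset, nsmul_eq_mul]
        push_cast
        field_simp
        ring
    _ ≤ _ := by
        gcongr
        rw [add_comm]; exact Real.add_one_le_exp _

lemma bad_row (n k : ℕ) (γ : ℝ) (hn : 4 ≤ n) (hγ0 : 0 < γ) (hγ1 : γ ≤ 1 / 2)
    (hkn : k ≤ n) (hk : (n : ℝ) - γ * n / 2 ≤ k)
    (A : Fin n → Finset (Fin n)) (hA : ∀ x, (A x).card = k) (E : Finset (Fin n × Fin n))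
    (hE : γ * (n : ℝ) ^ 2 ≤ (E.card : ℝ)) :
    (((univ : Finset (Equiv.Perm (Fin n))).filter fun σ =>
      (∀ x, σ x ∈ A x) ∧ (gE E σ : ℝ) < γ * (n : ℝ) / 10).card : ℝ) ≤
      Real.exp (FF k) ^ n * ((2 * (n : ℝ)) ^ 2 * Real.exp (-(γ * n / 20))) := by
  have hn4 : (4 : ℝ) ≤ n := by exact_mod_cast hn
  have hnp : (0 : ℝ) < n := by linarith
  have hk34 : 3 / 4 * (n : ℝ) ≤ k := by nlinarith
  have hkp : (0 : ℝ) < k := by linarith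
  have hk1 : 1 ≤ k := by exact_mod_cast hkp
  have hknr : (k : ℝ) ≤ n := by exact_mod_cast hkn
  set B : Fin n → Finset (Fin n) := fun x => (A x).filter fun y => (x, y) ∈ E with hB
  set s := 3 / 2 * Real.log (2 * n) with hs
  have hlog : 0 ≤ Real.log (2 * n) := Real.log_nonneg (by linarith)
  have hsum : γ * (n : ℝ) ^ 2 / 2 ≤ ∑ x, ((B x).card : ℝ) := by
    have h1 : E.card = ∑ x, (univ.filter fun y => (x, y) ∈ E).card := by
      rw [Finset.card_eq_sum_card_fiberwise (f := Prod.fst) (t := univ) (by simp [Set.MapsTo])]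
      apply Finset.sum_congr rfl
      intro x _
      apply Finset.card_bij' (fun p _ => p.2) (fun y _ => (x, y))
      · rintro ⟨a, b⟩ h
        simp only [mem_filter] at h
        simp only [mem_filter, mem_univ, true_and]
        rw [← h.2]; exact h.1
      · rintro ⟨a, b⟩ h
        simp only [mem_filter] at h
        rw [← h.2]
      · intro y h; rfl
      · intro y h; simpa using h
    have h2 : ∀ x, ((univ.filter fun y => (x, y) ∈ E).card : ℝ) ≤ (B x).card + ((n : ℝ) - k) := by
      intro x
      have h3 : (univ.filter fun y => (x, y) ∈ E) ⊆ B x ∪ (A x)ᶜ := by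
        intro y hy
        simp only [mem_filter, mem_univ, true_and] at hy
        simp only [hB, mem_union, mem_filter, mem_compl]
        tauto
      have h4 := (Finset.card_le_card h3).trans (Finset.card_union_le _ _)
      rw [Finset.card_compl, hA, Fintype.card_fin] at h4
      rw [← Nat.cast_sub hkn]
      exact_mod_cast h4
    have h5 : (E.card : ℝ) ≤ ∑ x, (((B x).card : ℝ) + ((n : ℝ) - k)) := by
      rw [h1]; push_cast
      exact Finset.sum_le_sum fun x _ => h2 x
    rw [Finset.sum_add_distrib, Finset.sum_const, nsmul_eq_mul, Finset.card_univ,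
      Fintype.card_fin] at h5
    nlinarith
  have hthin : ∑ π ∈ (univ : Finset (Equiv.Perm (Fin n))).filter (fun σ => ∀ x, σ x ∈ A x),
      ∏ x, (((B x).powerset.filter fun T => π x ∉ T).card : ℝ) ≤
      ∏ x, ∑ T ∈ (B x).powerset, Real.exp (FF (A x \ T).card) := by
    convert thin A B
  have hR : ∏ x, ∑ T ∈ (B x).powerset, Real.exp (FF (A x \ T).card) ≤
      2 ^ (∑ x, (B x).card) * (Real.exp (FF k) ^ n *
        ((2 * (n : ℝ)) ^ 2 * Real.exp (-(γ * n / 4)))) := by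
    calc _ ≤ ∏ x, (2 ^ (B x).card * (Real.exp (FF k) *
        Real.exp ((s - (B x).card / 2) / k))) := by
          apply Finset.prod_le_prod
          · intro x _; positivity
          · intro x _
            exact row_sum n k hn hk1 hkn (A x) (B x) (Finset.filter_subset _ _) (hA x)
      _ = 2 ^ (∑ x, (B x).card) * (Real.exp (FF k) ^ n *
          Real.exp (∑ x, (s - (B x).card / 2) / k)) := by
          rw [Finset.prod_mul_distrib, Finset.prod_mul_distrib, Finset.prod_pow_eq_pow_sum,
            Finset.prod_const, Finset.card_univ, Fintype.card_fin, Real.exp_sum]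
      _ ≤ _ := by
          gcongr
          have : (2 * (n : ℝ)) ^ 2 = Real.exp (2 * Real.log (2 * n)) := by
            rw [show 2 * Real.log (2 * (n : ℝ)) = ((2 : ℕ) : ℝ) * Real.log (2 * (n : ℝ)) by norm_num,
              Real.exp_nat_mul, Real.exp_log (by positivity)]
          rw [this, ← Real.exp_add]
          apply Real.exp_le_exp.2
          rw [← Finset.sum_div, Finset.sum_sub_distrib, ← Finset.sum_div, Finset.sum_const,
            nsmul_eq_mul, Finset.card_univ, Fintype.card_fin, div_le_iff₀ hkp]
          have a1 : (n : ℝ) * s ≤ 2 * Real.log (2 * n) * k := by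
            rw [hs]; nlinarith
          have a2 : γ * n / 4 * k ≤ γ * (n : ℝ) ^ 2 / 4 := by
            have : γ * n / 4 * k ≤ γ * n / 4 * n := by gcongr
            linarith
          linarith
  set Bad := (univ : Finset (Equiv.Perm (Fin n))).filter fun σ =>
      (∀ x, σ x ∈ A x) ∧ (gE E σ : ℝ) < γ * (n : ℝ) / 10 with hBad
  have hL : (Bad.card : ℝ) * (2 ^ (∑ x, (B x).card) * (1 / 2 : ℝ) ^ (γ * n / 10)) ≤
      ∑ π ∈ (univ : Finset (Equiv.Perm (Fin n))).filter (fun σ => ∀ x, σ x ∈ A x),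
      ∏ x, (((B x).powerset.filter fun T => π x ∉ T).card : ℝ) := by
    have hsub : Bad ⊆ (univ : Finset (Equiv.Perm (Fin n))).filter (fun σ => ∀ x, σ x ∈ A x) := by
      intro σ hσ
      simp only [hBad, mem_filter, mem_univ, true_and] at hσ ⊢
      exact hσ.1
    refine le_trans ?_ (Finset.sum_le_sum_of_subset_of_nonneg hsub
      (fun _ _ _ => Finset.prod_nonneg fun _ _ => by positivity))
    rw [← nsmul_eq_mul]
    apply Finset.card_nsmul_le_sum
    intro π hπ
    simp only [hBad, mem_filter, mem_univ, true_and] at hπ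
    have e1 : ∏ x, (((B x).powerset.filter fun T => π x ∉ T).card : ℝ) =
        2 ^ (∑ x, (B x).card) * (1 / 2 : ℝ) ^ (gE E π) := by
      simp_rw [card_avoid]
      rw [Finset.prod_mul_distrib, Finset.prod_pow_eq_pow_sum]
      congr 1
      rw [Finset.prod_ite, Finset.prod_const, Finset.prod_const_one, mul_one, gE]
      congr 2
      ext x
      simp [hB, hπ.1 x]
    rw [e1]
    gcongr
    rw [← Real.rpow_natCast]
    exact Real.rpow_le_rpow_of_exponent_ge (by norm_num) (by norm_num) hπ.2.le
  have hfin := (hL.trans hthin).trans hR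
  have h2p : (0 : ℝ) < 2 ^ (∑ x, (B x).card) := by positivity
  have hfin2 : (Bad.card : ℝ) * (1 / 2 : ℝ) ^ (γ * n / 10) ≤ (Real.exp (FF k) ^ n *
        ((2 * (n : ℝ)) ^ 2 * Real.exp (-(γ * n / 4)))) := by
    apply le_of_mul_le_mul_left _ h2p
    linarith
  have hhalf : Real.exp (-(γ * n / 5)) ≤ (1 / 2 : ℝ) ^ (γ * n / 10) := by
    rw [Real.rpow_def_of_pos (by norm_num)]
    apply Real.exp_le_exp.2
    have : Real.log (1 / 2) = - Real.log 2 := by rw [one_div, Real.log_inv]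
    rw [this]
    have := Real.log_two_lt_d9
    have : 0 < γ * n := by positivity
    nlinarith
  have h6 : (Bad.card : ℝ) * Real.exp (-(γ * n / 5)) ≤ (Real.exp (FF k) ^ n *
        ((2 * (n : ℝ)) ^ 2 * Real.exp (-(γ * n / 20)))) * Real.exp (-(γ * n / 5)) := by
    have : Real.exp (-(γ * n / 4)) = Real.exp (-(γ * n / 20)) * Real.exp (-(γ * n / 5)) := by
      rw [← Real.exp_add]; congr 1; ring
    calc _ ≤ (Bad.card : ℝ) * (1 / 2 : ℝ) ^ (γ * n / 10) := by gcongr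
      _ ≤ _ := hfin2
      _ = _ := by rw [this]; ring
  exact le_of_mul_le_mul_right h6 (Real.exp_pos _)

lemma good_row (n k : ℕ) (A : Fin n → Finset (Fin n)) (hA : ∀ x, (A x).card = k) :
    (((univ : Finset (Equiv.Perm (Fin n))).filter fun σ => ∀ x, σ x ∈ A x).card : ℝ) ≤
      Real.exp (FF k) ^ n := by
  have h := bregman A
  have e : ∏ x, Real.exp (FF (A x).card) = Real.exp (FF k) ^ n := by simp [hA]
  rw [e] at h
  convert h

def QQ {n : ℕ} (Bd : Finset (Fin n → Equiv.Perm (Fin n))) (J : Finset (Fin n))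
    (L₀ : Fin n → Equiv.Perm (Fin n)) : Finset (Fin n → Equiv.Perm (Fin n)) :=
  Bd.filter fun L => ∀ j, j ∉ J → L j = L₀ j

lemma QQ_step {n : ℕ} (Bd : Finset (Fin n → Equiv.Perm (Fin n))) (J : Finset (Fin n))
    (L₀ : Fin n → Equiv.Perm (Fin n)) (i : Fin n) (M M' : ℝ) (hM' : 0 ≤ M')
    (P : Finset (Equiv.Perm (Fin n)))
    (hP : ∀ L ∈ QQ Bd J L₀, L i ∈ P) (hM : (P.card : ℝ) ≤ M)
    (h : ∀ L ∈ QQ Bd J L₀, ((QQ Bd (J.erase i) L).card : ℝ) ≤ M') :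
    ((QQ Bd J L₀).card : ℝ) ≤ M * M' := by
  rw [Finset.card_eq_sum_card_fiberwise (f := fun L => L i) (t := P)
    (fun L hL => hP L hL)]
  push_cast
  calc _ ≤ ∑ b ∈ P, M' := by
        apply Finset.sum_le_sum
        intro b _
        rcases ((QQ Bd J L₀).filter (fun L => L i = b)).eq_empty_or_nonempty with he | ⟨L, hL⟩
        · rw [he]; simpa using hM'
        · rw [Finset.mem_filter] at hL
          refine le_trans ?_ (h L hL.1)
          norm_cast
          apply Finset.card_le_card
          intro K hK
          rw [Finset.mem_filter] at hK
          have h1 := hK.1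
          have h2 := hL.1
          simp only [QQ, mem_filter] at h1 h2 ⊢
          refine ⟨h1.1, fun j hj => ?_⟩
          by_cases hji : j = i
          · rw [hji, hK.2, hL.2]
          · have : j ∉ J := fun hh => hj (Finset.mem_erase.2 ⟨hji, hh⟩)
            rw [h1.2 j this, h2.2 j this]
    _ = P.card * M' := by rw [Finset.sum_const, nsmul_eq_mul]
    _ ≤ _ := by gcongr

lemma QQ_bound (n : ℕ) (γ : ℝ) (hn : 4 ≤ n) (hγ0 : 0 < γ) (hγ1 : γ ≤ 1 / 2)
    (E : Fin n → Finset (Fin n × Fin n))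
    (I : Finset (Fin n)) (hI : (I.card : ℝ) = γ * (n : ℝ) / 2)
    (hEI : ∀ i ∈ I, γ * (n : ℝ) ^ 2 ≤ ((E i).card : ℝ))
    (Bd : Finset (Fin n → Equiv.Perm (Fin n)))
    (hBd : ∀ L ∈ Bd, IsLatinSquare L ∧ ∀ i ∈ I, (gE (E i) (L i) : ℝ) < γ * (n : ℝ) / 10)
    (W : ℝ) (hW : W = (2 * (n : ℝ)) ^ 2 * Real.exp (-(γ * n / 20))) :
    ∀ (m : ℕ) (J : Finset (Fin n)) (L₀ : Fin n → Equiv.Perm (Fin n)), J.card = m →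
      (Disjoint J I ∨ Iᶜ ⊆ J) →
      ((QQ Bd J L₀).card : ℝ) ≤
        (∏ k ∈ Finset.Icc 1 m, Real.exp (FF k) ^ n) * W ^ (J ∩ I).card := by
  have hW0 : 0 ≤ W := by rw [hW]; positivity
  intro m
  induction m with
  | zero =>
    intro J L₀ hJ _
    rw [Finset.card_eq_zero] at hJ
    subst hJ
    have : QQ Bd ∅ L₀ ⊆ {L₀} := by
      intro L hL
      simp only [QQ, mem_filter] at hL
      rw [Finset.mem_singleton]
      funext j
      exact hL.2 j (by simp)
    have := Finset.card_le_card this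
    simp at this ⊢
    exact_mod_cast this
  | succ m ih =>
    intro J L₀ hJ hJI
    have hstep : ∃ i ∈ J, (i ∈ I → Iᶜ ⊆ J) ∧ (Disjoint (J.erase i) I ∨ Iᶜ ⊆ J.erase i) := by
      by_cases hd : Disjoint J I
      · obtain ⟨i, hi⟩ : J.Nonempty := Finset.card_pos.1 (by omega)
        refine ⟨i, hi, fun h => ?_, Or.inl (hd.mono_left (Finset.erase_subset _ _))⟩
        exact absurd h (Finset.disjoint_left.1 hd hi)
      · have hsub := hJI.resolve_left hd
        obtain ⟨i, hi, hiI⟩ := Finset.not_disjoint_iff.1 hd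
        refine ⟨i, hi, fun _ => hsub, Or.inr ?_⟩
        intro x hx
        refine Finset.mem_erase.2 ⟨?_, hsub hx⟩
        rintro rfl
        exact (Finset.mem_compl.1 hx) hiI
    obtain ⟨i, hiJ, hi1, hi2⟩ := hstep
    rcases (QQ Bd J L₀).eq_empty_or_nonempty with he | ⟨L₁, hL₁⟩
    · rw [he]; simp only [card_empty, Nat.cast_zero]
      exact mul_nonneg (Finset.prod_nonneg fun _ _ => by positivity) (by positivity)
    set A : Fin n → Finset (Fin n) := fun x => (Jᶜ.image fun j => L₀ j x)ᶜ with hAdef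
    have hA : ∀ x, (A x).card = m + 1 := by
      intro x
      rw [hAdef]
      simp only
      rw [Finset.card_compl, Finset.card_image_of_injOn, Finset.card_compl, Fintype.card_fin, hJ]
      · have : J.card ≤ n := by simpa using Finset.card_le_univ J
        omega
      · intro a ha b hb hab
        by_contra hne
        simp only [QQ, mem_filter] at hL₁
        have ha' : a ∉ J := by simpa using ha
        have hb' : b ∉ J := by simpa using hb
        have := (hBd L₁ hL₁.1).1 a b hne x
        rw [hL₁.2 a ha', hL₁.2 b hb'] at this
        exact this hab
    have hLA : ∀ L ∈ QQ Bd J L₀, ∀ x, L i x ∈ A x := by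
      intro L hL x
      simp only [QQ, mem_filter] at hL
      simp only [hAdef, mem_compl, mem_image, not_exists, not_and]
      intro j hj hjx
      have hne : j ≠ i := by rintro rfl; exact hj hiJ
      have := (hBd L hL.1).1 j i hne x
      rw [hL.2 j hj] at this
      exact this hjx
    have hcJ : (J.erase i).card = m := by rw [Finset.card_erase_of_mem hiJ, hJ]; rfl
    have hM'0 : 0 ≤ (∏ k ∈ Finset.Icc 1 m, Real.exp (FF k) ^ n) * W ^ ((J.erase i) ∩ I).card :=
      mul_nonneg (Finset.prod_nonneg fun _ _ => by positivity) (by positivity)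
    by_cases hiI : i ∈ I
    · have hJn : m + 1 ≤ n := by rw [← hJ]; simpa using Finset.card_le_univ J
      have hk : (n : ℝ) - γ * n / 2 ≤ ((m + 1 : ℕ) : ℝ) := by
        have h1 := Finset.card_le_card (hi1 hiI)
        rw [Finset.card_compl, Fintype.card_fin, hJ] at h1
        have h2 : (n : ℝ) ≤ ((m + 1 : ℕ) : ℝ) + I.card := by
          exact_mod_cast (by omega : n ≤ m + 1 + I.card)
        rw [hI] at h2; linarith
      have := QQ_step Bd J L₀ i _ _ hM'0 _ (fun L hL => by
          rw [Finset.mem_filter]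
          refine ⟨Finset.mem_univ _, hLA L hL, ?_⟩
          simp only [QQ, mem_filter] at hL
          exact (hBd L hL.1).2 i hiI)
        (bad_row n (m + 1) γ hn hγ0 hγ1 hJn hk A hA (E i) (hEI i hiI))
        (fun L _ => ih (J.erase i) L hcJ hi2)
      refine this.trans (le_of_eq ?_)
      have hc : (J ∩ I).card = ((J.erase i) ∩ I).card + 1 := by
        rw [Finset.erase_inter, Finset.card_erase_add_one (Finset.mem_inter.2 ⟨hiJ, hiI⟩)]
      rw [hc, Finset.prod_Icc_succ_top (by omega), pow_succ W, ← hW]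
      ring
    · have := QQ_step Bd J L₀ i _ _ hM'0 _ (fun L hL => by
          rw [Finset.mem_filter]
          exact ⟨Finset.mem_univ _, hLA L hL⟩)
        (good_row n (m + 1) A hA)
        (fun L _ => ih (J.erase i) L hcJ hi2)
      refine this.trans (le_of_eq ?_)
      have hc : (J ∩ I).card = ((J.erase i) ∩ I).card := by
        rw [Finset.erase_inter, Finset.erase_eq_of_notMem]
        intro h; exact hiI (Finset.mem_inter.1 h).2
      rw [hc, Finset.prod_Icc_succ_top (by omega)]
      ring

/-- **Proposition (counting bad Latin squares).** Let `0 < γ ≤ 1/2` with `γn/2` an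
integer, let `E_1,…,E_n ⊆ [n]²` have all rows of size at most `n/2`, and let `I ⊆ [n]`
with `|I| = γn/2` be such that `|E_i| ≥ γ·n²` for all `i ∈ I`.  Then the number of
Latin squares `L = (π_1,…,π_n)` of order `n` with `g_{E_i}(π_i) < γn/10` for all
`i ∈ I` is at most `(2n)^{γn} · (∏_{k=1}^n (k!)^{n/k}) · e^{−γ²n²/40}`. -/
theorem count_bad_latin_squares (n : ℕ) (γ : ℝ) (hγ0 : 0 < γ) (hγ1 : γ ≤ 1 / 2)
    (E : Fin n → Finset (Fin n × Fin n))
    (hrow : ∀ m : Fin n, ∀ i : Fin n,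
      (((E m).filter fun p => p.1 = i).card : ℝ) ≤ (n : ℝ) / 2)
    (I : Finset (Fin n)) (hI : (I.card : ℝ) = γ * (n : ℝ) / 2)
    (hEI : ∀ i ∈ I, γ * (n : ℝ) ^ 2 ≤ ((E i).card : ℝ)) :
    (((univ : Finset (LatinSquare n)).filter fun L =>
        ∀ i ∈ I, (gE (E i) (L.1 i) : ℝ) < γ * (n : ℝ) / 10).card : ℝ) ≤
      (2 * (n : ℝ)) ^ (γ * (n : ℝ)) *
        (∏ k ∈ Finset.Icc 1 n, ((k.factorial : ℝ)) ^ ((n : ℝ) / (k : ℝ))) *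
        Real.exp (-(γ ^ 2 * (n : ℝ) ^ 2 / 40)) := by
  rcases Nat.eq_zero_or_pos n with rfl | hnpos
  · have h1 : (((univ : Finset (LatinSquare 0)).filter fun L =>
        ∀ i ∈ I, (gE (E i) (L.1 i) : ℝ) < γ * ((0 : ℕ) : ℝ) / 10).card : ℝ) ≤ 1 := by
      norm_cast
      exact Finset.card_le_one.2 fun a _ b _ => Subsingleton.elim a b
    refine h1.trans (le_of_eq ?_)
    simp
  have hnp : (0 : ℝ) < n := by exact_mod_cast hnpos
  have hn : 4 ≤ n := by
    have h0 : (0 : ℝ) < I.card := by rw [hI]; positivity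
    have h1 : (1 : ℝ) ≤ I.card := by exact_mod_cast h0
    rw [hI] at h1
    have : (4 : ℝ) ≤ n := by nlinarith
    exact_mod_cast this
  set Bd : Finset (Fin n → Equiv.Perm (Fin n)) := univ.filter fun L =>
    IsLatinSquare L ∧ ∀ i ∈ I, (gE (E i) (L i) : ℝ) < γ * (n : ℝ) / 10 with hBd
  have hb := QQ_bound n γ hn hγ0 hγ1 E I hI hEI Bd
    (fun L hL => by simpa only [hBd, mem_filter, mem_univ, true_and] using hL) _ rfl
    n univ (fun _ => 1) (by simp) (Or.inr (Finset.subset_univ _))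
  have hle : (((univ : Finset (LatinSquare n)).filter fun L =>
        ∀ i ∈ I, (gE (E i) (L.1 i) : ℝ) < γ * (n : ℝ) / 10).card : ℝ) ≤
        ((QQ Bd univ (fun _ => 1)).card : ℝ) := by
    norm_cast
    apply Finset.card_le_card_of_injOn Subtype.val
    · intro L hL
      have h2 := (Finset.mem_filter.1 hL).2
      show L.1 ∈ QQ Bd univ (fun _ => 1)
      simp only [QQ, hBd, mem_filter, mem_univ, true_and]
      exact ⟨⟨L.2, h2⟩, fun j hj => absurd trivial hj⟩
    · exact Subtype.val_injective.injOn
  refine (hle.trans hb).trans (le_of_eq ?_)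
  rw [Finset.univ_inter, ← Real.rpow_natCast _ I.card, hI,
    Real.mul_rpow (by positivity) (by positivity), ← Real.rpow_natCast (2 * (n : ℝ)) 2,
    ← Real.rpow_mul (by positivity), ← Real.exp_mul]
  have e1 : ∏ k ∈ Finset.Icc 1 n, Real.exp (FF k) ^ n =
      ∏ k ∈ Finset.Icc 1 n, ((k.factorial : ℝ)) ^ ((n : ℝ) / (k : ℝ)) := by
    apply Finset.prod_congr rfl
    intro k _
    rw [Real.rpow_def_of_pos (by exact_mod_cast k.factorial_pos), ← Real.exp_nat_mul]
    congr 1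
    unfold FF
    ring
  rw [e1, show ((2 : ℕ) : ℝ) * (γ * n / 2) = γ * n by push_cast; ring,
    show -(γ * n / 20) * (γ * n / 2) = -(γ ^ 2 * (n : ℝ) ^ 2 / 40) by ring]
  ring
end
end

section
/- Fix an integer d ≥ 100 and 0 < c < 1. Then with probability 1 − O(n^{-1}) as n → ∞ over Y = Y(L^d) ∈ 𝓨(n,d), the following holds: every 1-cochain φ ∈ C^1(T_n;F_2) with 0 < ‖[φ]‖ ≤ c·n² satisfies ‖d_1φ‖_Y / ‖[φ]‖ ≥ (d − 3√d)·(1 − c^{1/3})/2 − d/3, where ‖d_1φ‖_Y is the number of 2-simplices of Y on which d_1φ is nonzero. -/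
open Finset
open scoped Classical

noncomputable section

/-- A `1`-cochain of the complete `3`-partite complex `T_n` (whose vertex set is
`V_1 ∪ V_2 ∪ V_3`, three copies of `Fin n`), recorded by its values on the three
kinds of edges `a_i b_j`, `a_i c_k`, `b_j c_k`. -/
structure Cochain1 (n : ℕ) where
  ab : Fin n → Fin n → ZMod 2
  ac : Fin n → Fin n → ZMod 2
  bc : Fin n → Fin n → ZMod 2

instance {n : ℕ} : Add (Cochain1 n) :=
  ⟨fun φ η => ⟨fun i j => φ.ab i j + η.ab i j, fun i k => φ.ac i k + η.ac i k,
    fun j k => φ.bc j k + η.bc j k⟩⟩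

/-- The coboundary of a `0`-cochain on `T_n`; vertices are indexed by `Fin 3 × Fin n`. -/
def d0 {n : ℕ} (ψ : Fin 3 × Fin n → ZMod 2) : Cochain1 n :=
  ⟨fun i j => ψ (0, i) + ψ (1, j), fun i k => ψ (0, i) + ψ (2, k),
   fun j k => ψ (1, j) + ψ (2, k)⟩

/-- `φ ∈ B^1`, i.e. `φ` is a `1`-coboundary. -/
def IsCobound1 {n : ℕ} (φ : Cochain1 n) : Prop := ∃ ψ, φ = d0 ψ

/-- `‖φ‖ = |supp φ|` for a `1`-cochain. -/
def norm1 {n : ℕ} (φ : Cochain1 n) : ℕ :=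
  (univ.filter fun p : Fin n × Fin n => φ.ab p.1 p.2 ≠ 0).card +
    (univ.filter fun p : Fin n × Fin n => φ.ac p.1 p.2 ≠ 0).card +
    (univ.filter fun p : Fin n × Fin n => φ.bc p.1 p.2 ≠ 0).card

/-- `‖[φ]‖ = min {‖φ + d_0 ψ‖ : ψ ∈ C^0}`. -/
def normClass1 {n : ℕ} (φ : Cochain1 n) : ℕ :=
  sInf (Set.range fun ψ : Fin 3 × Fin n → ZMod 2 => norm1 (φ + d0 ψ))

/-- The coboundary of a `1`-cochain evaluated on the triangle `[a_i, b_j, c_k]`. -/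
def d1 {n : ℕ} (φ : Cochain1 n) (i j k : Fin n) : ZMod 2 :=
  φ.ab i j + φ.ac i k + φ.bc j k

/-- The set of `2`-simplices `[a_i, b_j, c_{π_{mi}(j)}]` of `Y(L_1,…,L_d)`. -/
def triangles {n d : ℕ} (Ls : Fin d → LatinSquare n) : Finset (Fin n × Fin n × Fin n) :=
  univ.filter fun t => ∃ m : Fin d, ((Ls m).1 t.1) t.2.1 = t.2.2

/-- `‖d_1 φ‖_Y`, where `Y ⊆ T_n` has full `1`-skeleton and triangle set `T`. -/
def normd1 {n : ℕ} (T : Finset (Fin n × Fin n × Fin n)) (φ : Cochain1 n) : ℕ :=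
  (T.filter fun t => d1 φ t.1 t.2.1 t.2.2 ≠ 0).card

/-- The first coboundary expansion constant `h_1(Y)` of the subcomplex `Y ⊆ T_n` with
full `1`-skeleton and triangle set `T`:
`h_1 = min { ‖d_1 φ‖ / ‖[φ]‖ : φ ∈ C^1 ∖ B^1 }`. -/
def h1 {n : ℕ} (T : Finset (Fin n × Fin n × Fin n)) : ℝ :=
  sInf {r : ℝ | ∃ φ : Cochain1 n, ¬ IsCobound1 φ ∧
    r = (normd1 T φ : ℝ) / (normClass1 φ : ℝ)}

/-- `f` is equivariant for left multiplication. -/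
def EqV {n : ℕ} {X : Type} (f : X → Equiv.Perm (Fin n)) : Prop :=
  ∀ τ : Equiv.Perm (Fin n), ∃ g : X → X, Function.Injective g ∧ ∀ x, f (g x) = τ * f x

lemma EqV.step {n : ℕ} {X : Type} [Fintype X] {f : X → Equiv.Perm (Fin n)} (hf : EqV f)
    (B S : Finset (Fin n)) (b : Fin n) (hb : b ∉ B) :
    (univ.filter fun x : X => ∀ z ∈ insert b B, f x z ∈ S).card * n ≤
      S.card * (univ.filter fun x : X => ∀ z ∈ B, f x z ∈ S).card := by
  set N : Fin n → ℕ := fun y => (univ.filter fun x : X => (∀ z ∈ B, f x z ∈ S) ∧ f x b = y).card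
    with hN
  have h1 : ∀ y ∈ S, ∀ y' ∈ Sᶜ, N y ≤ N y' := by
    intro y hy y' hy'
    obtain ⟨g, hg, hgf⟩ := hf (Equiv.swap y y')
    refine Finset.card_le_card_of_injOn g ?_ hg.injOn
    intro x hx
    simp only [coe_filter, mem_univ, true_and, Set.mem_ofPred_eq] at hx ⊢
    refine ⟨fun z hz => ?_, ?_⟩
    · rw [hgf, Equiv.Perm.mul_apply, Equiv.swap_apply_of_ne_of_ne]
      · exact hx.1 z hz
      · rw [← hx.2]; intro h
        have := (f x).injective h
        exact hb (this ▸ hz)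
      · intro h
        have := hx.1 z hz
        rw [h] at this
        exact (Finset.mem_compl.1 hy') this
    · rw [hgf, Equiv.Perm.mul_apply, hx.2, Equiv.swap_apply_left]
  have h2 : (univ.filter fun x : X => ∀ z ∈ insert b B, f x z ∈ S).card = ∑ y ∈ S, N y := by
    rw [Finset.card_eq_sum_card_fiberwise (f := fun x => f x b) (t := S)]
    · refine Finset.sum_congr rfl fun y hy => ?_
      rw [hN]; simp only
      congr 1
      ext x
      simp only [mem_filter, mem_univ, true_and, mem_insert, forall_eq_or_imp]
      constructor
      · rintro ⟨⟨_, h⟩, h'⟩; exact ⟨h, h'⟩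
      · rintro ⟨h, h'⟩; exact ⟨⟨h' ▸ hy, h⟩, h'⟩
    · intro x hx
      simp only [coe_filter, mem_univ, true_and, Set.mem_ofPred_eq] at hx
      exact hx b (mem_insert_self _ _)
  have h3 : (univ.filter fun x : X => ∀ z ∈ B, f x z ∈ S).card = ∑ y, N y := by
    rw [Finset.card_eq_sum_card_fiberwise (f := fun x => f x b) (t := univ)]
    · refine Finset.sum_congr rfl fun y hy => ?_
      rw [hN]; simp only
      congr 1
      ext x
      simp
    · intro x hx; simp
  have h4 : ∑ y, N y = ∑ y ∈ S, N y + ∑ y ∈ Sᶜ, N y := (Finset.sum_add_sum_compl S N).symm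
  have h5 : (∑ y ∈ S, N y) * (Sᶜ).card ≤ S.card * ∑ y ∈ Sᶜ, N y := by
    rw [Finset.sum_mul, ← smul_eq_mul (a := S.card)]
    refine Finset.sum_le_card_nsmul _ _ _ fun y hy => ?_
    rw [mul_comm, ← smul_eq_mul]
    exact Finset.card_nsmul_le_sum _ _ _ fun y' hy' => h1 y hy y' hy'
  have h6 : S.card + (Sᶜ).card = n := by
    rw [Finset.card_add_card_compl]; simp
  rw [h2, h3, h4]
  calc (∑ y ∈ S, N y) * n = (∑ y ∈ S, N y) * (S.card + (Sᶜ).card) := by rw [h6]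
    _ = S.card * (∑ y ∈ S, N y) + (∑ y ∈ S, N y) * (Sᶜ).card := by ring
    _ ≤ _ := by rw [mul_add]; omega

lemma EqV.hits {n : ℕ} {X : Type} [Fintype X] {f : X → Equiv.Perm (Fin n)} (hf : EqV f)
    (B S : Finset (Fin n)) :
    (univ.filter fun x : X => ∀ z ∈ B, f x z ∈ S).card * n ^ B.card ≤
      S.card ^ B.card * Fintype.card X := by
  induction B using Finset.induction_on with
  | empty => simp
  | insert b B hb ih =>
    rw [Finset.card_insert_of_notMem hb, pow_succ, pow_succ]
    have := hf.step B S b hb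
    calc _ = ((univ.filter fun x : X => ∀ z ∈ insert b B, f x z ∈ S).card * n) * n ^ B.card := by ring
      _ ≤ (S.card * (univ.filter fun x : X => ∀ z ∈ B, f x z ∈ S).card) * n ^ B.card := by gcongr
      _ = S.card * ((univ.filter fun x : X => ∀ z ∈ B, f x z ∈ S).card * n ^ B.card) := by ring
      _ ≤ S.card * (S.card ^ B.card * Fintype.card X) := by gcongr
      _ = _ := by ring

lemma EqV.point {n : ℕ} {X : Type} [Fintype X] {f : X → Equiv.Perm (Fin n)} (hf : EqV f)
    (z y : Fin n) :
    (univ.filter fun x : X => f x z = y).card * n ≤ Fintype.card X := by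
  have := hf.hits {z} {y}
  simpa using this

/-- number of edges inside `(S1,S2)` -/
def ecount {n : ℕ} (π : Equiv.Perm (Fin n)) (S1 S2 : Finset (Fin n)) : ℕ :=
  (S1.filter fun z => π z ∈ S2).card

lemma EqV.mgf {n : ℕ} (hn : 0 < n) {X : Type} [Fintype X] {f : X → Equiv.Perm (Fin n)}
    (hf : EqV f) (S1 S2 : Finset (Fin n)) (u : ℝ) (hu : 0 ≤ u) :
    ∑ x : X, (1 + u) ^ ecount (f x) S1 S2 ≤
      Fintype.card X * Real.exp (u * S1.card * S2.card / n) := by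
  have hn' : (0:ℝ) < n := by exact_mod_cast hn
  have h1 : ∀ x, (1 + u) ^ ecount (f x) S1 S2 =
      ∑ B ∈ S1.powerset, u ^ B.card * (if ∀ z ∈ B, f x z ∈ S2 then 1 else 0) := by
    intro x
    have : (1 + u) ^ ecount (f x) S1 S2 = ∏ z ∈ S1, (1 + if f x z ∈ S2 then u else 0) := by
      rw [ecount, ← Finset.prod_const, Finset.prod_filter]
      refine Finset.prod_congr rfl fun z _ => ?_
      split_ifs <;> simp
    rw [this, Finset.prod_one_add]
    refine Finset.sum_congr rfl fun B _ => ?_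
    by_cases h : ∀ z ∈ B, f x z ∈ S2
    · rw [if_pos h, Finset.prod_congr rfl (g := fun _ => u)]
      · simp
      · intro z hz; rw [if_pos (h z hz)]
    · rw [if_neg h]
      push Not at h
      obtain ⟨z, hz, hz'⟩ := h
      rw [Finset.prod_eq_zero hz (by rw [if_neg hz'])]; simp
  simp_rw [h1]
  rw [Finset.sum_comm]
  have h2 : ∀ B ∈ S1.powerset, ∑ x : X, u ^ B.card * (if ∀ z ∈ B, f x z ∈ S2 then (1:ℝ) else 0) ≤
      Fintype.card X * (u * S2.card / n) ^ B.card := by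
    intro B _
    rw [← Finset.mul_sum, Finset.sum_boole]
    have := hf.hits B S2
    have h' : ((univ.filter fun x : X => ∀ z ∈ B, f x z ∈ S2).card : ℝ) * (n:ℝ) ^ B.card ≤
      (S2.card:ℝ) ^ B.card * Fintype.card X := by exact_mod_cast this
    rw [div_pow, mul_pow, ← mul_div_assoc, le_div_iff₀ (by positivity), mul_assoc]
    calc _ ≤ u ^ B.card * ((S2.card:ℝ) ^ B.card * Fintype.card X) := by gcongr
      _ = _ := by ring
  refine (Finset.sum_le_sum h2).trans ?_
  rw [← Finset.mul_sum]
  gcongr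
  have h3 : ∑ B ∈ S1.powerset, (u * S2.card / n) ^ B.card = (1 + u * S2.card / n) ^ S1.card := by
    have := Finset.prod_one_add (f := fun _ : Fin n => u * S2.card / (n:ℝ)) (s := S1)
    simp only [Finset.prod_const] at this
    exact this.symm
  rw [h3]
  calc (1 + u * S2.card / (n:ℝ)) ^ S1.card ≤ (Real.exp (u * S2.card / (n:ℝ))) ^ S1.card := by
        gcongr
        rw [add_comm]; exact Real.add_one_le_exp _
    _ = _ := by rw [← Real.exp_nat_mul]; congr 1; ring

lemma EqV.mgf_pi {n : ℕ} (hn : 0 < n) {X : Type} [Fintype X] {f : X → Equiv.Perm (Fin n)}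
    (hf : EqV f) (d : ℕ) (S1 S2 : Finset (Fin n)) (u : ℝ) (hu : 0 ≤ u) :
    ∑ Ls : Fin d → X, (1 + u) ^ (∑ m, ecount (f (Ls m)) S1 S2) ≤
      (Fintype.card X : ℝ) ^ d * Real.exp (d * (u * S1.card * S2.card / n)) := by
  have : ∑ Ls : Fin d → X, (1 + u) ^ (∑ m, ecount (f (Ls m)) S1 S2) =
      ∏ m : Fin d, ∑ x : X, (1 + u) ^ ecount (f x) S1 S2 := by
    rw [Fintype.prod_sum]
    refine Finset.sum_congr rfl fun Ls _ => ?_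
    rw [Finset.prod_pow_eq_pow_sum]
  rw [this]
  simp only [Finset.prod_const, Finset.card_univ, Fintype.card_fin]
  rw [Real.exp_nat_mul, ← mul_pow]
  exact pow_le_pow_left₀ (Finset.sum_nonneg fun x _ => by positivity) (hf.mgf hn S1 S2 u hu) d

lemma EqV.tail {n : ℕ} (hn : 0 < n) {X : Type} [Fintype X] {f : X → Equiv.Perm (Fin n)}
    (hf : EqV f) (d : ℕ) (S1 S2 : Finset (Fin n)) (u K : ℝ) (hu : 0 ≤ u) :
    ((univ.filter fun Ls : Fin d → X => K ≤ ((∑ m, ecount (f (Ls m)) S1 S2 : ℕ) : ℝ)).card : ℝ) ≤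
      (Fintype.card X : ℝ) ^ d * Real.exp (d * (u * S1.card * S2.card / n) - K * Real.log (1 + u)) := by
  have h := hf.mgf_pi hn d S1 S2 u hu
  rw [Real.exp_sub, ← mul_div_assoc, le_div_iff₀ (Real.exp_pos _)]
  refine le_trans ?_ h
  rw [Finset.card_eq_sum_ones, Nat.cast_sum, Finset.sum_mul]
  refine le_trans (Finset.sum_le_sum (g := fun Ls : Fin d → X => (1 + u) ^ (∑ m, ecount (f (Ls m)) S1 S2)) ?_)
    (Finset.sum_le_sum_of_subset_of_nonneg (Finset.filter_subset _ _) fun _ _ _ => by positivity)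
  intro Ls hLs
  simp only [mem_filter, mem_univ, true_and] at hLs
  simp only [Nat.cast_one, one_mul]
  rw [← Real.exp_log (show 0 < 1 + u by linarith), Real.log_exp, ← Real.exp_nat_mul]
  apply Real.exp_le_exp.2
  exact mul_le_mul_of_nonneg_right hLs (Real.log_nonneg (by linarith))

/-- few coincidences -/
lemma EqV.degree {n : ℕ} (hn : 0 < n) {X : Type} [Fintype X] {f : X → Equiv.Perm (Fin n)}
    (hf : EqV f) (d : ℕ) (hd : 3 ≤ d) (z : Fin n) :
    ((univ.filter fun Ls : Fin d → X =>
        (univ.image fun m => f (Ls m) z).card < d - 2).card : ℝ) * (n : ℝ) ^ 3 ≤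
      (d : ℝ) ^ d * (Fintype.card X : ℝ) ^ d := by
  have hn' : (0:ℝ) < n := by exact_mod_cast hn
  set k := d - 3 with hk
  have hsub : (univ.filter fun Ls : Fin d → X =>
        (univ.image fun m => f (Ls m) z).card < d - 2) ⊆
      (univ : Finset ((Fin d → Fin k) × (Fin k → Fin n))).biUnion fun p =>
        Fintype.piFinset fun m => univ.filter fun x : X => f x z = p.2 (p.1 m) := by
    intro Ls hLs
    simp only [mem_filter, mem_univ, true_and] at hLs
    set I := univ.image fun m => f (Ls m) z with hI
    have hIk : I.card ≤ k := by omega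
    have hIpos : 0 < I.card := by
      apply Finset.card_pos.2
      exact ⟨f (Ls ⟨0, by omega⟩) z, by rw [hI]; exact Finset.mem_image_of_mem _ (mem_univ _)⟩
    have : Nonempty I := ⟨⟨_, (Finset.card_pos.1 hIpos).choose_spec⟩⟩
    obtain ⟨e⟩ : Nonempty (I ↪ Fin k) := by
      apply Function.Embedding.nonempty_of_card_le; simpa using hIk
    simp only [mem_biUnion, mem_univ, true_and, Fintype.mem_piFinset, mem_filter]
    refine ⟨(fun m => e ⟨f (Ls m) z, by rw [hI]; exact Finset.mem_image_of_mem (fun m => f (Ls m) z) (mem_univ m)⟩,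
      fun q => (Function.invFun e q).1), fun m => ?_⟩
    simp only
    rw [Function.leftInverse_invFun e.injective]
  have h1 := (Finset.card_le_card hsub).trans Finset.card_biUnion_le
  have h2 : ∀ p : (Fin d → Fin k) × (Fin k → Fin n),
      ((Fintype.piFinset fun m => univ.filter fun x : X => f x z = p.2 (p.1 m)).card : ℝ) ≤
        ((Fintype.card X : ℝ) / n) ^ d := by
    intro p
    rw [Fintype.card_piFinset]
    push_cast
    calc _ ≤ ∏ m : Fin d, ((Fintype.card X : ℝ) / n) := by
          apply Finset.prod_le_prod
          · intros; positivity
          · intro m _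
            rw [le_div_iff₀ hn']
            exact_mod_cast hf.point z (p.2 (p.1 m))
      _ = _ := by simp only [Finset.prod_const, Finset.card_univ, Fintype.card_fin]
  have h3 : ((univ.filter fun Ls : Fin d → X =>
        (univ.image fun m => f (Ls m) z).card < d - 2).card : ℝ) ≤
      (k:ℝ)^d * (n:ℝ)^k * ((Fintype.card X : ℝ) / n) ^ d := by
    calc _ ≤ ((∑ p : (Fin d → Fin k) × (Fin k → Fin n), (Fintype.piFinset fun m => univ.filter fun x : X => f x z = p.2 (p.1 m)).card : ℕ) : ℝ) := by
          exact_mod_cast h1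
      _ ≤ ∑ p : (Fin d → Fin k) × (Fin k → Fin n), ((Fintype.card X : ℝ) / n) ^ d := by
          push_cast; exact Finset.sum_le_sum fun p _ => h2 p
      _ = _ := by simp [Finset.card_univ]
  calc _ ≤ (k:ℝ)^d * (n:ℝ)^k * ((Fintype.card X : ℝ) / n) ^ d * (n:ℝ)^3 := by gcongr
    _ = (k:ℝ)^d * (Fintype.card X : ℝ)^d := by
        have : (n:ℝ)^d = (n:ℝ)^k * (n:ℝ)^3 := by rw [← pow_add]; congr 1; omega
        rw [div_pow, this]; field_simp
    _ ≤ _ := by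
        have : (k:ℝ) ≤ d := by exact_mod_cast (by omega : k ≤ d)
        gcongr

lemma rate_bound (x σ : ℝ) (hx : 10 ≤ x) (h1 : 1 / 20 ≤ σ) (h2 : σ ≤ 1) :
    Real.log (2 / σ) + 1 + 26 / 25 * x -
      (x ^ 2 * σ / 4 + 26 / 25 * x) * Real.log (1 + 4 * (26 / 25) / (x * σ)) ≤ -(1 / 20) := by
  have hσ : 0 < σ := by linarith
  have hx0 : 0 < x := by linarith
  have hlog : 2 * (4 * (26 / 25) / (x * σ)) / (4 * (26 / 25) / (x * σ) + 2) ≤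
      Real.log (1 + 4 * (26 / 25) / (x * σ)) :=
    Real.le_log_one_add_of_nonneg (by positivity)
  have hmul := mul_le_mul_of_nonneg_left hlog
    (show 0 ≤ x ^ 2 * σ / 4 + 26 / 25 * x by positivity)
  have e1 : (x ^ 2 * σ / 4 + 26 / 25 * x) *
      (2 * (4 * (26 / 25) / (x * σ)) / (4 * (26 / 25) / (x * σ) + 2)) =
      26 / 25 * x + 2 * (26 / 25) ^ 2 * x / (x * σ + 2 * (26 / 25)) := by
    field_simp; ring
  set y := 1 / σ with hy
  have hy1 : 1 ≤ y := by rw [hy, le_div_iff₀ hσ]; linarith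
  have hy2 : y ≤ 20 := by rw [hy, div_le_iff₀ hσ]; linarith
  have hσy : σ = 1 / y := by rw [hy]; field_simp
  have e2 : 2 * (26 / 25) ^ 2 * y / (1 + 26 / 125 * y) ≤
      2 * (26 / 25) ^ 2 * x / (x * σ + 2 * (26 / 25)) := by
    rw [div_le_div_iff₀ (by positivity) (by positivity), hσy]
    have : x * (1 / y) * y = x := by field_simp
    nlinarith [mul_nonneg (show 0 ≤ y by linarith) (show 0 ≤ x - 10 by linarith)]
  have e3 : Real.log (2 / σ) = Real.log 2 + Real.log y := by
    rw [← Real.log_mul (by norm_num) (by positivity)]; congr 1; rw [hy]; ring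
  have hl2 := Real.log_two_lt_d9
  have key : Real.log y + 1.6931471808 + 1 / 20 ≤ 2 * (26 / 25) ^ 2 * y / (1 + 26 / 125 * y) := by
    rcases le_total y 3 with h | h
    · have := Real.log_le_sub_one_of_pos (show 0 < y by linarith)
      refine le_trans (b := y - 1 + 1.6931471808 + 1 / 20) (by linarith) ?_
      rw [le_div_iff₀ (by positivity)]
      nlinarith [mul_nonneg (show 0 ≤ y - 1 by linarith) (show 0 ≤ 3 - y by linarith)]
    · have := Real.log_le_sub_one_of_pos (show 0 < y / 4 by linarith)
      have h4 : Real.log (y / 4) = Real.log y - 2 * Real.log 2 := by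
        rw [Real.log_div (by positivity) (by norm_num),
          show (4:ℝ) = 2 ^ 2 by norm_num, Real.log_pow]; norm_num
      refine le_trans (b := y / 4 - 1 + 2 * 0.6931471808 + 1.6931471808 + 1 / 20) (by linarith) ?_
      rw [le_div_iff₀ (by positivity)]
      nlinarith [mul_nonneg (show 0 ≤ y - 3 by linarith) (show 0 ≤ 20 - y by linarith)]
  rw [e3]
  linarith

lemma choose_bound (n s : ℕ) (hs : 0 < s) (hn : 0 < n) :
    ((Nat.choose (n + n) s : ℕ) : ℝ) ≤
      Real.exp (s * (Real.log (2 / ((s : ℝ) / n)) + 1)) := by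
  have hs' : (0:ℝ) < s := by exact_mod_cast hs
  have hn' : (0:ℝ) < n := by exact_mod_cast hn
  have h1 : ((Nat.choose (n + n) s : ℕ) : ℝ) ≤ ((n + n : ℕ) : ℝ) ^ s / (s.factorial : ℝ) :=
    Nat.choose_le_pow_div s (n + n)
  have h2 : (s:ℝ) ^ s / (s.factorial : ℝ) ≤ Real.exp s := Real.pow_div_factorial_le_exp s hs'.le s
  have e : 2 / ((s:ℝ) / n) = 2 * n / s := by field_simp
  rw [mul_add, Real.exp_add, mul_one, e, Real.exp_nat_mul, Real.exp_log (by positivity)]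
  calc _ ≤ _ := h1
    _ = (2 * n / s : ℝ) ^ s * ((s:ℝ) ^ s / (s.factorial : ℝ)) := by
        push_cast
        rw [div_pow, ← two_mul]
        field_simp
    _ ≤ _ := by gcongr

/-- inside edges of a set `S` in the link -/
def eIn {n d : ℕ} {X : Type} (f : X → Equiv.Perm (Fin n)) (Ls : Fin d → X)
    (S1 S2 : Finset (Fin n)) : ℕ := ∑ m, ecount (f (Ls m)) S1 S2

def BadLink {n d : ℕ} {X : Type} (f : X → Equiv.Perm (Fin n)) (σ : ℝ) (Ls : Fin d → X) : Prop :=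
  ∃ S : Finset (Fin n ⊕ Fin n), 1 ≤ S.card ∧ (S.card : ℝ) ≤ σ * n ∧
    ((d:ℝ) * σ / 4 + 26 / 25 * Real.sqrt d) * S.card ≤ (eIn f Ls S.toLeft S.toRight : ℝ)

lemma expo_bound (s n p x dd σ0 σ u0 u κ r : ℝ) (hs0 : 1 ≤ s) (hn' : 0 < n)
    (h1 : 1 / 20 ≤ σ0) (h2 : σ0 ≤ 1) (hS' : s ≤ σ0 * n) (hxx : x ^ 2 = dd) (hx10 : 10 ≤ x)
    (hσ : σ = s / n) (hu0 : u0 = 4 * (26 / 25) / (x * σ0)) (hu : u = (1 + u0) * (σ0 / σ) - 1)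
    (hκ : κ = dd * σ0 / 4 + 26 / 25 * x) (hr : r = Real.log (σ / σ0)) (hprod : p ≤ s ^ 2 / 4) :
    0 ≤ u ∧ s * (Real.log (2 / σ) + 1) + (dd * (u * p / n)
      - κ * s * Real.log (1 + u)) ≤ 2 * r + -(1 / 20) * s := by
  have hσ0 : 0 < σ0 := by linarith
  have hdd : 0 ≤ dd := by rw [← hxx]; positivity
  have hσpos : 0 < σ := by rw [hσ]; positivity
  have hσle : σ ≤ σ0 := by rw [hσ, div_le_iff₀ hn']; exact hS'
  have hx0 : 0 < x := by linarith
  have hu0pos : 0 < u0 := by rw [hu0]; positivity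
  have hq : 1 ≤ σ0 / σ := by rw [le_div_iff₀ hσpos]; linarith
  have hupos : 0 ≤ u := by rw [hu]; nlinarith
  refine ⟨hupos, ?_⟩
  have hr0 : r ≤ 0 := by
    rw [hr]; exact Real.log_nonpos (by positivity) (by rw [div_le_iff₀ hσ0]; linarith)
  have hlogu : Real.log (1 + u) = Real.log (1 + u0) - r := by
    rw [hu, hr, show 1 + ((1 + u0) * (σ0 / σ) - 1) = (1 + u0) / (σ / σ0) by field_simp; ring,
      Real.log_div (by positivity) (by positivity)]
  have hlog2 : Real.log (2 / σ) = Real.log (2 / σ0) - r := by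
    rw [hr, ← Real.log_div (by positivity) (by positivity)]; congr 1; field_simp
  have hrate := rate_bound x σ0 hx10 h1 h2
  rw [hxx, ← hκ, ← hu0] at hrate
  have hsub : r ≤ σ / σ0 - 1 := by rw [hr]; exact Real.log_le_sub_one_of_pos (by positivity)
  have a1 : dd * (u * p / n) ≤ s * (dd * σ * u / 4) := by
    have : dd * (u * p / n) = (dd * u / n) * p := by ring
    rw [this]
    calc _ ≤ (dd * u / n) * (s ^ 2 / 4) := by gcongr
      _ = _ := by rw [hσ]; ring
  have a2 : dd * σ * u / 4 = dd * σ0 / 4 + 26 / 25 * x - dd * σ / 4 := by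
    have e : σ * u = (1 + u0) * σ0 - σ := by rw [hu]; field_simp
    have e' : dd * u0 * σ0 = 4 * (26 / 25) * x := by rw [hu0, ← hxx]; field_simp
    have : dd * σ * u = dd * σ0 + dd * u0 * σ0 - dd * σ := by
      rw [mul_assoc, e]; ring
    rw [this, e']; ring
  have a3 : dd * σ0 / 4 - dd * σ / 4 ≤ -(dd * σ0 / 4) * r := by
    have : dd * σ0 / 4 - dd * σ / 4 = -((dd * σ0 / 4) * (σ / σ0 - 1)) := by field_simp; ring
    rw [this, neg_mul]
    have : 0 ≤ dd * σ0 / 4 := by positivity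
    exact neg_le_neg (mul_le_mul_of_nonneg_left hsub this)
  have a4 : Real.log (2 / σ) + 1 + dd * σ * u / 4 - κ * Real.log (1 + u) ≤ 2 * r + -(1/20) := by
    rw [hlogu, hlog2, a2]
    have : 26 / 25 * x * r - r ≤ 2 * r := by nlinarith
    have e : κ * (Real.log (1 + u0) - r) = κ * Real.log (1 + u0) - (dd * σ0 / 4) * r - 26 / 25 * x * r := by
      rw [hκ]; ring
    rw [e]
    linarith
  have a5 := mul_le_mul_of_nonneg_left a4 (show (0:ℝ) ≤ s by linarith)
  have a6 : (s:ℝ) * (2 * r) ≤ 2 * r := by nlinarith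
  have a7 : s * (Real.log (2 / σ) + 1 + dd * σ * u / 4 - κ * Real.log (1 + u)) =
    s * (Real.log (2 / σ) + 1) + (s * (dd * σ * u / 4) - κ * s * Real.log (1 + u)) := by ring
  have a8 : s * (2 * r + -(1/20)) = s * (2 * r) + -(1/20) * s := by ring
  rw [a7, a8] at a5
  linarith

lemma EqV.single {n : ℕ} (hn : 0 < n) {X : Type} [Fintype X] {f : X → Equiv.Perm (Fin n)}
    (hf : EqV f) (d : ℕ) (hd : 100 ≤ d) (σ0 : ℝ) (h1 : 1 / 20 ≤ σ0) (h2 : σ0 ≤ 1)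
    (S : Finset (Fin n ⊕ Fin n)) (hS : 1 ≤ S.card) (hS' : (S.card : ℝ) ≤ σ0 * n) :
    (Nat.choose (n + n) S.card : ℝ) * ((univ.filter fun Ls : Fin d → X =>
      ((d:ℝ) * σ0 / 4 + 26 / 25 * Real.sqrt d) * S.card ≤ (eIn f Ls S.toLeft S.toRight : ℝ)).card : ℝ) ≤
      (Fintype.card X : ℝ) ^ d * (((S.card : ℝ) ^ 2 * Real.exp (-(1 / 20) * S.card)) / (σ0 ^ 2 * n ^ 2)) := by
  have hcard : (S.toLeft.card : ℝ) + S.toRight.card = S.card := by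
    exact_mod_cast Finset.card_toLeft_add_card_toRight
  have hc := choose_bound n S.card hS hn
  have hs0 : (1:ℝ) ≤ S.card := by exact_mod_cast hS
  have hn' : (0:ℝ) < n := by exact_mod_cast hn
  have hσ0 : 0 < σ0 := by linarith
  have hxx : (Real.sqrt d) ^ 2 = d := Real.sq_sqrt (by positivity)
  have hx10 : 10 ≤ Real.sqrt d := by
    apply Real.le_sqrt_of_sq_le
    have : (100:ℝ) ≤ d := by exact_mod_cast hd
    linarith
  have hprod : (S.toLeft.card : ℝ) * S.toRight.card ≤ (S.card : ℝ) ^ 2 / 4 := by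
    rw [← hcard]; nlinarith [sq_nonneg ((S.toLeft.card : ℝ) - S.toRight.card)]
  obtain ⟨hupos, hmain⟩ := expo_bound S.card n _ (Real.sqrt d) d σ0 _ _ _ _ _ hs0 hn' h1 h2 hS' hxx hx10
    rfl rfl rfl rfl rfl hprod
  generalize hu : (1 + 4 * (26 / 25) / (Real.sqrt d * σ0)) * (σ0 / ((S.card:ℝ) / n)) - 1 = u at hupos hmain
  have ht := hf.tail hn d S.toLeft S.toRight u (((d:ℝ) * σ0 / 4 + 26 / 25 * Real.sqrt d) * S.card) hupos
  calc _ ≤ Real.exp (S.card * (Real.log (2 / ((S.card:ℝ) / n)) + 1)) * ((Fintype.card X : ℝ) ^ d *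
        Real.exp ((d:ℝ) * (u * S.toLeft.card * S.toRight.card / n) -
          ((d:ℝ) * σ0 / 4 + 26 / 25 * Real.sqrt d) * S.card * Real.log (1 + u))) := by
        exact mul_le_mul hc ht (by positivity) (by positivity)
    _ = (Fintype.card X : ℝ) ^ d * Real.exp (S.card * (Real.log (2 / ((S.card:ℝ) / n)) + 1) +
        ((d:ℝ) * (u * (S.toLeft.card * S.toRight.card) / n) -
          ((d:ℝ) * σ0 / 4 + 26 / 25 * Real.sqrt d) * S.card * Real.log (1 + u))) := by
        rw [Real.exp_add, mul_assoc u]; ring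
    _ ≤ (Fintype.card X : ℝ) ^ d * Real.exp (2 * Real.log ((S.card:ℝ) / n / σ0) + -(1 / 20) * S.card) := by
        gcongr
    _ = _ := by
        rw [Real.exp_add, show 2 * Real.log ((S.card:ℝ) / n / σ0) = ((2:ℕ):ℝ) * Real.log ((S.card:ℝ) / n / σ0) by norm_num, Real.exp_nat_mul,
          Real.exp_log (by positivity)]
        field_simp

lemma badLink_bound (d : ℕ) (hd : 100 ≤ d) (σ0 : ℝ) (h1 : 1 / 20 ≤ σ0) (h2 : σ0 ≤ 1) :
    ∃ C : ℝ, 0 ≤ C ∧ ∀ n : ℕ, 0 < n → ∀ (X : Type) [Fintype X] (f : X → Equiv.Perm (Fin n)), EqV f →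
      ((univ.filter fun Ls : Fin d → X => BadLink f σ0 Ls).card : ℝ) ≤
        C / (n:ℝ) ^ 2 * (Fintype.card X : ℝ) ^ d := by
  have hsum : Summable fun s : ℕ => (s:ℝ) ^ 2 * Real.exp (-(1 / 20) * s) :=
    Real.summable_pow_mul_exp_neg_nat_mul 2 (by norm_num)
  refine ⟨(∑' s : ℕ, (s:ℝ) ^ 2 * Real.exp (-(1 / 20) * s)) / σ0 ^ 2, by positivity, ?_⟩
  intro n hn X _ f hf
  have hσ0 : 0 < σ0 := by linarith
  have hn' : (0:ℝ) < n := by exact_mod_cast hn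
  set A : Finset (Fin n ⊕ Fin n) → Finset (Fin d → X) := fun S => univ.filter fun Ls : Fin d → X =>
      ((d:ℝ) * σ0 / 4 + 26 / 25 * Real.sqrt d) * S.card ≤ (eIn f Ls S.toLeft S.toRight : ℝ) with hA
  set W := (univ : Finset (Finset (Fin n ⊕ Fin n))).filter fun S => 1 ≤ S.card ∧ (S.card : ℝ) ≤ σ0 * n
    with hW
  have hsub : (univ.filter fun Ls : Fin d → X => BadLink f σ0 Ls) ⊆ W.biUnion A := by
    intro Ls hLs
    obtain ⟨S, ha, hb, hc⟩ := (Finset.mem_filter.1 hLs).2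
    simp only [mem_biUnion, hW, hA, mem_filter, mem_univ, true_and]
    exact ⟨S, ⟨ha, hb⟩, hc⟩
  have hchoose : ∀ S : Finset (Fin n ⊕ Fin n), (0:ℝ) < Nat.choose (n + n) S.card := by
    intro S
    have : S.card ≤ n + n := by
      have := Finset.card_le_univ S
      simpa using this
    exact_mod_cast Nat.choose_pos this
  set t : ℕ → ℝ := fun s => (s:ℝ) ^ 2 * Real.exp (-(1 / 20) * s) with ht
  have htn : ∀ s, 0 ≤ t s := fun s => by rw [ht]; positivity
  set D : ℝ := (Fintype.card X : ℝ) ^ d / (σ0 ^ 2 * n ^ 2) with hD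
  have hDn : 0 ≤ D := by positivity
  have hone : ∀ S ∈ W, ((A S).card : ℝ) ≤ D * (t S.card / Nat.choose (n + n) S.card) := by
    intro S hS
    simp only [hW, mem_filter, mem_univ, true_and] at hS
    have := hf.single hn d hd σ0 h1 h2 S hS.1 hS.2
    rw [← mul_div_assoc, le_div_iff₀ (hchoose S), mul_comm]
    refine this.trans (le_of_eq ?_)
    rw [hD, ht]; ring
  calc _ ≤ ((W.biUnion A).card : ℝ) := by exact_mod_cast Finset.card_le_card hsub
    _ ≤ ∑ S ∈ W, ((A S).card : ℝ) := by exact_mod_cast Finset.card_biUnion_le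
    _ ≤ ∑ S ∈ W, D * (t S.card / Nat.choose (n + n) S.card) := Finset.sum_le_sum hone
    _ ≤ ∑ S : Finset (Fin n ⊕ Fin n), D * (t S.card / Nat.choose (n + n) S.card) := by
        apply Finset.sum_le_sum_of_subset_of_nonneg (Finset.subset_univ _)
        intro S _ _
        have := htn S.card
        positivity
    _ = D * ∑ s ∈ range (n + n + 1), t s := by
        rw [← Finset.mul_sum]
        congr 1
        rw [← Finset.powerset_univ, Finset.sum_powerset]
        simp only [Finset.card_univ, Fintype.card_sum, Fintype.card_fin]
        refine Finset.sum_congr rfl fun s hs => ?_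
        rw [Finset.sum_congr rfl (g := fun _ => t s / Nat.choose (n + n) s)]
        · rw [Finset.sum_const, Finset.card_powersetCard]
          simp only [Finset.card_univ, Fintype.card_sum, Fintype.card_fin, nsmul_eq_mul]
          have : (0:ℝ) < Nat.choose (n + n) s := by
            exact_mod_cast Nat.choose_pos (by simp at hs; omega)
          field_simp
        · intro S hS
          rw [(Finset.mem_powersetCard.1 hS).2]
    _ ≤ D * ∑' s, t s := by
        gcongr
        exact hsum.sum_le_tsum _ fun s _ => htn s
    _ = _ := by rw [hD]; field_simp

/-- row permutation, `b → c` -/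
def fa {n : ℕ} (i : Fin n) (L : LatinSquare n) : Equiv.Perm (Fin n) := L.1 i

lemma col_inj {n : ℕ} (L : LatinSquare n) (j : Fin n) : Function.Injective fun i => L.1 i j := by
  intro i i' h
  by_contra hne
  exact L.2 i i' hne j h

lemma symm_inj {n : ℕ} (L : LatinSquare n) (k : Fin n) :
    Function.Injective fun i => (L.1 i).symm k := by
  intro i i' h
  by_contra hne
  refine L.2 i i' hne ((L.1 i).symm k) ?_
  have h' : (L.1 i).symm k = (L.1 i').symm k := h
  rw [Equiv.apply_symm_apply, h', Equiv.apply_symm_apply]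

/-- `c → a` -/
def fb {n : ℕ} (j : Fin n) (L : LatinSquare n) : Equiv.Perm (Fin n) :=
  (Equiv.ofBijective (fun i => L.1 i j) (Finite.injective_iff_bijective.1 (col_inj L j))).symm

/-- `a → b` -/
def fc {n : ℕ} (k : Fin n) (L : LatinSquare n) : Equiv.Perm (Fin n) :=
  Equiv.ofBijective (fun i => (L.1 i).symm k) (Finite.injective_iff_bijective.1 (symm_inj L k))

lemma fb_iff {n : ℕ} (L : LatinSquare n) (i j k : Fin n) : fb j L k = i ↔ L.1 i j = k := by
  rw [fb, Equiv.symm_apply_eq]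
  simp only [Equiv.ofBijective_apply]
  exact eq_comm

lemma fc_iff {n : ℕ} (L : LatinSquare n) (i j k : Fin n) : fc k L i = j ↔ L.1 i j = k := by
  rw [fc]
  simp only [Equiv.ofBijective_apply]
  rw [Equiv.symm_apply_eq]
  exact eq_comm

lemma fa_eqv {n : ℕ} (i : Fin n) : EqV (fa i) := by
  intro τ
  refine ⟨fun L => ⟨fun i => τ * L.1 i, ?_⟩, ?_, ?_⟩
  · intro i j hij x h
    exact L.2 i j hij x (τ.injective h)
  · intro L L' h
    apply Subtype.ext
    funext i
    have := congrFun (congrArg Subtype.val h) i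
    exact mul_left_cancel this
  · intro L; rfl

lemma fb_eqv {n : ℕ} (j : Fin n) : EqV (fb j) := by
  intro τ
  refine ⟨fun L => ⟨fun i => L.1 (τ⁻¹ i), ?_⟩, ?_, ?_⟩
  · intro i j hij x h
    exact L.2 _ _ (fun h => hij (τ⁻¹.injective h)) x h
  · intro L L' h
    apply Subtype.ext
    funext i
    have := congrFun (congrArg Subtype.val h) (τ i)
    simpa using this
  · intro L
    ext1 k
    rw [fb_iff, Equiv.Perm.mul_apply]
    show L.1 (τ⁻¹ (τ (fb j L k))) j = k
    rw [show τ⁻¹ (τ (fb j L k)) = fb j L k from τ.symm_apply_apply _]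
    exact (fb_iff L _ j k).1 rfl

lemma fc_eqv {n : ℕ} (k : Fin n) : EqV (fc k) := by
  intro τ
  refine ⟨fun L => ⟨fun i => L.1 i * τ⁻¹, ?_⟩, ?_, ?_⟩
  · intro i j hij x h
    exact L.2 i j hij (τ⁻¹ x) h
  · intro L L' h
    apply Subtype.ext
    funext i
    have := congrFun (congrArg Subtype.val h) i
    exact mul_right_cancel this
  · intro L
    ext1 i
    rw [fc_iff, Equiv.Perm.mul_apply, Equiv.Perm.mul_apply]
    rw [show τ⁻¹ (τ (fc k L i)) = fc k L i from τ.symm_apply_apply _]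
    exact (fc_iff L i _ k).1 rfl

lemma latin_nonempty (n : ℕ) (hn : 0 < n) : Nonempty (LatinSquare n) := by
  have : NeZero n := ⟨hn.ne'⟩
  refine ⟨⟨fun i => Equiv.addLeft i, ?_⟩⟩
  intro i j hij x h
  simp only [Equiv.coe_addLeft] at h
  exact hij (add_right_cancel h)

/-- the good event -/
structure Good {n d : ℕ} (θ : ℝ) (Ls : Fin d → LatinSquare n) : Prop where
  da : ∀ i z, d - 2 ≤ (univ.image fun m => fa i (Ls m) z).card
  db : ∀ i z, d - 2 ≤ (univ.image fun m => fb i (Ls m) z).card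
  dc : ∀ i z, d - 2 ≤ (univ.image fun m => fc i (Ls m) z).card
  la : ∀ i, ¬ BadLink (fa i) 1 Ls
  lb : ∀ i, ¬ BadLink (fb i) 1 Ls
  lc : ∀ i, ¬ BadLink (fc i) 1 Ls
  la' : ∀ i, ¬ BadLink (fa i) θ Ls
  lb' : ∀ i, ¬ BadLink (fb i) θ Ls
  lc' : ∀ i, ¬ BadLink (fc i) θ Ls

/-- Bad event for one family. -/
def BadFam {n d : ℕ} {X : Type} (θ : ℝ) (f : Fin n → X → Equiv.Perm (Fin n))
    (Ls : Fin d → X) : Prop :=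
  (∃ i z, (univ.image fun m => f i (Ls m) z).card < d - 2) ∨ (∃ i, BadLink (f i) 1 Ls) ∨
    (∃ i, BadLink (f i) θ Ls)

/-- counting with the classical instance -/
def cnt {Ω : Type} [Fintype Ω] (P : Ω → Prop) : ℝ :=
  ((@Finset.filter Ω P (Classical.decPred P) univ).card : ℝ)

lemma cnt_eq {Ω : Type} [Fintype Ω] (P : Ω → Prop) [inst : DecidablePred P] :
    ((univ.filter P).card : ℝ) = cnt P := by
  rw [cnt]; congr!

lemma cnt_mono {Ω : Type} [Fintype Ω] {P Q : Ω → Prop} (h : ∀ x, P x → Q x) : cnt P ≤ cnt Q := by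
  rw [← cnt_eq, ← cnt_eq]
  exact_mod_cast Finset.card_le_card fun x hx =>
    Finset.mem_filter.2 ⟨mem_univ _, h x (Finset.mem_filter.1 hx).2⟩

lemma cnt_exists_le {Ω ι : Type} [Fintype Ω] [Fintype ι] (P : ι → Ω → Prop) (b : ℝ)
    (h : ∀ i, cnt (P i) ≤ b) :
    cnt (fun x => ∃ i, P i x) ≤ Fintype.card ι * b := by
  have hsub : (univ.filter fun x : Ω => ∃ i, P i x) ⊆
      (univ : Finset ι).biUnion fun i => univ.filter fun x : Ω => P i x := by
    intro x hx
    obtain ⟨i, hi⟩ := (Finset.mem_filter.1 hx).2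
    exact Finset.mem_biUnion.2 ⟨i, mem_univ _, Finset.mem_filter.2 ⟨mem_univ _, hi⟩⟩
  rw [← cnt_eq]
  calc _ ≤ ((∑ i : ι, (univ.filter fun x : Ω => P i x).card : ℕ) : ℝ) := by
        exact_mod_cast (Finset.card_le_card hsub).trans Finset.card_biUnion_le
    _ ≤ ∑ i : ι, b := by
        push_cast; exact Finset.sum_le_sum fun i _ => (cnt_eq (P i)).le.trans (h i)
    _ = _ := by simp

lemma cnt_or_le {Ω : Type} [Fintype Ω] (P Q : Ω → Prop) : cnt (fun x => P x ∨ Q x) ≤ cnt P + cnt Q := by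
  rw [← cnt_eq, ← cnt_eq, ← cnt_eq, Finset.filter_or]
  exact_mod_cast Finset.card_union_le _ _

lemma badFam_bound (d : ℕ) (hd : 100 ≤ d) (θ : ℝ) (h1 : 1 / 20 ≤ θ) (h2 : θ ≤ 1) :
    ∃ C : ℝ, 0 ≤ C ∧ ∀ n : ℕ, 0 < n → ∀ (X : Type) [Fintype X]
      (f : Fin n → X → Equiv.Perm (Fin n)), (∀ i, EqV (f i)) →
      cnt (fun Ls : Fin d → X => BadFam θ f Ls) ≤ C / (n:ℝ) * (Fintype.card X : ℝ) ^ d := by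
  obtain ⟨C1, hC1, H1⟩ := badLink_bound d hd 1 (by norm_num) le_rfl
  obtain ⟨C2, hC2, H2⟩ := badLink_bound d hd θ h1 h2
  refine ⟨(d:ℝ) ^ d + (C1 + C2), by positivity, ?_⟩
  intro n hn X _ f hf
  have hn' : (0:ℝ) < n := by exact_mod_cast hn
  have H1' := fun i => H1 n hn X (f i) (hf i)
  have H2' := fun i => H2 n hn X (f i) (hf i)
  have H3' : ∀ i z, cnt (fun Ls : Fin d → X => (univ.image fun m => f i (Ls m) z).card < d - 2) ≤
      (d:ℝ) ^ d * (Fintype.card X : ℝ) ^ d / n ^ 3 := by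
    intro i z
    rw [le_div_iff₀ (by positivity), ← cnt_eq]
    exact (hf i).degree hn d (by omega) z
  generalize (Fintype.card X : ℝ) ^ d = M at *
  simp only [cnt_eq] at H1' H2'
  have A := cnt_exists_le _ _ fun i => cnt_exists_le _ _ (H3' i)
  have B := cnt_exists_le _ _ H1'
  have B' := cnt_exists_le _ _ H2'
  have D1 := cnt_or_le (Ω := Fin d → X) (fun Ls => ∃ i, BadLink (f i) 1 Ls) (fun Ls => ∃ i, BadLink (f i) θ Ls)
  have D2 := cnt_or_le (Ω := Fin d → X) (fun Ls => ∃ i z, (univ.image fun m => f i (Ls m) z).card < d - 2)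
    (fun Ls => (∃ i, BadLink (f i) 1 Ls) ∨ (∃ i, BadLink (f i) θ Ls))
  have D3 : cnt (fun Ls : Fin d → X => BadFam θ f Ls) ≤ _ := D2
  refine D3.trans ((add_le_add A (D1.trans (add_le_add B B'))).trans (le_of_eq ?_))
  simp only [Fintype.card_fin]
  field_simp

lemma good_bound (d : ℕ) (hd : 100 ≤ d) (θ : ℝ) (h1 : 1 / 20 ≤ θ) (h2 : θ ≤ 1) :
    ∃ C : ℝ, ∀ n : ℕ, 0 < n →
      cnt (fun Ls : Fin d → LatinSquare n => ¬ Good θ Ls) ≤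
        C / (n:ℝ) * ((univ : Finset (Fin d → LatinSquare n)).card : ℝ) := by
  obtain ⟨C, hC, H⟩ := badFam_bound d hd θ h1 h2
  refine ⟨3 * C, fun n hn => ?_⟩
  have hcard : ((univ : Finset (Fin d → LatinSquare n)).card : ℝ) = (Fintype.card (LatinSquare n) : ℝ) ^ d := by
    simp [Finset.card_univ]
  rw [hcard]
  have A := H n hn (LatinSquare n) fa fa_eqv
  have B := H n hn (LatinSquare n) fb fb_eqv
  have D := H n hn (LatinSquare n) fc fc_eqv
  generalize (Fintype.card (LatinSquare n) : ℝ) ^ d = M at *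
  have E1 := cnt_or_le (Ω := Fin d → LatinSquare n) (BadFam θ fb) (BadFam θ fc)
  have E2 := cnt_or_le (Ω := Fin d → LatinSquare n) (BadFam θ fa) (fun Ls => BadFam θ fb Ls ∨ BadFam θ fc Ls)
  have E3 : cnt (fun Ls : Fin d → LatinSquare n => ¬ Good θ Ls) ≤
      cnt (fun Ls : Fin d → LatinSquare n => BadFam θ fa Ls ∨ BadFam θ fb Ls ∨ BadFam θ fc Ls) := by
    apply cnt_mono
    intro Ls hng
    by_contra hcon
    unfold BadFam at hcon
    push Not at hcon
    obtain ⟨⟨a1, a2, a3⟩, ⟨b1, b2, b3⟩, c1, c2, c3⟩ := hcon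
    exact hng ⟨a1, b1, c1, a2, b2, c2, a3, b3, c3⟩
  have : 3 * C / n * M = C / n * M + (C / n * M + C / n * M) := by ring
  rw [this]
  linarith

lemma link_count {n d : ℕ} {X : Type} (f : X → Equiv.Perm (Fin n)) (Ls : Fin d → X) (θ : ℝ)
    (hb : ¬ BadLink f 1 Ls) (hs : ¬ BadLink f θ Ls) (S1 S2 : Finset (Fin n))
    (hn : S1.card + S2.card ≤ n) :
    (eIn f Ls S1 S2 : ℝ) ≤ ((d:ℝ) * θ / 4 + 26 / 25 * Real.sqrt d) * ((S1.card + S2.card : ℕ) : ℝ) +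
      (if θ * n < ((S1.card + S2.card : ℕ) : ℝ) then
        (d:ℝ) * (1 - θ) / 4 * ((S1.card + S2.card : ℕ) : ℝ) else 0) := by
  have hc : (S1.disjSum S2).card = S1.card + S2.card := Finset.card_disjSum S1 S2
  rcases Nat.eq_zero_or_pos (S1.card + S2.card) with h0 | hpos
  · have h1 : S1 = ∅ := Finset.card_eq_zero.1 (by omega)
    subst h1
    have : eIn f Ls ∅ S2 = 0 := by simp [eIn, ecount]
    rw [this, h0]; simp
  have hle : (((S1.card + S2.card : ℕ)) : ℝ) ≤ n := by exact_mod_cast hn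
  have hL : (S1.disjSum S2).toLeft = S1 := by simp
  have hR : (S1.disjSum S2).toRight = S2 := by simp
  split_ifs with h
  · by_contra hcon
    push Not at hcon
    apply hb
    refine ⟨S1.disjSum S2, by omega, by rw [hc, one_mul]; exact hle, ?_⟩
    rw [hL, hR, hc]
    refine le_trans (le_of_eq ?_) hcon.le
    ring
  · by_contra hcon
    push Not at hcon
    apply hs
    refine ⟨S1.disjSum S2, by omega, by rw [hc]; exact not_lt.1 h, ?_⟩
    rw [hL, hR, hc]
    linarith

lemma link_sum {n d : ℕ} {X : Type} (f : Fin n → X → Equiv.Perm (Fin n)) (Ls : Fin d → X) (θ : ℝ)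
    (hb : ∀ i, ¬ BadLink (f i) 1 Ls) (hs : ∀ i, ¬ BadLink (f i) θ Ls) (S1 S2 : Fin n → Finset (Fin n))
    (hn : ∀ i, (S1 i).card + (S2 i).card ≤ n) :
    ((∑ i, eIn (f i) Ls (S1 i) (S2 i) : ℕ) : ℝ) ≤
      ((d:ℝ) * θ / 4 + 26 / 25 * Real.sqrt d) * ((∑ i, ((S1 i).card + (S2 i).card) : ℕ) : ℝ) +
      (d:ℝ) * (1 - θ) / 4 *
        ((∑ i ∈ univ.filter (fun i => θ * n < (((S1 i).card + (S2 i).card : ℕ) : ℝ)),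
          ((S1 i).card + (S2 i).card) : ℕ) : ℝ) := by
  rw [Nat.cast_sum, Nat.cast_sum, Nat.cast_sum, Finset.mul_sum, Finset.mul_sum, Finset.sum_filter,
    ← Finset.sum_add_distrib]
  exact Finset.sum_le_sum fun i _ => link_count (f i) Ls θ (hb i) (hs i) _ _ (hn i)

lemma tri_count {n d : ℕ} {X : Type} (f : Fin n → X → Equiv.Perm (Fin n)) (Ls : Fin d → X)
    (S1 S2 : Fin n → Finset (Fin n)) (Q : Finset (Fin n × Fin n × Fin n))
    (v : Fin n × Fin n × Fin n → Fin n) (W : Fin n → Fin n → Fin n → Fin n × Fin n × Fin n)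
    (hQ : ∀ t ∈ Q, ∃ m, ∃ y ∈ S1 (v t), f (v t) (Ls m) y ∈ S2 (v t) ∧
      t = W (v t) y (f (v t) (Ls m) y)) :
    Q.card ≤ ∑ i, eIn (f i) Ls (S1 i) (S2 i) := by
  have hsub : Q ⊆ (univ : Finset (Fin n)).biUnion fun i => (univ : Finset (Fin d)).biUnion fun m =>
      ((S1 i).filter fun y => f i (Ls m) y ∈ S2 i).image fun y => W i y (f i (Ls m) y) := by
    intro t ht
    obtain ⟨m, y, hy, hy', h⟩ := hQ t ht
    refine Finset.mem_biUnion.2 ⟨v t, mem_univ _, Finset.mem_biUnion.2 ⟨m, mem_univ _, ?_⟩⟩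
    exact Finset.mem_image.2 ⟨y, Finset.mem_filter.2 ⟨hy, hy'⟩, h.symm⟩
  refine (Finset.card_le_card hsub).trans (Finset.card_biUnion_le.trans ?_)
  refine Finset.sum_le_sum fun i _ => Finset.card_biUnion_le.trans ?_
  exact Finset.sum_le_sum fun m _ => Finset.card_image_le

lemma edge_count {n D : ℕ} (T : Finset (Fin n × Fin n × Fin n))
    (π : Fin n × Fin n × Fin n → Fin n × Fin n) (E : Finset (Fin n × Fin n))
    (h : ∀ p ∈ E, D ≤ (T.filter fun t => π t = p).card) :
    D * E.card ≤ (T.filter fun t => π t ∈ E).card := by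
  rw [Finset.card_eq_sum_card_fiberwise (f := π) (t := E)]
  swap
  · intro t ht
    exact (Finset.mem_filter.1 (Finset.mem_coe.1 ht)).2
  rw [mul_comm, ← smul_eq_mul]
  refine Finset.card_nsmul_le_sum _ _ _ fun p hp => (h p hp).trans ?_
  apply Finset.card_le_card
  intro t ht
  simp only [mem_filter] at ht ⊢
  exact ⟨⟨ht.1, ht.2 ▸ hp⟩, ht.2⟩

lemma row_sum_s8 {n : ℕ} (P : Fin n → Fin n → Prop) (U : Finset (Fin n)) :
    ∑ i ∈ U, (univ.filter fun j => P i j).card =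
      ((univ.filter fun p : Fin n × Fin n => P p.1 p.2).filter fun p => p.1 ∈ U).card := by
  rw [Finset.card_eq_sum_card_fiberwise (f := Prod.fst) (t := U)]
  swap
  · intro t ht
    exact (Finset.mem_filter.1 (Finset.mem_coe.1 ht)).2
  refine Finset.sum_congr rfl fun i hi => ?_
  refine Finset.card_bij (fun j _ => (i, j)) ?_ ?_ ?_
  · intro j hj; simp only [mem_filter, mem_univ, true_and] at hj ⊢; simp [hj, hi]
  · intro j _ j' _ h; exact (Prod.mk.inj h).2
  · rintro ⟨i', j⟩ hp
    simp only [mem_filter, mem_univ, true_and] at hp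
    obtain ⟨⟨h1, h2⟩, h3⟩ := hp
    subst h3
    exact ⟨j, by simp [h1], rfl⟩

lemma col_sum {n : ℕ} (P : Fin n → Fin n → Prop) (V : Finset (Fin n)) :
    ∑ j ∈ V, (univ.filter fun i => P i j).card =
      ((univ.filter fun p : Fin n × Fin n => P p.1 p.2).filter fun p => p.2 ∈ V).card := by
  rw [Finset.card_eq_sum_card_fiberwise (f := Prod.snd) (t := V)]
  swap
  · intro t ht
    exact (Finset.mem_filter.1 (Finset.mem_coe.1 ht)).2
  refine Finset.sum_congr rfl fun j hj => ?_
  refine Finset.card_bij (fun i _ => (i, j)) ?_ ?_ ?_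
  · intro i hi; simp only [mem_filter, mem_univ, true_and] at hi ⊢; simp [hi, hj]
  · intro j _ j' _ h; exact (Prod.mk.inj h).1
  · rintro ⟨i, j'⟩ hp
    simp only [mem_filter, mem_univ, true_and] at hp
    obtain ⟨⟨h1, h2⟩, h3⟩ := hp
    subst h3
    exact ⟨i, by simp [h1], rfl⟩

lemma big_pair {n : ℕ} (E : Finset (Fin n × Fin n)) (U V : Finset (Fin n)) :
    (E.filter fun p => p.1 ∈ U).card + (E.filter fun p => p.2 ∈ V).card ≤ E.card + U.card * V.card := by
  rw [← Finset.card_union_add_card_inter, ← Finset.card_product]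
  apply add_le_add
  · apply Finset.card_le_card
    exact Finset.union_subset (Finset.filter_subset _ _) (Finset.filter_subset _ _)
  · apply Finset.card_le_card
    intro p hp
    simp only [mem_inter, mem_filter] at hp
    exact Finset.mem_product.2 ⟨hp.1.2, hp.2.2⟩

/-- degrees of a tripartite graph -/
lemma big_sum {n : ℕ} (P Q R : Fin n → Fin n → Prop) (θ : ℝ) (hθ : 0 < θ) (hn : 0 < n)
    (A B C : Fin n → ℕ)
    (hA : ∀ i, A i = (univ.filter fun j => P i j).card + (univ.filter fun k => Q i k).card)
    (hB : ∀ j, B j = (univ.filter fun k => R j k).card + (univ.filter fun i => P i j).card)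
    (hC : ∀ k, C k = (univ.filter fun i => Q i k).card + (univ.filter fun j => R j k).card)
    (N : ℕ) (hN : N = (univ.filter fun p : Fin n × Fin n => P p.1 p.2).card +
      (univ.filter fun p : Fin n × Fin n => Q p.1 p.2).card +
      (univ.filter fun p : Fin n × Fin n => R p.1 p.2).card) :
    (∑ i, A i + ∑ i, B i + ∑ i, C i = 2 * N) ∧
    ((∑ i ∈ univ.filter (fun i => θ * n < (A i : ℝ)), A i : ℕ) : ℝ) +
    ((∑ i ∈ univ.filter (fun i => θ * n < (B i : ℝ)), B i : ℕ) : ℝ) +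
    ((∑ i ∈ univ.filter (fun i => θ * n < (C i : ℝ)), C i : ℕ) : ℝ) ≤
      N + 4 * (N:ℝ) ^ 2 / (3 * θ ^ 2 * n ^ 2) := by
  have hn' : (0:ℝ) < n := by exact_mod_cast hn
  have sA : ∀ U : Finset (Fin n), ∑ i ∈ U, A i = _ := fun U => by
    rw [Finset.sum_congr rfl (fun i _ => hA i), Finset.sum_add_distrib, row_sum_s8, row_sum_s8]
  have sB : ∀ U : Finset (Fin n), ∑ i ∈ U, B i = _ := fun U => by
    rw [Finset.sum_congr rfl (fun i _ => hB i), Finset.sum_add_distrib, row_sum_s8, col_sum]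
  have sC : ∀ U : Finset (Fin n), ∑ i ∈ U, C i = _ := fun U => by
    rw [Finset.sum_congr rfl (fun i _ => hC i), Finset.sum_add_distrib, col_sum, col_sum]
  have htot : ∑ i, A i + ∑ i, B i + ∑ i, C i = 2 * N := by
    rw [sA, sB, sC, hN]; simp only [mem_univ, Finset.filter_true]; ring
  refine ⟨htot, ?_⟩
  set U := univ.filter (fun i => θ * n < (A i : ℝ)) with hU
  set V := univ.filter (fun i => θ * n < (B i : ℝ)) with hV
  set Z := univ.filter (fun i => θ * n < (C i : ℝ)) with hZ
  have gen : ∀ F : Fin n → ℕ, ((univ.filter (fun i => θ * n < (F i : ℝ))).card : ℝ) * (θ * n) ≤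
      ((∑ i, F i : ℕ) : ℝ) := by
    intro F
    push_cast
    refine le_trans ?_ (Finset.sum_le_sum_of_subset_of_nonneg
      (Finset.filter_subset (fun i => θ * n < (F i : ℝ)) univ) (fun _ _ _ => by positivity))
    rw [← nsmul_eq_mul]
    exact Finset.card_nsmul_le_sum _ _ _ fun i hi => (Finset.mem_filter.1 hi).2.le
  have gA := gen A
  have gB := gen B
  have gC := gen C
  rw [← hU] at gA
  rw [← hV] at gB
  rw [← hZ] at gC
  have htot' : ((∑ i, A i : ℕ) : ℝ) + ((∑ i, B i : ℕ) : ℝ) + ((∑ i, C i : ℕ) : ℝ) = 2 * N := by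
    exact_mod_cast htot
  have hsum : ((U.card : ℝ) + V.card + Z.card) * (θ * n) ≤ 2 * N := by linarith
  have p1 := big_pair (univ.filter fun p : Fin n × Fin n => P p.1 p.2) U V
  have p2 := big_pair (univ.filter fun p : Fin n × Fin n => Q p.1 p.2) U Z
  have p3 := big_pair (univ.filter fun p : Fin n × Fin n => R p.1 p.2) V Z
  have hnat : ∑ i ∈ U, A i + ∑ i ∈ V, B i + ∑ i ∈ Z, C i ≤
      N + (U.card * V.card + U.card * Z.card + V.card * Z.card) := by
    rw [sA, sB, sC]; omega
  have hnat' : ((∑ i ∈ U, A i : ℕ) : ℝ) + ((∑ i ∈ V, B i : ℕ) : ℝ) + ((∑ i ∈ Z, C i : ℕ) : ℝ) ≤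
      N + ((U.card:ℝ) * V.card + U.card * Z.card + V.card * Z.card) := by exact_mod_cast hnat
  refine hnat'.trans ?_
  gcongr
  rw [le_div_iff₀ (by positivity)]
  have h3 : 3 * ((U.card:ℝ) * V.card + U.card * Z.card + V.card * Z.card) ≤
      ((U.card : ℝ) + V.card + Z.card) ^ 2 := by
    nlinarith [sq_nonneg ((U.card : ℝ) - V.card), sq_nonneg ((U.card : ℝ) - Z.card), sq_nonneg ((V.card : ℝ) - Z.card)]
  have h4 : (((U.card : ℝ) + V.card + Z.card) * (θ * n)) ^ 2 ≤ (2 * N) ^ 2 := by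
    gcongr
  calc _ = 3 * ((U.card:ℝ) * V.card + U.card * Z.card + V.card * Z.card) * (θ * n) ^ 2 := by ring
    _ ≤ ((U.card : ℝ) + V.card + Z.card) ^ 2 * (θ * n) ^ 2 := by gcongr
    _ ≤ _ := by nlinarith

lemma zmod_point (x y z : ZMod 2) :
    (if x ≠ 0 then 1 else 0) + (if y ≠ 0 then 1 else 0) + (if z ≠ 0 then 1 else 0) ≤
      (if x + y + z ≠ 0 then 1 else 0) + 2 * ((if x ≠ 0 ∧ y ≠ 0 then 1 else 0) +
        (if z ≠ 0 ∧ x ≠ 0 then 1 else 0) + (if y ≠ 0 ∧ z ≠ 0 then 1 else 0)) := by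
  have key : ∀ x y z : ZMod 2, @LE.le ℕ _ ((if x ≠ 0 then 1 else 0) + (if y ≠ 0 then 1 else 0) + (if z ≠ 0 then 1 else 0))
      ((if x + y + z ≠ 0 then 1 else 0) + 2 * ((if x ≠ 0 ∧ y ≠ 0 then 1 else 0) +
        (if z ≠ 0 ∧ x ≠ 0 then 1 else 0) + (if y ≠ 0 ∧ z ≠ 0 then 1 else 0))) := by decide
  convert key x y z

lemma normd1_lower {n : ℕ} (T : Finset (Fin n × Fin n × Fin n)) (φ : Cochain1 n) :
    (T.filter fun t => φ.ab t.1 t.2.1 ≠ 0).card + (T.filter fun t => φ.ac t.1 t.2.2 ≠ 0).card +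
      (T.filter fun t => φ.bc t.2.1 t.2.2 ≠ 0).card ≤
    normd1 T φ + 2 * ((T.filter fun t => φ.ab t.1 t.2.1 ≠ 0 ∧ φ.ac t.1 t.2.2 ≠ 0).card +
      (T.filter fun t => φ.bc t.2.1 t.2.2 ≠ 0 ∧ φ.ab t.1 t.2.1 ≠ 0).card +
      (T.filter fun t => φ.ac t.1 t.2.2 ≠ 0 ∧ φ.bc t.2.1 t.2.2 ≠ 0).card) := by
  unfold normd1 d1
  simp only [Finset.card_filter]
  simp only [← Finset.sum_add_distrib, Finset.mul_sum]
  refine Finset.sum_le_sum fun t _ => ?_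
  have := zmod_point (φ.ab t.1 t.2.1) (φ.ac t.1 t.2.2) (φ.bc t.2.1 t.2.2)
  simpa only [mul_add] using this

lemma flip_row {n : ℕ} (P P' : Fin n → Fin n → Prop) (i : Fin n)
    (h : ∀ i' j, i' ≠ i → (P' i' j ↔ P i' j)) (h' : ∀ j, P' i j ↔ ¬ P i j) :
    (univ.filter fun p : Fin n × Fin n => P' p.1 p.2).card + 2 * (univ.filter fun j => P i j).card =
      (univ.filter fun p : Fin n × Fin n => P p.1 p.2).card + n := by
  have e1 := row_sum_s8 P univ
  have e2 := row_sum_s8 P' univ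
  simp only [mem_univ, Finset.filter_true] at e1 e2
  rw [← e1, ← e2, ← Finset.add_sum_erase univ _ (mem_univ i), ← Finset.add_sum_erase univ (fun i => (univ.filter fun j => P i j).card) (mem_univ i)]
  have e3 : ∑ x ∈ univ.erase i, (univ.filter fun j => P' x j).card =
      ∑ x ∈ univ.erase i, (univ.filter fun j => P x j).card := by
    refine Finset.sum_congr rfl fun x hx => ?_
    congr 1
    ext j
    simp only [mem_filter, mem_univ, true_and]
    exact h x j (Finset.ne_of_mem_erase hx)
  have e4 : (univ.filter fun j => P' i j).card + (univ.filter fun j => P i j).card = n := by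
    have := Finset.card_filter_add_card_filter_not (s := (univ : Finset (Fin n))) (fun j => P i j)
    simp only [Finset.card_univ, Fintype.card_fin] at this
    have e : (univ.filter fun j => P' i j) = (univ.filter fun j => ¬ P i j) := by
      ext j; simp only [mem_filter, mem_univ, true_and]; exact h' j
    rw [e]; omega
  rw [e3]; omega

lemma flip_col {n : ℕ} (P P' : Fin n → Fin n → Prop) (j : Fin n)
    (h : ∀ i j', j' ≠ j → (P' i j' ↔ P i j')) (h' : ∀ i, P' i j ↔ ¬ P i j) :
    (univ.filter fun p : Fin n × Fin n => P' p.1 p.2).card + 2 * (univ.filter fun i => P i j).card =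
      (univ.filter fun p : Fin n × Fin n => P p.1 p.2).card + n := by
  have e := flip_row (fun j i => P i j) (fun j i => P' i j) j (fun i' j hh => h j i' hh) h'
  have sw : ∀ P : Fin n → Fin n → Prop, (univ.filter fun p : Fin n × Fin n => P p.2 p.1).card =
      (univ.filter fun p : Fin n × Fin n => P p.1 p.2).card := by
    intro P
    refine Finset.card_bij (fun p _ => p.swap) ?_ ?_ ?_
    · intro p hp; simpa using hp
    · intro p _ q _ hh; exact Prod.swap_injective hh
    · intro p hp; exact ⟨p.swap, by simpa using hp, by simp⟩
  rw [sw P, sw P'] at e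
  exact e

lemma flip_rowZ {n : ℕ} (M M' : Fin n → Fin n → ZMod 2) (i : Fin n)
    (h : ∀ i' j, i' ≠ i → (M' i' j ≠ 0 ↔ M i' j ≠ 0)) (h' : ∀ j, M' i j ≠ 0 ↔ ¬ M i j ≠ 0) :
    (univ.filter fun p : Fin n × Fin n => M' p.1 p.2 ≠ 0).card + 2 * (univ.filter fun j => M i j ≠ 0).card =
      (univ.filter fun p : Fin n × Fin n => M p.1 p.2 ≠ 0).card + n := by
  have := flip_row (fun i j => M i j ≠ 0) (fun i j => M' i j ≠ 0) i h h'
  convert this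

lemma flip_colZ {n : ℕ} (M M' : Fin n → Fin n → ZMod 2) (j : Fin n)
    (h : ∀ i j', j' ≠ j → (M' i j' ≠ 0 ↔ M i j' ≠ 0)) (h' : ∀ i, M' i j ≠ 0 ↔ ¬ M i j ≠ 0) :
    (univ.filter fun p : Fin n × Fin n => M' p.1 p.2 ≠ 0).card + 2 * (univ.filter fun i => M i j ≠ 0).card =
      (univ.filter fun p : Fin n × Fin n => M p.1 p.2 ≠ 0).card + n := by
  have := flip_col (fun i j => M i j ≠ 0) (fun i j => M' i j ≠ 0) j h h'
  convert this

lemma zmod_flip (x : ZMod 2) : x + 1 ≠ 0 ↔ ¬ (x ≠ 0) := by revert x; decide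

lemma cochain_ext {n : ℕ} (φ η : Cochain1 n) (h1 : φ.ab = η.ab) (h2 : φ.ac = η.ac) (h3 : φ.bc = η.bc) :
    φ = η := by
  cases φ; cases η; simp_all

lemma add_d0 {n : ℕ} (φ : Cochain1 n) (ψ χ : Fin 3 × Fin n → ZMod 2) :
    φ + d0 ψ + d0 χ = φ + d0 (ψ + χ) := by
  apply cochain_ext <;> funext i j
  · show φ.ab i j + (ψ (0,i) + ψ (1,j)) + (χ (0,i) + χ (1,j)) = φ.ab i j + ((ψ + χ) (0,i) + (ψ+χ) (1,j))
    simp only [Pi.add_apply]; ring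
  · show φ.ac i j + (ψ (0,i) + ψ (2,j)) + (χ (0,i) + χ (2,j)) = φ.ac i j + ((ψ + χ) (0,i) + (ψ+χ) (2,j))
    simp only [Pi.add_apply]; ring
  · show φ.bc i j + (ψ (1,i) + ψ (2,j)) + (χ (1,i) + χ (2,j)) = φ.bc i j + ((ψ + χ) (1,i) + (ψ+χ) (2,j))
    simp only [Pi.add_apply]; ring

lemma zmod_dbl (x : ZMod 2) : x + x = 0 := by revert x; decide

lemma normd1_add_d0 {n : ℕ} (T : Finset (Fin n × Fin n × Fin n)) (φ : Cochain1 n)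
    (ψ : Fin 3 × Fin n → ZMod 2) : normd1 T (φ + d0 ψ) = normd1 T φ := by
  have : ∀ i j k, d1 (φ + d0 ψ) i j k = d1 φ i j k := by
    intro i j k
    show φ.ab i j + (ψ (0,i) + ψ (1,j)) + (φ.ac i k + (ψ (0,i) + ψ (2,k))) +
      (φ.bc j k + (ψ (1,j) + ψ (2,k))) = φ.ab i j + φ.ac i k + φ.bc j k
    have h0 := zmod_dbl (ψ (0,i))
    have h1 := zmod_dbl (ψ (1,j))
    have h2 := zmod_dbl (ψ (2,k))
    linear_combination h0 + h1 + h2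
  unfold normd1
  simp only [this]

lemma min_rep {n : ℕ} (φ : Cochain1 n) : ∃ η : Cochain1 n, norm1 η = normClass1 φ ∧
    (∀ T, normd1 T η = normd1 T φ) ∧ ∀ χ, norm1 η ≤ norm1 (η + d0 χ) := by
  obtain ⟨ψ, hψ⟩ := Nat.sInf_mem (Set.range_nonempty fun ψ : Fin 3 × Fin n → ZMod 2 => norm1 (φ + d0 ψ))
  refine ⟨φ + d0 ψ, hψ, fun T => normd1_add_d0 T φ ψ, fun χ => ?_⟩
  rw [add_d0]
  have : norm1 (φ + d0 ψ) = normClass1 φ := hψ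
  rw [this]
  exact Nat.sInf_le ⟨ψ + χ, rfl⟩

lemma min_deg {n : ℕ} (η : Cochain1 n) (h : ∀ χ, norm1 η ≤ norm1 (η + d0 χ)) (v : Fin n) :
    ((univ.filter fun j => η.ab v j ≠ 0).card + (univ.filter fun k => η.ac v k ≠ 0).card ≤ n) ∧
    ((univ.filter fun k => η.bc v k ≠ 0).card + (univ.filter fun i => η.ab i v ≠ 0).card ≤ n) ∧
    ((univ.filter fun i => η.ac i v ≠ 0).card + (univ.filter fun j => η.bc j v ≠ 0).card ≤ n) := by
  refine ⟨?_, ?_, ?_⟩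
  · have hh := h (fun p => if p = (0, v) then 1 else 0)
    have e1 := flip_rowZ η.ab
      (η + d0 (fun p => if p = (0, v) then 1 else 0)).ab v
      (by
        intro i j hi
        show η.ab i j + ((if ((0:Fin 3), i) = (0, v) then (1:ZMod 2) else 0) + (if ((1:Fin 3), j) = (0, v) then 1 else 0)) ≠ 0 ↔ _
        simp [hi])
      (by
        intro j
        show η.ab v j + ((if ((0:Fin 3), v) = (0, v) then (1:ZMod 2) else 0) + (if ((1:Fin 3), j) = (0, v) then 1 else 0)) ≠ 0 ↔ _
        rw [← zmod_flip]; simp)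
    have e2 := flip_rowZ η.ac
      (η + d0 (fun p => if p = (0, v) then 1 else 0)).ac v
      (by
        intro i j hi
        show η.ac i j + ((if ((0:Fin 3), i) = (0, v) then (1:ZMod 2) else 0) + (if ((2:Fin 3), j) = (0, v) then 1 else 0)) ≠ 0 ↔ _
        simp [hi])
      (by
        intro j
        show η.ac v j + ((if ((0:Fin 3), v) = (0, v) then (1:ZMod 2) else 0) + (if ((2:Fin 3), j) = (0, v) then 1 else 0)) ≠ 0 ↔ _
        rw [← zmod_flip]; simp)
    have e3 : ∀ i j, (η + d0 (fun p => if p = (0, v) then 1 else 0)).bc i j = η.bc i j := by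
      intro i j
      show η.bc i j + ((if ((1:Fin 3), i) = (0, v) then (1:ZMod 2) else 0) + (if ((2:Fin 3), j) = (0, v) then 1 else 0)) = _
      simp
    unfold norm1 at hh
    simp only [e3] at hh
    omega
  · have hh := h (fun p => if p = (1, v) then 1 else 0)
    have e1 := flip_colZ η.ab
      (η + d0 (fun p => if p = (1, v) then 1 else 0)).ab v
      (by
        intro i j hi
        show η.ab i j + ((if ((0:Fin 3), i) = (1, v) then (1:ZMod 2) else 0) + (if ((1:Fin 3), j) = (1, v) then 1 else 0)) ≠ 0 ↔ _
        simp [hi])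
      (by
        intro i
        show η.ab i v + ((if ((0:Fin 3), i) = (1, v) then (1:ZMod 2) else 0) + (if ((1:Fin 3), v) = (1, v) then 1 else 0)) ≠ 0 ↔ _
        rw [← zmod_flip]; simp)
    have e2 := flip_rowZ η.bc
      (η + d0 (fun p => if p = (1, v) then 1 else 0)).bc v
      (by
        intro i j hi
        show η.bc i j + ((if ((1:Fin 3), i) = (1, v) then (1:ZMod 2) else 0) + (if ((2:Fin 3), j) = (1, v) then 1 else 0)) ≠ 0 ↔ _
        simp [hi])
      (by
        intro j
        show η.bc v j + ((if ((1:Fin 3), v) = (1, v) then (1:ZMod 2) else 0) + (if ((2:Fin 3), j) = (1, v) then 1 else 0)) ≠ 0 ↔ _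
        rw [← zmod_flip]; simp)
    have e3 : ∀ i j, (η + d0 (fun p => if p = (1, v) then 1 else 0)).ac i j = η.ac i j := by
      intro i j
      show η.ac i j + ((if ((0:Fin 3), i) = (1, v) then (1:ZMod 2) else 0) + (if ((2:Fin 3), j) = (1, v) then 1 else 0)) = _
      simp
    unfold norm1 at hh
    simp only [e3] at hh
    omega
  · have hh := h (fun p => if p = (2, v) then 1 else 0)
    have e1 := flip_colZ η.ac
      (η + d0 (fun p => if p = (2, v) then 1 else 0)).ac v
      (by
        intro i j hi
        show η.ac i j + ((if ((0:Fin 3), i) = (2, v) then (1:ZMod 2) else 0) + (if ((2:Fin 3), j) = (2, v) then 1 else 0)) ≠ 0 ↔ _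
        simp [hi])
      (by
        intro i
        show η.ac i v + ((if ((0:Fin 3), i) = (2, v) then (1:ZMod 2) else 0) + (if ((2:Fin 3), v) = (2, v) then 1 else 0)) ≠ 0 ↔ _
        rw [← zmod_flip]; simp)
    have e2 := flip_colZ η.bc
      (η + d0 (fun p => if p = (2, v) then 1 else 0)).bc v
      (by
        intro i j hi
        show η.bc i j + ((if ((1:Fin 3), i) = (2, v) then (1:ZMod 2) else 0) + (if ((2:Fin 3), j) = (2, v) then 1 else 0)) ≠ 0 ↔ _
        simp [hi])
      (by
        intro i
        show η.bc i v + ((if ((1:Fin 3), i) = (2, v) then (1:ZMod 2) else 0) + (if ((2:Fin 3), v) = (2, v) then 1 else 0)) ≠ 0 ↔ _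
        rw [← zmod_flip]; simp)
    have e3 : ∀ i j, (η + d0 (fun p => if p = (2, v) then 1 else 0)).ab i j = η.ab i j := by
      intro i j
      show η.ab i j + ((if ((0:Fin 3), i) = (2, v) then (1:ZMod 2) else 0) + (if ((1:Fin 3), j) = (2, v) then 1 else 0)) = _
      simp
    unfold norm1 at hh
    simp only [e3] at hh
    omega

lemma det_arith (d : ℕ) (hd : 2 ≤ d) (N E1 E2 E3 F1 F2 F3 G1 G2 G3 H1 H2 H3 S1 S2 S3 U1 U2 U3 D : ℕ)
    (K k W : ℝ) (hk : 0 ≤ k) (hN : N = E1 + E2 + E3)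
    (c1 : (d - 2) * E1 ≤ F1) (c2 : (d - 2) * E2 ≤ F2) (c3 : (d - 2) * E3 ≤ F3)
    (hlow : F1 + F2 + F3 ≤ D + 2 * (G1 + G2 + G3)) (t1 : G1 ≤ H1) (t2 : G2 ≤ H2) (t3 : G3 ≤ H3)
    (l1 : (H1 : ℝ) ≤ K * S1 + k * U1) (l2 : (H2 : ℝ) ≤ K * S2 + k * U2) (l3 : (H3 : ℝ) ≤ K * S3 + k * U3)
    (b1 : S1 + S2 + S3 = 2 * N) (b2 : (U1 : ℝ) + U2 + U3 ≤ W) :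
    ((d:ℝ) - 2) * N ≤ D + 2 * (K * (2 * N) + k * W) := by
  have h0 : (d - 2) * N ≤ D + 2 * (H1 + H2 + H3) := by
    subst hN; rw [mul_add, mul_add]; omega
  have h1 : (((d - 2) * N : ℕ) : ℝ) ≤ ((D + 2 * (H1 + H2 + H3) : ℕ) : ℝ) := by exact_mod_cast h0
  rw [Nat.cast_mul, Nat.cast_sub hd] at h1
  push_cast at h1
  have h2 : (S1 : ℝ) + S2 + S3 = 2 * N := by exact_mod_cast b1
  have h3 := mul_le_mul_of_nonneg_left b2 hk
  have h4 : K * (2 * N) = K * S1 + K * S2 + K * S3 := by rw [← h2]; ring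
  rw [h4]
  linarith

lemma det {n d : ℕ} (hn : 0 < n) (hd : 100 ≤ d) (θ : ℝ) (hθ : 0 < θ) (hθ1 : θ ≤ 1)
    (Ls : Fin d → LatinSquare n) (hG : Good θ Ls) (η : Cochain1 n)
    (h : ∀ χ, norm1 η ≤ norm1 (η + d0 χ)) :
    ((d:ℝ) - 2) * norm1 η ≤ normd1 (triangles Ls) η +
      2 * (((d:ℝ) * θ / 4 + 26 / 25 * Real.sqrt d) * (2 * norm1 η) +
        (d:ℝ) * (1 - θ) / 4 * (norm1 η + 4 * (norm1 η:ℝ) ^ 2 / (3 * θ ^ 2 * n ^ 2))) := by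
  have hdeg := min_deg η h
  have hT : ∀ i j k, (i, j, k) ∈ triangles Ls ↔ ∃ m, (Ls m).1 i j = k := by
    intro i j k; simp [triangles]
  have hlow := normd1_lower (triangles Ls) η
  have c1 := edge_count (D := d - 2) (triangles Ls) (fun t => (t.1, t.2.1))
    (univ.filter fun p : Fin n × Fin n => η.ab p.1 p.2 ≠ 0) (by
      rintro ⟨i, j⟩ _
      refine (hG.da i j).trans (Finset.card_le_card_of_injOn (fun k => (i, j, k)) ?_ ?_)
      · intro k hk
        obtain ⟨m, _, hm⟩ := Finset.mem_image.1 (Finset.mem_coe.1 hk)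
        exact Finset.mem_coe.2 (Finset.mem_filter.2 ⟨(hT _ _ _).2 ⟨m, hm⟩, rfl⟩)
      · intro k _ k' _ hh; simpa using hh)
  have c2 := edge_count (D := d - 2) (triangles Ls) (fun t => (t.1, t.2.2))
    (univ.filter fun p : Fin n × Fin n => η.ac p.1 p.2 ≠ 0) (by
      rintro ⟨i, k⟩ _
      refine (hG.dc k i).trans (Finset.card_le_card_of_injOn (fun j => (i, j, k)) ?_ ?_)
      · intro j hj
        obtain ⟨m, _, hm⟩ := Finset.mem_image.1 (Finset.mem_coe.1 hj)
        exact Finset.mem_coe.2 (Finset.mem_filter.2 ⟨(hT _ _ _).2 ⟨m, (fc_iff _ _ _ _).1 hm⟩, rfl⟩)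
      · intro k _ k' _ hh; simpa using hh)
  have c3 := edge_count (D := d - 2) (triangles Ls) (fun t => (t.2.1, t.2.2))
    (univ.filter fun p : Fin n × Fin n => η.bc p.1 p.2 ≠ 0) (by
      rintro ⟨j, k⟩ _
      refine (hG.db j k).trans (Finset.card_le_card_of_injOn (fun i => (i, j, k)) ?_ ?_)
      · intro i hi
        obtain ⟨m, _, hm⟩ := Finset.mem_image.1 (Finset.mem_coe.1 hi)
        exact Finset.mem_coe.2 (Finset.mem_filter.2 ⟨(hT _ _ _).2 ⟨m, (fb_iff _ _ _ _).1 hm⟩, rfl⟩)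
      · intro k _ k' _ hh; simpa using hh)
  simp only [mem_filter, mem_univ, true_and] at c1 c2 c3
  have t1 := tri_count fa Ls (fun i => univ.filter fun j => η.ab i j ≠ 0)
    (fun i => univ.filter fun k => η.ac i k ≠ 0)
    ((triangles Ls).filter fun t => η.ab t.1 t.2.1 ≠ 0 ∧ η.ac t.1 t.2.2 ≠ 0)
    (fun t => t.1) (fun i j k => (i, j, k)) (by
      rintro ⟨i, j, k⟩ ht
      obtain ⟨ht, h1, h2⟩ := Finset.mem_filter.1 ht
      obtain ⟨m, hm⟩ := (hT _ _ _).1 ht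
      have hm' : fa i (Ls m) j = k := hm
      refine ⟨m, j, by simpa using h1, ?_⟩
      simp only [hm']
      exact ⟨by simpa using h2, trivial⟩)
  have t2 := tri_count fb Ls (fun j => univ.filter fun k => η.bc j k ≠ 0)
    (fun j => univ.filter fun i => η.ab i j ≠ 0)
    ((triangles Ls).filter fun t => η.bc t.2.1 t.2.2 ≠ 0 ∧ η.ab t.1 t.2.1 ≠ 0)
    (fun t => t.2.1) (fun j k i => (i, j, k)) (by
      rintro ⟨i, j, k⟩ ht
      obtain ⟨ht, h1, h2⟩ := Finset.mem_filter.1 ht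
      obtain ⟨m, hm⟩ := (hT _ _ _).1 ht
      have hm' : fb j (Ls m) k = i := (fb_iff _ _ _ _).2 hm
      refine ⟨m, k, by simpa using h1, ?_⟩
      simp only [hm']
      exact ⟨by simpa using h2, trivial⟩)
  have t3 := tri_count fc Ls (fun k => univ.filter fun i => η.ac i k ≠ 0)
    (fun k => univ.filter fun j => η.bc j k ≠ 0)
    ((triangles Ls).filter fun t => η.ac t.1 t.2.2 ≠ 0 ∧ η.bc t.2.1 t.2.2 ≠ 0)
    (fun t => t.2.2) (fun k i j => (i, j, k)) (by
      rintro ⟨i, j, k⟩ ht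
      obtain ⟨ht, h1, h2⟩ := Finset.mem_filter.1 ht
      obtain ⟨m, hm⟩ := (hT _ _ _).1 ht
      have hm' : fc k (Ls m) i = j := (fc_iff _ _ _ _).2 hm
      refine ⟨m, i, by simpa using h1, ?_⟩
      simp only [hm']
      exact ⟨by simpa using h2, trivial⟩)
  have l1 := link_sum fa Ls θ hG.la hG.la' (fun i => univ.filter fun j => η.ab i j ≠ 0)
    (fun i => univ.filter fun k => η.ac i k ≠ 0) (fun i => (hdeg i).1)
  have l2 := link_sum fb Ls θ hG.lb hG.lb' (fun j => univ.filter fun k => η.bc j k ≠ 0)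
    (fun j => univ.filter fun i => η.ab i j ≠ 0) (fun i => (hdeg i).2.1)
  have l3 := link_sum fc Ls θ hG.lc hG.lc' (fun k => univ.filter fun i => η.ac i k ≠ 0)
    (fun k => univ.filter fun j => η.bc j k ≠ 0) (fun i => (hdeg i).2.2)
  obtain ⟨b1, b2⟩ := big_sum (fun i j => η.ab i j ≠ 0) (fun i k => η.ac i k ≠ 0) (fun j k => η.bc j k ≠ 0)
    θ hθ hn (fun i => (univ.filter fun j => η.ab i j ≠ 0).card + (univ.filter fun k => η.ac i k ≠ 0).card)
    (fun j => (univ.filter fun k => η.bc j k ≠ 0).card + (univ.filter fun i => η.ab i j ≠ 0).card)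
    (fun k => (univ.filter fun i => η.ac i k ≠ 0).card + (univ.filter fun j => η.bc j k ≠ 0).card)
    (fun i => by congr!) (fun i => by congr!) (fun i => by congr!) (norm1 η) (by unfold norm1; congr!)
  have hk : 0 ≤ (d:ℝ) * (1 - θ) / 4 := by
    have : 0 ≤ 1 - θ := by linarith
    positivity
  exact det_arith d (by omega) (norm1 η) _ _ _ _ _ _ _ _ _ _ _ _ _ _ _ _ _ _ _ _ _ _ hk rfl c1 c2 c3 hlow
    t1 t2 t3 l1 l2 l3 b1 b2

lemma fin_arith (x t θ : ℝ) (hx : 10 ≤ x) (ht : 0 < t) (hθ : θ = max t (1/20))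
    (hR : 0 < (x ^ 2 - 3 * x) * (1 - t) / 2 - x ^ 2 / 3) :
    (x ^ 2 - 3 * x) * (1 - t) / 2 - x ^ 2 / 3 ≤
      x ^ 2 - 2 - 2 * ((x ^ 2 * θ / 4 + 26 / 25 * x) * 2 + x ^ 2 * (1 - θ) / 4 * (1 + 4 * t / 3)) := by
  have h1 : 3 * t * (x - 3) < x - 9 := by
    by_contra hcon
    push Not at hcon
    nlinarith
  have ht3 : t < 1 / 3 := by
    by_contra hcon
    push Not at hcon
    nlinarith
  have key : ∀ s : ℝ, 0 ≤ s → 3 * s * (x - 3) ≤ x - 9 → s ≤ 1/3 →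
      0 ≤ x ^ 2 / 3 - 2 - 2.66 * x - 2 / 3 * s * x ^ 2 - 1.5 * x * s := by
    intro s hs h hs3
    have hx3 : 0 < x - 3 := by linarith
    have : 0 ≤ (x - 3) * (x ^ 2 / 3 - 2 - 2.66 * x - 2 / 3 * s * x ^ 2 - 1.5 * x * s) := by
      have h2 : (s * (x - 3)) * (2 / 3 * x ^ 2 + 1.5 * x) ≤ ((x - 9) / 3) * (2 / 3 * x ^ 2 + 1.5 * x) := by
        apply mul_le_mul_of_nonneg_right
        · linarith
        · positivity
      have h3 : 0 ≤ (x - 3) * (x ^ 2 / 3 - 2 - 2.66 * x) - ((x - 9) / 3) * (2 / 3 * x ^ 2 + 1.5 * x) := by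
        nlinarith [mul_nonneg (sub_nonneg.2 hx) (sq_nonneg (x - 11)), sq_nonneg (x - 11), mul_nonneg (sub_nonneg.2 hx) (sq_nonneg (x - 10))]
      nlinarith
    exact nonneg_of_mul_nonneg_right this hx3
  rcases le_total (1/20) t with h | h
  · rw [max_eq_left h] at hθ
    subst hθ
    have := key θ ht.le h1.le ht3.le
    nlinarith [sq_nonneg (θ * x)]
  · rw [max_eq_right h] at hθ
    subst hθ
    nlinarith [mul_nonneg (sub_nonneg.2 h) (sub_nonneg.2 hx), mul_nonneg (sub_nonneg.2 h) (sq_nonneg x), sq_nonneg (x - 10), mul_nonneg (sub_nonneg.2 hx) (sub_nonneg.2 hx)]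

lemma prop_of_good {n d : ℕ} (hn : 0 < n) (hd : 100 ≤ d) (c t θ : ℝ) (ht : 0 < t) (ht1 : t < 1) (htc : t ^ 3 = c)
    (hθ : θ = max t (1/20))
    (hR : 0 < ((d:ℝ) - 3 * Real.sqrt d) * (1 - t) / 2 - (d:ℝ) / 3)
    (Ls : Fin d → LatinSquare n) (hG : Good θ Ls) (φ : Cochain1 n) (h0 : 0 < normClass1 φ)
    (h1 : (normClass1 φ : ℝ) ≤ c * (n : ℝ) ^ 2) :
    ((d : ℝ) - 3 * Real.sqrt d) * (1 - t) / 2 - (d : ℝ) / 3 ≤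
                (normd1 (triangles Ls) φ : ℝ) / (normClass1 φ : ℝ) := by
  obtain ⟨η, e1, e2, e3⟩ := min_rep φ
  have hθ0 : 0 < θ := by rw [hθ]; exact lt_of_lt_of_le ht (le_max_left _ _)
  have htθ : t ≤ θ := by rw [hθ]; exact le_max_left _ _
  have hθ1 : θ ≤ 1 := by rw [hθ]; exact max_le ht1.le (by norm_num)
  have hdet := det hn hd θ hθ0 hθ1 Ls hG η e3
  rw [e1, e2] at hdet
  have hN : (0:ℝ) < normClass1 φ := by exact_mod_cast h0
  have hn' : (0:ℝ) < n := by exact_mod_cast hn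
  rw [le_div_iff₀ hN]
  set N : ℝ := (normClass1 φ : ℝ) with hNdef
  set x := Real.sqrt d with hxdef
  have hx2 : (d:ℝ) = x ^ 2 := (Real.sq_sqrt (by positivity)).symm
  have hx : 10 ≤ x := by
    apply Real.le_sqrt_of_sq_le
    have : (100:ℝ) ≤ d := by exact_mod_cast hd
    linarith
  rw [hx2] at hdet hR ⊢
  have hA := fin_arith x t θ hx ht hθ hR
  have hq : 4 * N ^ 2 / (3 * θ ^ 2 * n ^ 2) ≤ N * (4 * t / 3) := by
    rw [div_le_iff₀ (by positivity)]
    have h3 : N ≤ t * θ ^ 2 * n ^ 2 := by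
      refine h1.trans ?_
      rw [← htc]
      have : t ^ 3 ≤ t * θ ^ 2 := by
        have : t ^ 2 ≤ θ ^ 2 := pow_le_pow_left₀ ht.le htθ 2
        nlinarith
      exact mul_le_mul_of_nonneg_right this (by positivity)
    have := mul_le_mul_of_nonneg_left h3 hN.le
    nlinarith
  have hk : 0 ≤ x ^ 2 * (1 - θ) / 4 := by
    have : 0 ≤ 1 - θ := by linarith
    positivity
  have h5 := mul_le_mul_of_nonneg_left hq hk
  have h6 := mul_le_mul_of_nonneg_right hA hN.le
  nlinarith

/-- **Corollary (expansion of small cochains, random version).** Fix `d ≥ 100` and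
`0 < c < 1`. With probability `1 − O(n⁻¹)` over `Y = Y(L^d) ∈ 𝓨(n,d)`, every
`1`-cochain `φ` of `T_n` with `0 < ‖[φ]‖ ≤ c·n²` satisfies
`‖d_1 φ‖_Y / ‖[φ]‖ ≥ (d − 3√d)·(1 − c^{1/3})/2 − d/3`. -/
theorem small_cochain_expansion_whp (d : ℕ) (hd : 100 ≤ d) (c : ℝ)
    (hc0 : 0 < c) (hc1 : c < 1) :
    ∃ C : ℝ, ∀ n : ℕ, 0 < n →
      (1 : ℝ) - C / (n : ℝ) ≤
        (((univ : Finset (Fin d → LatinSquare n)).filter fun Ls =>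
            ∀ φ : Cochain1 n, 0 < normClass1 φ → (normClass1 φ : ℝ) ≤ c * (n : ℝ) ^ 2 →
              ((d : ℝ) - 3 * Real.sqrt d) * (1 - c ^ ((1 : ℝ) / 3)) / 2 - (d : ℝ) / 3 ≤
                (normd1 (triangles Ls) φ : ℝ) / (normClass1 φ : ℝ)).card : ℝ) /
          ((univ : Finset (Fin d → LatinSquare n)).card : ℝ) := by
  classical
  set t : ℝ := c ^ ((1:ℝ)/3) with htdef
  have ht : 0 < t := Real.rpow_pos_of_pos hc0 _
  have ht1 : t < 1 := Real.rpow_lt_one hc0.le hc1 (by norm_num)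
  have htc : t ^ 3 = c := by
    rw [htdef, ← Real.rpow_natCast, ← Real.rpow_mul hc0.le]; norm_num
  have hpos : ∀ n : ℕ, 0 < n → (0:ℝ) < ((univ : Finset (Fin d → LatinSquare n)).card : ℝ) := by
    intro n hn
    have := latin_nonempty n hn
    exact_mod_cast Finset.card_pos.2 Finset.univ_nonempty
  by_cases hR : 0 < ((d:ℝ) - 3 * Real.sqrt d) * (1 - t) / 2 - (d:ℝ) / 3
  swap
  · refine ⟨0, fun n hn => ?_⟩
    rw [Finset.filter_true_of_mem, div_self (hpos n hn).ne']
    · simp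
    · intro Ls _ φ _ _
      exact (not_lt.1 hR).trans (by positivity)
  · obtain ⟨C, hC⟩ := good_bound d hd (max t (1/20)) (le_max_right _ _) (max_le ht1.le (by norm_num))
    refine ⟨C, fun n hn => ?_⟩
    have hp := hpos n hn
    rw [le_div_iff₀ hp, cnt_eq]
    have hg := hC n hn
    have h1 : cnt (fun Ls : Fin d → LatinSquare n => Good (max t (1/20)) Ls) ≤ _ :=
      cnt_mono (fun Ls hG φ h0 h1 => prop_of_good hn hd c t _ ht ht1 htc rfl hR Ls hG φ h0 h1)
    have h2 : cnt (fun Ls : Fin d → LatinSquare n => Good (max t (1/20)) Ls) +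
        cnt (fun Ls : Fin d → LatinSquare n => ¬ Good (max t (1/20)) Ls) =
        ((univ : Finset (Fin d → LatinSquare n)).card : ℝ) := by
      rw [← cnt_eq, ← cnt_eq]
      exact_mod_cast Finset.card_filter_add_card_filter_not _
    linarith
end
end
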